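/- arXiv:1609.00303 — 3 statements merged into one kernel-verified Lean document; each statement's English description precedes it below -/
import Mathlib

section
/- Let G be a group with a non-elementary action by homeomorphisms on a dendrite X (i.e., G fixes no point and preserves no two-point set), and let M be the unique minimal nonempty closed G-invariant subset of X. Then every homeomorphism of X commuting with the G-action fixes every point of M. -/
open Set

/-- A dendrite: a nonempty compact connected metrizable space that is locally
connected and contains no simple closed curve. -/
def IsDendrite (X : Type*) [TopologicalSpace X] : Prop :=
  Nonempty X ∧ CompactSpace X ∧ ConnectedSpace X ∧ TopologicalSpace.MetrizableSpace X ∧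
    LocallyConnectedSpace X ∧ ¬ ∃ S : Set X, Nonempty (S ≃ₜ Circle)

/-- An action is elementary if it fixes a point or preserves a two-point set. -/
def ElementaryAction (G X : Type*) [Group G] [TopologicalSpace X] [MulAction G X] : Prop :=
  (∃ x : X, ∀ g : G, g • x = x) ∨
    (∃ P : Set X, P.ncard = 2 ∧ ∀ g : G, (g • ·) '' P = P)



namespace DendriteAux
open Filter Topology

/-- Polygonal paths with vertices in the image of `X` whose consecutive vertices lie in a common
small connected set. -/
inductive Poly {X E : Type*} [MetricSpace X] [NormedAddCommGroup E] [NormedSpace ℝ E]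
    (ι : X → E) (ε : ℝ) : (x y : X) → Path (ι x) (ι y) → Prop
  | seg (x y : X) (V : Set X) (hV : IsPreconnected V) (hx : x ∈ V) (hy : y ∈ V)
      (hd : ∀ a ∈ V, ∀ b ∈ V, dist a b ≤ ε) : Poly ι ε x y (Path.segment (ι x) (ι y))
  | trans (x y z : X) (γ₁ : Path (ι x) (ι y)) (γ₂ : Path (ι y) (ι z))
      (h₁ : Poly ι ε x y γ₁) (h₂ : Poly ι ε y z γ₂) : Poly ι ε x z (γ₁.trans γ₂)

lemma dist_segment_le {E : Type*} [NormedAddCommGroup E] [NormedSpace ℝ E]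
    (a b : E) (t : unitInterval) : dist (Path.segment a b t) a ≤ dist a b := by
  rw [Path.segment_apply, dist_lineMap_left, Real.norm_eq_abs, abs_of_nonneg t.2.1]
  exact mul_le_of_le_one_left dist_nonneg t.2.2

lemma exists_small_conn {X : Type*} [MetricSpace X] [LocallyConnectedSpace X] (x : X) {ε : ℝ}
    (hε : 0 < ε) : ∃ V : Set X, IsOpen V ∧ x ∈ V ∧ IsPreconnected V ∧
      ∀ a ∈ V, ∀ b ∈ V, dist a b ≤ ε := by
  obtain ⟨V, hVs, hVo, hxV, hVc⟩ := locallyConnectedSpace_iff_subsets_isOpen_isConnected.1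
    ‹LocallyConnectedSpace X› x (Metric.ball x (ε / 2)) (Metric.ball_mem_nhds x (by linarith))
  refine ⟨V, hVo, hxV, hVc.isPreconnected, fun a ha b hb => ?_⟩
  have h1 := hVs ha
  have h2 := hVs hb
  rw [Metric.mem_ball] at h1 h2
  have := dist_triangle_right a b x
  linarith

section
variable {X E : Type*} [MetricSpace X] [NormedAddCommGroup E] [NormedSpace ℝ E]
    {ι : X → E} (hι : Isometry ι)
include hι

lemma Poly.near {ε : ℝ} {x y : X} {γ : Path (ι x) (ι y)} (h : Poly ι ε x y γ) (t : unitInterval) :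
    ∃ z, dist (γ t) (ι z) ≤ ε := by
  induction h generalizing t with
  | seg x y V hV hx hy hd =>
    exact ⟨x, (dist_segment_le _ _ _).trans (by rw [hι.dist_eq]; exact hd _ hx _ hy)⟩
  | trans x y z γ₁ γ₂ h₁ h₂ ih₁ ih₂ =>
    rw [Path.trans_apply]
    split_ifs
    · exact ih₁ _
    · exact ih₂ _

lemma exists_poly [LocallyConnectedSpace X] {ε : ℝ} (hε : 0 < ε) {C : Set X}
    (hC : IsPreconnected C) {x y : X} (hx : x ∈ C) (hy : y ∈ C) :
    ∃ γ : Path (ι x) (ι y), Poly ι ε x y γ ∧ ∀ t, ∃ z ∈ C, dist (γ t) (ι z) ≤ ε := by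
  refine hC.induction₂' (fun x y => ∃ γ : Path (ι x) (ι y), Poly ι ε x y γ ∧
    ∀ t, ∃ z ∈ C, dist (γ t) (ι z) ≤ ε) ?_ ?_ hx hy
  · intro x hx
    obtain ⟨V, hVo, hxV, hVc, hVd⟩ := exists_small_conn x hε
    filter_upwards [mem_nhdsWithin_of_mem_nhds (hVo.mem_nhds hxV), self_mem_nhdsWithin]
      with y hyV hy
    refine ⟨⟨_, Poly.seg x y V hVc hxV hyV hVd, fun t => ⟨x, hx, ?_⟩⟩,
      ⟨_, Poly.seg y x V hVc hyV hxV hVd, fun t => ⟨y, hy, ?_⟩⟩⟩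
    · exact (dist_segment_le _ _ _).trans (by rw [hι.dist_eq]; exact hVd _ hxV _ hyV)
    · exact (dist_segment_le _ _ _).trans (by rw [hι.dist_eq]; exact hVd _ hyV _ hxV)
  · rintro x y z hx hy hz ⟨γ₁, h₁, h₁'⟩ ⟨γ₂, h₂, h₂'⟩
    refine ⟨_, Poly.trans _ _ _ _ _ h₁ h₂, fun t => ?_⟩
    rw [Path.trans_apply]
    split_ifs
    · exact h₁' _
    · exact h₂' _

lemma Poly.refine_path [LocallyConnectedSpace X] {ε δ : ℝ} (hδ : 0 < δ) (hδε : δ ≤ ε) {x y : X}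
    {γ : Path (ι x) (ι y)} (h : Poly ι ε x y γ) :
    ∃ γ' : Path (ι x) (ι y), Poly ι δ x y γ' ∧ ∀ t, dist (γ t) (γ' t) ≤ 3 * ε := by
  induction h with
  | seg x y V hV hx hy hd =>
    obtain ⟨γ', h1, h2⟩ := exists_poly hι hδ hV hx hy
    refine ⟨γ', h1, fun t => ?_⟩
    obtain ⟨z, hz, hzd⟩ := h2 t
    have e1 := dist_segment_le (ι x) (ι y) t
    rw [hι.dist_eq] at e1
    have e2 := hd _ hx _ hy
    have e3 := hd _ hx _ hz
    have e4 := dist_triangle (Path.segment (ι x) (ι y) t) (ι x) (γ' t)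
    have e5 := dist_triangle_right (ι x) (γ' t) (ι z)
    rw [hι.dist_eq] at e5
    linarith
  | trans x y z γ₁ γ₂ h₁ h₂ ih₁ ih₂ =>
    obtain ⟨γ₁', a₁, b₁⟩ := ih₁
    obtain ⟨γ₂', a₂, b₂⟩ := ih₂
    refine ⟨_, Poly.trans _ _ _ _ _ a₁ a₂, fun t => ?_⟩
    rw [Path.trans_apply, Path.trans_apply]
    split_ifs
    · exact b₁ _
    · exact b₂ _

lemma joinedIn_aux [CompleteSpace E] [CompactSpace X] [LocallyConnectedSpace X] {ε : ℝ}
    (hε : 0 < ε)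
    {V : Set X} (hV : IsPreconnected V) (hd : ∀ a ∈ V, ∀ b ∈ V, dist a b ≤ ε) {x y : X}
    (hx : x ∈ V) (hy : y ∈ V) : JoinedIn (Metric.ball x (8 * ε)) x y := by
  have hpos : ∀ n : ℕ, 0 < ε * (1 / 2) ^ n := fun n => by positivity
  let T : ℕ → Type _ := fun n => {γ : Path (ι x) (ι y) // Poly ι (ε * (1 / 2) ^ n) x y γ}
  have step : ∀ n (γ : T n), ∃ γ' : T (n + 1), ∀ t, dist (γ.1 t) (γ'.1 t) ≤
      3 * (ε * (1 / 2) ^ n) := by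
    intro n γ
    obtain ⟨γ', h1, h2⟩ := γ.2.refine_path hι (hpos (n + 1))
      (by rw [pow_succ]; have := hpos n; linarith)
    exact ⟨⟨γ', h1⟩, h2⟩
  choose nxt hnxt using step
  let s : (n : ℕ) → T n := fun n => Nat.rec (motive := T)
    ⟨Path.segment (ι x) (ι y), by simpa using Poly.seg x y V hV hx hy hd⟩ (fun n γ => nxt n γ) n
  have hs : ∀ n t, dist ((s n).1 t) ((s (n + 1)).1 t) ≤ 3 * (ε * (1 / 2) ^ n) :=
    fun n t => hnxt n (s n) t
  let f : ℕ → C(unitInterval, E) := fun n => (s n).1.toContinuousMap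
  have hf : ∀ n, dist (f n) (f (n + 1)) ≤ (3 * ε) * (1 / 2) ^ n := by
    intro n
    rw [ContinuousMap.dist_le (by have := hpos n; linarith)]
    intro t
    rw [mul_assoc]
    exact hs n t
  obtain ⟨F, hF⟩ := cauchySeq_tendsto_of_complete
    (cauchySeq_of_le_geometric (1 / 2) (3 * ε) (by norm_num) hf)
  have hF0 := dist_le_of_le_geometric_of_tendsto₀ (1 / 2) (3 * ε) (by norm_num) hf hF
  have hFt : ∀ t, Tendsto (fun n => f n t) atTop (𝓝 (F t)) := fun t =>
    ((continuous_eval_const (F := C(unitInterval, E)) t).tendsto F).comp hF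
  have hcl : IsClosed (range ι) := (isCompact_range hι.continuous).isClosed
  have hrange : ∀ t, F t ∈ range ι := by
    intro t
    rw [← hcl.closure_eq, Metric.mem_closure_iff]
    intro η hη
    have h1 : ∀ᶠ n in atTop, dist (f n t) (F t) < η / 2 :=
      (hFt t).eventually (Metric.ball_mem_nhds _ (by linarith))
    have h2 : ∀ᶠ n : ℕ in atTop, ε * (1 / 2) ^ n < η / 2 := by
      have : Tendsto (fun n : ℕ => ε * (1 / 2 : ℝ) ^ n) atTop (𝓝 (ε * 0)) :=
        (tendsto_pow_atTop_nhds_zero_of_lt_one (by norm_num) (by norm_num)).const_mul ε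
      rw [mul_zero] at this
      exact this.eventually (gt_mem_nhds (by linarith))
    obtain ⟨n, hn1, hn2⟩ := (h1.and h2).exists
    obtain ⟨z, hz⟩ := (s n).2.near hι t
    refine ⟨_, mem_range_self z, ?_⟩
    have := dist_triangle_left (F t) (ι z) (f n t)
    have e : dist (f n t) (ι z) ≤ ε * (1 / 2) ^ n := hz
    linarith
  choose g hg using hrange
  have hgc : Continuous g := by
    rw [hι.isEmbedding.continuous_iff]
    have : ι ∘ g = F := funext hg
    rw [this]; exact F.continuous
  have hg0 : g 0 = x := by
    apply hι.injective
    rw [hg]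
    refine tendsto_nhds_unique (hFt 0) ?_
    have : (fun n => f n 0) = fun _ => ι x := funext fun n => (s n).1.source
    rw [this]; exact tendsto_const_nhds
  have hg1 : g 1 = y := by
    apply hι.injective
    rw [hg]
    refine tendsto_nhds_unique (hFt 1) ?_
    have : (fun n => f n 1) = fun _ => ι y := funext fun n => (s n).1.target
    rw [this]; exact tendsto_const_nhds
  refine ⟨⟨⟨g, hgc⟩, hg0, hg1⟩, fun t => ?_⟩
  change dist (g t) x < 8 * ε
  rw [← hι.dist_eq, hg]
  have e1 := (ContinuousMap.dist_apply_le_dist (f := f 0) (g := F) t).trans hF0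
  have e2 : dist (f 0 t) (ι x) ≤ dist (ι x) (ι y) := dist_segment_le (ι x) (ι y) t
  rw [hι.dist_eq] at e2
  have e3 := hd _ hx _ hy
  have e4 := dist_triangle_left (F t) (ι x) (f 0 t)
  have : 3 * ε / (1 - 1 / 2) = 6 * ε := by ring
  rw [this] at e1
  linarith

end

/-- A compact locally connected metric space is locally path connected. -/
lemma locallyPathConnected (X : Type*) [MetricSpace X] [CompactSpace X] [LocallyConnectedSpace X] :
    LocallyPathConnectedSpace X := by
  constructor
  intro x
  rw [hasBasis_self]
  intro t ht
  obtain ⟨r, hr, hrt⟩ := Metric.mem_nhds_iff.1 ht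
  obtain ⟨V, hVo, hxV, hVc, hVd⟩ := exists_small_conn x (show 0 < r / 8 by linarith)
  refine ⟨pathComponentIn (Metric.ball x r) x, ?_, ?_, pathComponentIn_subset.trans hrt⟩
  · refine mem_of_superset (hVo.mem_nhds hxV) fun y hy => ?_
    have := joinedIn_aux (kuratowskiEmbedding.isometry X) (by linarith) hVc hVd hxV hy
    rw [show 8 * (r / 8) = r by ring] at this
    exact this
  · exact isPathConnected_pathComponentIn (Metric.mem_ball_self hr)



/-- Running minimum of the distance to `x` along `δ`. -/
noncomputable def runMin {X : Type*} [MetricSpace X] (δ : unitInterval → X) (x : X)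
    (t : unitInterval) : ℝ := sInf ((fun s : unitInterval => dist x (δ (min s t))) '' univ)

section
variable {X : Type*} [MetricSpace X] {δ : unitInterval → X} (hδ : Continuous δ)

lemma runMin_le (x : X) {u t : unitInterval} (h : u ≤ t) : runMin δ x t ≤ dist x (δ u) := by
  refine csInf_le ⟨0, ?_⟩ ⟨u, mem_univ _, by simp only [min_eq_left h]⟩
  rintro _ ⟨s, -, rfl⟩
  exact dist_nonneg

include hδ

lemma runMin_continuous (x : X) : Continuous (runMin δ x) := by
  unfold runMin
  refine isCompact_univ.continuous_sInf
    (f := fun t s : unitInterval => dist x (δ (min s t))) ?_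
  simp only [Function.HasUncurry.uncurry, id]
  fun_prop

lemma runMin_attained (x : X) (t : unitInterval) : ∃ u ≤ t, runMin δ x t = dist x (δ u) := by
  have hc : ContinuousOn (fun s : unitInterval => dist x (δ (min s t))) univ := by
    apply Continuous.continuousOn; fun_prop
  obtain ⟨s, -, hs, -⟩ := isCompact_univ.exists_sInf_image_eq_and_le univ_nonempty hc
  exact ⟨min s t, min_le_right _ _, hs⟩

lemma runMin_anti (x : X) {s t : unitInterval} (h : s ≤ t) : runMin δ x t ≤ runMin δ x s := by
  obtain ⟨u, hu, e⟩ := runMin_attained hδ x s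
  rw [e]; exact runMin_le x (hu.trans h)

/-- A path with order-convex fibres, reparametrised to an injective path. -/
lemma arc_of_monotone [CompactSpace X]
    (hconv : ∀ s t u, s ≤ t → t ≤ u → δ s = δ u → δ t = δ u) (h01 : δ 0 ≠ δ 1) :
    ∃ α : unitInterval → X, Continuous α ∧ Function.Injective α ∧ α 0 = δ 0 ∧ α 1 = δ 1 ∧
      range α ⊆ range δ := by
  have : Nonempty X := ⟨δ 0⟩
  let x := TopologicalSpace.denseSeq X
  obtain ⟨D, hD⟩ := (Metric.isBounded_iff.1 (isCompact_univ : IsCompact (univ : Set X)).isBounded)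
  have hnn : ∀ n t, 0 ≤ runMin δ (x n) t := fun n t => by
    obtain ⟨u, -, e⟩ := runMin_attained hδ (x n) t
    rw [e]; exact dist_nonneg
  have hbd : ∀ n t, runMin δ (x n) t ≤ D := fun n t => by
    obtain ⟨u, -, e⟩ := runMin_attained hδ (x n) t
    rw [e]; exact hD (mem_univ _) (mem_univ _)
  have hsumD : Summable (fun n : ℕ => (1 / 2 : ℝ) ^ n * D) :=
    (summable_geometric_of_lt_one (by norm_num) (by norm_num)).mul_right D
  have hsum : ∀ t, Summable (fun n : ℕ => (1 / 2 : ℝ) ^ n * runMin δ (x n) t) := fun t =>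
    Summable.of_nonneg_of_le (fun n => mul_nonneg (by positivity) (hnn n t))
      (fun n => mul_le_mul_of_nonneg_left (hbd n t) (by positivity)) hsumD
  let φ : unitInterval → ℝ := fun t => ∑' n : ℕ, (1 / 2 : ℝ) ^ n * runMin δ (x n) t
  have hφc : Continuous φ := by
    refine continuous_tsum (fun n => continuous_const.mul (runMin_continuous hδ (x n))) hsumD ?_
    intro n t
    rw [Real.norm_eq_abs, abs_of_nonneg (mul_nonneg (by positivity) (hnn n t))]
    exact mul_le_mul_of_nonneg_left (hbd n t) (by positivity)
  have hφanti : ∀ s t, s ≤ t → φ t ≤ φ s := fun s t h =>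
    (hsum t).tsum_le_tsum (fun n => mul_le_mul_of_nonneg_left (runMin_anti hδ _ h) (by positivity))
      (hsum s)
  have hφlt : ∀ s t, s ≤ t → δ s ≠ δ t → φ t < φ s := by
    intro s t h hne
    have hcomp : IsCompact (δ '' Iic s) := (isClosed_Iic.isCompact).image hδ
    have hnot : δ t ∉ δ '' Iic s := by
      rintro ⟨u, hu, e⟩
      exact hne (hconv u s t hu h e)
    have hpos : 0 < Metric.infDist (δ t) (δ '' Iic s) :=
      (hcomp.isClosed.notMem_iff_infDist_pos ⟨_, mem_image_of_mem _ (mem_Iic.2 le_rfl)⟩).1 hnot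
    obtain ⟨n, hn⟩ := (TopologicalSpace.denseRange_denseSeq X).exists_dist_lt (δ t)
      (half_pos hpos)
    obtain ⟨u, hu, e⟩ := runMin_attained hδ (x n) s
    have e1 := Metric.infDist_le_dist_of_mem (x := δ t) (mem_image_of_mem δ (mem_Iic.2 hu))
    have e2 := dist_triangle_left (δ t) (δ u) (x n)
    have e3 := runMin_le (δ := δ) (x n) (le_refl t)
    have e4 : dist (x n) (δ t) < Metric.infDist (δ t) (δ '' Iic s) / 2 := by
      rw [dist_comm]; exact hn
    refine Summable.tsum_lt_tsum (i := n)
      (fun n => mul_le_mul_of_nonneg_left (runMin_anti hδ _ h) (by positivity)) ?_ (hsum t) (hsum s)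
    exact mul_lt_mul_of_pos_left (by linarith) (by positivity)
  have hφeq : ∀ s t, s ≤ t → δ s = δ t → φ s = φ t := by
    intro s t h he
    refine le_antisymm ?_ (hφanti s t h)
    refine (hsum s).tsum_le_tsum (fun n => mul_le_mul_of_nonneg_left ?_ (by positivity)) (hsum t)
    obtain ⟨u, hu, e⟩ := runMin_attained hδ (x n) t
    rw [e]
    rcases le_total u s with hus | hsu
    · exact runMin_le _ hus
    · rw [hconv s u t hsu hu he, ← he]
      exact runMin_le _ le_rfl
  have hφiff : ∀ s t, φ s = φ t ↔ δ s = δ t := by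
    intro s t
    constructor
    · intro h
      by_contra hne
      rcases le_total s t with h' | h'
      · exact absurd h (hφlt s t h' hne).ne'
      · exact absurd h (hφlt t s h' (Ne.symm hne)).ne
    · intro h
      rcases le_total s t with h' | h'
      · exact hφeq s t h' h
      · exact (hφeq t s h' h.symm).symm
  have hlt : φ 1 < φ 0 := hφlt 0 1 zero_le_one h01
  have hden : 0 < φ 0 - φ 1 := by linarith
  let Φ : unitInterval → unitInterval := fun t => ⟨(φ 0 - φ t) / (φ 0 - φ 1),
    div_nonneg (sub_nonneg.2 (hφanti 0 t t.2.1)) hden.le,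
    (div_le_one hden).2 (by have := hφanti t 1 t.2.2; linarith)⟩
  have hΦc : Continuous Φ := by
    refine Continuous.subtype_mk ?_ _
    exact (continuous_const.sub hφc).div_const _
  have hΦ0 : Φ 0 = 0 := by ext; simp [Φ]
  have hΦ1 : Φ 1 = 1 := by ext; simp [Φ, hden.ne']
  have hΦs : Function.Surjective Φ := fun t =>
    mem_range_of_exists_le_of_exists_ge hΦc ⟨0, by rw [hΦ0]; exact t.2.1⟩
      ⟨1, by rw [hΦ1]; exact t.2.2⟩
  have hΦiff : ∀ s t, Φ s = Φ t ↔ δ s = δ t := by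
    intro s t
    rw [← hφiff, Subtype.ext_iff]
    simp only [Φ]
    rw [div_left_inj' hden.ne']
    simp
  choose σ hσ using hΦs
  have hfac : (δ ∘ σ) ∘ Φ = δ := by
    funext t
    exact (hΦiff _ _).1 (hσ (Φ t))
  have hq : IsQuotientMap Φ := hΦc.isClosedMap.isQuotientMap hΦc (fun t => ⟨σ t, hσ t⟩)
  refine ⟨δ ∘ σ, ?_, ?_, ?_, ?_, range_comp_subset_range _ _⟩
  · rw [hq.continuous_iff, hfac]; exact hδ
  · intro s t h
    have := (hΦiff _ _).2 h
    rwa [hσ, hσ] at this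
  · exact (hΦiff _ _).1 (by rw [hσ, hΦ0])
  · exact (hΦiff _ _).1 (by rw [hσ, hΦ1])

end

/-- Closed sets of parameters whose complementary gaps have endpoints identified by `γ`. -/
def Good {X : Type*} (γ : unitInterval → X) (K : Set unitInterval) : Prop :=
  IsClosed K ∧ 0 ∈ K ∧ 1 ∈ K ∧
    ∀ s ∈ K, ∀ t ∈ K, s < t → (∀ u ∈ K, s < u → u < t → False) → γ s = γ t

lemma good_sInter {X : Type*} [TopologicalSpace X] [T2Space X] {γ : unitInterval → X}
    (hγ : Continuous γ) {c : Set (Set unitInterval)} (hc : ∀ K ∈ c, Good γ K)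
    (hch : IsChain (· ⊆ ·) c) (hne : c.Nonempty) : Good γ (⋂₀ c) := by
  refine ⟨isClosed_sInter fun K hK => (hc K hK).1, fun K hK => (hc K hK).2.1,
    fun K hK => (hc K hK).2.2.1, ?_⟩
  intro s hs t ht hst hgap
  by_contra hne'
  obtain ⟨A, B, hA, hB, hsA, htB, hAB⟩ := t2_separation hne'
  obtain ⟨s₁, hs₁, hs₁A⟩ := (mem_nhdsGE_iff_exists_Ico_subset' hst).1
    (mem_nhdsWithin_of_mem_nhds ((hA.preimage hγ).mem_nhds hsA) : γ ⁻¹' A ∈ 𝓝[≥] s)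
  obtain ⟨t₁, ht₁, ht₁B⟩ := (mem_nhdsLE_iff_exists_Ioc_subset' hst).1
    (mem_nhdsWithin_of_mem_nhds ((hB.preimage hγ).mem_nhds htB) : γ ⁻¹' B ∈ 𝓝[≤] t)
  obtain ⟨s', hs', hs's⟩ := exists_between (show s < s₁ from hs₁)
  obtain ⟨t', ht't, ht'⟩ := exists_between (show t₁ < t from ht₁)
  have hs'A : Icc s s' ⊆ γ ⁻¹' A := fun u hu => hs₁A ⟨hu.1, hu.2.trans_lt hs's⟩
  have ht'B : Icc t' t ⊆ γ ⁻¹' B := fun u hu => ht₁B ⟨ht't.trans_le hu.1, hu.2⟩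
  have hst' : s' < t' := by
    by_contra hcon
    push Not at hcon
    have h1 : max s t' ∈ Icc s s' := ⟨le_max_left _ _, max_le hs'.le hcon⟩
    have h2 : max s t' ∈ Icc t' t := ⟨le_max_right _ _, max_le hst.le ht'.le⟩
    exact disjoint_left.1 hAB (hs'A h1) (ht'B h2)
  obtain ⟨K, hK, hKe⟩ : ∃ K ∈ c, Icc s' t' ∩ K = ∅ := by
    have : Nonempty c := hne.to_subtype
    have hdir : Directed (· ⊇ ·) (fun K : c => (K : Set unitInterval)) := by
      intro K L
      rcases hch.total K.2 L.2 with h | h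
      · exact ⟨K, subset_rfl, h⟩
      · exact ⟨L, h, subset_rfl⟩
    obtain ⟨K, hK⟩ := (isCompact_Icc (a := s') (b := t')).elim_directed_family_closed
      (fun K : c => (K : Set unitInterval)) (fun K => (hc K K.2).1) (by
        rw [← sInter_eq_iInter, eq_empty_iff_forall_notMem]
        rintro u ⟨⟨hu1, hu2⟩, hu⟩
        exact hgap u hu (hs'.trans_le hu1) (hu2.trans_lt ht')) hdir
    exact ⟨K, K.2, hK⟩
  have hKg := hc K hK
  obtain ⟨a, ⟨haK, ha1, ha2⟩, hamax⟩ := ((hKg.1.inter isClosed_Icc).isCompact :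
    IsCompact (K ∩ Icc s s')).exists_isGreatest ⟨s, hs K hK, le_rfl, hs'.le⟩
  obtain ⟨b, ⟨hbK, hb1, hb2⟩, hbmin⟩ := ((hKg.1.inter isClosed_Icc).isCompact :
    IsCompact (K ∩ Icc t' t)).exists_isLeast ⟨t, ht K hK, ht'.le, le_rfl⟩
  have hab : γ a = γ b := by
    refine hKg.2.2.2 a haK b hbK (ha2.trans_lt (hst'.trans_le hb1)) ?_
    intro u huK hau hub
    rcases le_total u s' with h1 | h1
    · exact absurd (hamax ⟨huK, ha1.trans hau.le, h1⟩) (not_le.2 hau)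
    · rcases le_total u t' with h2 | h2
      · have : u ∈ Icc s' t' ∩ K := ⟨⟨h1, h2⟩, huK⟩
        rw [hKe] at this; exact this
      · exact absurd (hbmin ⟨huK, h2, hub.le.trans hb2⟩) (not_le.2 hub)
  exact disjoint_left.1 hAB (hs'A ⟨ha1, ha2⟩) (hab ▸ ht'B ⟨hb1, hb2⟩)

/-- Every path between distinct points contains an arc. -/
lemma arc_of_path {X : Type*} [MetricSpace X] [CompactSpace X] {γ : unitInterval → X}
    (hγ : Continuous γ) (h01 : γ 0 ≠ γ 1) :
    ∃ α : unitInterval → X, Continuous α ∧ Function.Injective α ∧ α 0 = γ 0 ∧ α 1 = γ 1 ∧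
      range α ⊆ range γ := by
  obtain ⟨K, -, hKmin⟩ := zorn_superset_nonempty {K | Good γ K}
    (fun c hc hch hne => ⟨⋂₀ c, good_sInter hγ hc hch hne, fun s hs => sInter_subset_of_mem hs⟩)
    univ ⟨isClosed_univ, mem_univ _, mem_univ _, fun s _ t _ hst hgap => by
      obtain ⟨u, h1, h2⟩ := exists_between hst
      exact (hgap u (mem_univ _) h1 h2).elim⟩
  obtain ⟨hKcl, hK0, hK1, hKgap⟩ := hKmin.1
  have hinj : ∀ s ∈ K, ∀ t ∈ K, s < t → γ s = γ t → ∀ u ∈ K, s < u → u < t → False := by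
    intro s hs t ht hst he u hu hsu hut
    have hgood : Good γ (K \ Ioo s t) := by
      refine ⟨hKcl.sdiff isOpen_Ioo, ⟨hK0, fun h => not_lt.2 s.2.1 h.1⟩,
        ⟨hK1, fun h => not_lt.2 t.2.2 h.2⟩, ?_⟩
      rintro s' ⟨hs', hs'2⟩ t' ⟨ht', ht'2⟩ hst' hgap
      by_cases hex : ∃ v ∈ K, s' < v ∧ v < t'
      · obtain ⟨v, hv, hsv, hvt⟩ := hex
        have hvI : v ∈ Ioo s t := by
          by_contra hvn
          exact hgap v ⟨hv, hvn⟩ hsv hvt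
        have h1 : s' ≤ s := by
          by_contra hcon
          exact hs'2 ⟨not_le.1 hcon, hsv.trans hvI.2⟩
        have h2 : t ≤ t' := by
          by_contra hcon
          exact ht'2 ⟨hvI.1.trans hvt, not_le.1 hcon⟩
        have h3 : s' = s := by
          by_contra hcon
          exact hgap s ⟨hs, fun h => lt_irrefl _ h.1⟩ (lt_of_le_of_ne h1 hcon) (hvI.1.trans hvt)
        have h4 : t = t' := by
          by_contra hcon
          exact hgap t ⟨ht, fun h => lt_irrefl _ h.2⟩ (hsv.trans hvI.2) (lt_of_le_of_ne h2 hcon)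
        rw [h3, ← h4]; exact he
      · push Not at hex
        exact hKgap s' hs' t' ht' hst' fun v hv h1 h2 => not_le.2 h2 (hex v hv h1)
    exact (hKmin.2 hgood sdiff_subset hu).2 ⟨hsu, hut⟩
  have hr : ∀ t, ∃ k, IsGreatest (K ∩ Iic t) k := fun t =>
    ((hKcl.inter isClosed_Iic).isCompact : IsCompact (K ∩ Iic t)).exists_isGreatest
      ⟨0, hK0, t.2.1⟩
  choose r hr using hr
  have hrK : ∀ t, r t ∈ K := fun t => (hr t).1.1
  have hrle : ∀ t, r t ≤ t := fun t => (hr t).1.2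
  have hrmax : ∀ t, ∀ u ∈ K, u ≤ t → u ≤ r t := fun t u hu hut => (hr t).2 ⟨hu, hut⟩
  have hrmono : ∀ s t, s ≤ t → r s ≤ r t := fun s t h => hrmax t _ (hrK s) ((hrle s).trans h)
  -- the collapsed path
  let E : Set (unitInterval × unitInterval) := {p | p.1 ∈ K} ∩
    ⋂ u ∈ K, ({p | p.1 < u ∧ u < p.2} ∪ {p | p.2 < u ∧ u < p.1})ᶜ
  have hEcl : IsClosed E := by
    refine (hKcl.preimage continuous_fst).inter (isClosed_biInter fun u _ => ?_)
    rw [isClosed_compl_iff]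
    have o1 : IsOpen {p : unitInterval × unitInterval | p.1 < u} :=
      isOpen_lt continuous_fst continuous_const
    have o2 : IsOpen {p : unitInterval × unitInterval | u < p.2} :=
      isOpen_lt continuous_const continuous_snd
    have o3 : IsOpen {p : unitInterval × unitInterval | p.2 < u} :=
      isOpen_lt continuous_snd continuous_const
    have o4 : IsOpen {p : unitInterval × unitInterval | u < p.1} :=
      isOpen_lt continuous_const continuous_fst
    exact (o1.inter o2).union (o3.inter o4)
  have hEmem : ∀ k t, (k, t) ∈ E ↔ k ∈ K ∧ ∀ u ∈ K, ¬ (k < u ∧ u < t) ∧ ¬ (t < u ∧ u < k) := by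
    intro k t
    simp only [E, mem_inter_iff, mem_ofPred_eq, mem_iInter, mem_compl_iff, mem_union, not_or]
  have hEeq : ∀ k t, (k, t) ∈ E → γ k = γ (r t) := by
    intro k t h
    obtain ⟨hk, h⟩ := (hEmem k t).1 h
    rcases le_or_gt k t with hkt | hkt
    · rcases (hrmax t k hk hkt).eq_or_lt with e | hlt
      · rw [← e]
      · have hrt : r t = t := by
          by_contra hcon
          exact (h (r t) (hrK t)).1 ⟨hlt, lt_of_le_of_ne (hrle t) hcon⟩
        exact hKgap k hk _ (hrK t) hlt fun u hu h1 h2 => (h u hu).1 ⟨h1, hrt ▸ h2⟩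
    · refine (hKgap _ (hrK t) k hk ((hrle t).trans_lt hkt) fun u hu h1 h2 => ?_).symm
      rcases le_or_gt u t with h3 | h3
      · exact not_le.2 h1 (hrmax t u hu h3)
      · exact (h u hu).2 ⟨h3, h2⟩
  have hEr : ∀ t, (r t, t) ∈ E := fun t => (hEmem _ _).2 ⟨hrK t, fun u hu =>
    ⟨fun h => not_le.2 h.1 (hrmax t u hu h.2.le), fun h => not_lt.2 (hrle t) (h.1.trans h.2)⟩⟩
  have : CompactSpace E := isCompact_iff_compactSpace.1 hEcl.isCompact
  let q : E → unitInterval := fun p => p.1.2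
  have hqc : Continuous q := continuous_snd.comp continuous_subtype_val
  have hq : IsQuotientMap q := hqc.isClosedMap.isQuotientMap hqc fun t => ⟨⟨_, hEr t⟩, rfl⟩
  have hδ : Continuous (γ ∘ r) := by
    rw [hq.continuous_iff]
    have : (γ ∘ r) ∘ q = fun p : E => γ p.1.1 := by
      funext p
      exact (hEeq p.1.1 p.1.2 p.2).symm
    rw [this]
    exact hγ.comp (continuous_fst.comp continuous_subtype_val)
  have hr0 : r 0 = 0 := le_antisymm (hrle 0) (r 0).2.1
  have hr1 : r 1 = 1 := le_antisymm (hrle 1) (hrmax 1 1 hK1 le_rfl)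
  obtain ⟨α, h1, h2, h3, h4, h5⟩ := arc_of_monotone hδ (by
    intro s t u hst htu he
    simp only [Function.comp] at he ⊢
    rcases (hrmono t u htu).eq_or_lt with e | hlt
    · rw [e]
    · rcases (hrmono s t hst).eq_or_lt with e | hlt'
      · rw [← e, he]
      · exact (hinj _ (hrK s) _ (hrK u) (hlt'.trans hlt) he _ (hrK t) hlt' hlt).elim)
    (by simp only [Function.comp, hr0, hr1]; exact h01)
  refine ⟨α, h1, h2, ?_, ?_, h5.trans (range_comp_subset_range _ _)⟩
  · rw [h3, Function.comp, hr0]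
  · rw [h4, Function.comp, hr1]

section
variable {X : Type*}

/-- Affine interpolation in the unit interval. -/
def lerp (a b t : unitInterval) : unitInterval :=
  ⟨(1 - (t : ℝ)) * a + t * b, by
    have ht0 := t.2.1
    have ht1 := t.2.2
    have ha0 := a.2.1
    have ha1 := a.2.2
    have hb0 := b.2.1
    have hb1 := b.2.2
    constructor <;> nlinarith⟩

lemma lerp_coe (a b t : unitInterval) : (lerp a b t : ℝ) = (1 - (t : ℝ)) * a + t * b := rfl

lemma lerp_zero (a b : unitInterval) : lerp a b 0 = a := by ext; simp [lerp_coe]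

lemma lerp_one (a b : unitInterval) : lerp a b 1 = b := by ext; simp [lerp_coe]

lemma lerp_continuous (a b : unitInterval) : Continuous (lerp a b) := by
  unfold lerp
  refine Continuous.subtype_mk ?_ _
  fun_prop

lemma lerp_injective {a b : unitInterval} (h : a ≠ b) : Function.Injective (lerp a b) := by
  intro s t e
  have e' := congrArg (Subtype.val) e
  rw [lerp_coe, lerp_coe] at e'
  have h' : (b : ℝ) - a ≠ 0 := fun h0 => h (Subtype.ext (by linarith))
  ext
  have : ((s : ℝ) - t) * (b - a) = 0 := by linarith
  rcases mul_eq_zero.1 this with h1 | h1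
  · linarith
  · exact absurd h1 h'

lemma lerp_mem {a b : unitInterval} (h : a ≤ b) (t : unitInterval) : lerp a b t ∈ Icc a b := by
  have ht0 := t.2.1
  have ht1 := t.2.2
  have h' : (a : ℝ) ≤ b := h
  constructor
  · change (a : ℝ) ≤ lerp a b t
    rw [lerp_coe]; nlinarith
  · change (lerp a b t : ℝ) ≤ b
    rw [lerp_coe]; nlinarith

/-- Two arcs meeting exactly at their endpoints form a circle. -/
lemma circle_of_arcs [TopologicalSpace X] [T2Space X] {α β : unitInterval → X}
    (hα : Continuous α) (hβ : Continuous β) (iα : Function.Injective α)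
    (iβ : Function.Injective β) (h0 : α 0 = β 0) (h1 : α 1 = β 1)
    (hd : ∀ s t, α s = β t → (s = 0 ∧ t = 0) ∨ (s = 1 ∧ t = 1)) :
    ∃ S : Set X, Nonempty (S ≃ₜ Circle) := by
  let P : ℝ → unitInterval := projIcc 0 1 zero_le_one
  have hPc : Continuous P := continuous_projIcc
  have hPv : ∀ t : ℝ, 0 ≤ t → t ≤ 1 → (P t : ℝ) = t := fun t h h' => by
    simp only [P, projIcc_of_mem zero_le_one (⟨h, h'⟩ : t ∈ Icc (0:ℝ) 1)]
  let f : ℝ → X := fun t => if t ≤ 1 then α (P t) else β (P (2 - t))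
  have hP0 : P 0 = 0 := Subtype.ext (hPv 0 le_rfl zero_le_one)
  have hP1 : P 1 = 1 := Subtype.ext (hPv 1 zero_le_one le_rfl)
  have hf : Continuous f := by
    refine Continuous.if_le (hα.comp hPc) (hβ.comp (hPc.comp (by fun_prop))) continuous_id
      continuous_const ?_
    intro t ht
    have ht' : t = 1 := ht
    subst ht'
    show α (P 1) = β (P (2 - 1))
    rw [show (2 : ℝ) - 1 = 1 by norm_num, hP1, h1]
  have : Fact ((0 : ℝ) < 2) := ⟨by norm_num⟩
  let F : AddCircle (2 : ℝ) → X := AddCircle.liftIco 2 0 f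
  have hFc : Continuous F := by
    refine AddCircle.liftIco_zero_continuous ?_ hf.continuousOn
    simp only [f]
    rw [if_pos zero_le_one, if_neg (by norm_num), sub_self, hP0, h0]
  have hfi : ∀ a b : ℝ, 0 ≤ a → a < 2 → 0 ≤ b → b < 2 → a ≤ b → f a = f b → a = b := by
    intro a b ha ha2 hb hb2 hab h
    simp only [f] at h
    split_ifs at h with h3 h4 h4
    · have := congrArg Subtype.val (iα h)
      rwa [hPv a ha h3, hPv b hb h4] at this
    · exfalso
      push Not at h4
      rcases hd _ _ h with ⟨-, e⟩ | ⟨-, e⟩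
      · have := congrArg Subtype.val e
        rw [hPv _ (by linarith) (by linarith)] at this
        simp at this
        linarith
      · have := congrArg Subtype.val e
        rw [hPv _ (by linarith) (by linarith)] at this
        simp at this
        linarith
    · exact absurd (hab.trans h4) h3
    · push Not at h3 h4
      have := congrArg Subtype.val (iβ h)
      rw [hPv _ (by linarith) (by linarith), hPv _ (by linarith) (by linarith)] at this
      linarith
  have hFi : Function.Injective F := by
    intro x y hxy
    obtain ⟨a, ha, rfl⟩ : ∃ a ∈ Ico (0 : ℝ) (0 + 2), (a : AddCircle (2 : ℝ)) = x := by
      have : x ∈ ((↑) : ℝ → AddCircle (2 : ℝ)) '' Ico 0 (0 + 2) := by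
        rw [AddCircle.coe_image_Ico_eq]; trivial
      exact this
    obtain ⟨b, hb, rfl⟩ : ∃ a ∈ Ico (0 : ℝ) (0 + 2), (a : AddCircle (2 : ℝ)) = y := by
      have : y ∈ ((↑) : ℝ → AddCircle (2 : ℝ)) '' Ico 0 (0 + 2) := by
        rw [AddCircle.coe_image_Ico_eq]; trivial
      exact this
    simp only [F] at hxy
    rw [AddCircle.liftIco_coe_apply ha, AddCircle.liftIco_coe_apply hb] at hxy
    rw [zero_add] at ha hb
    rcases le_total a b with h | h
    · rw [hfi a b ha.1 ha.2 hb.1 hb.2 h hxy]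
    · rw [hfi b a hb.1 hb.2 ha.1 ha.2 h hxy.symm]
  have hemb : Topology.IsEmbedding F := (hFc.isClosedEmbedding hFi).isEmbedding
  exact ⟨range F, ⟨hemb.toHomeomorph.symm.trans (AddCircle.homeomorphCircle (by norm_num))⟩⟩

lemma circle_of_arc_avoiding [TopologicalSpace X] [T2Space X] {α β : unitInterval → X}
    (hα : Continuous α) (hβ : Continuous β) (iα : Function.Injective α)
    (iβ : Function.Injective β) (h0 : α 0 = β 0) (h1 : α 1 = β 1) (t₀ : unitInterval)
    (ht₀ : α t₀ ∉ range β) : ∃ S : Set X, Nonempty (S ≃ₜ Circle) := by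
  have hcl : IsClosed (α ⁻¹' range β) := (isCompact_range hβ).isClosed.preimage hα
  obtain ⟨a, ⟨haβ, hat⟩, hamax⟩ := ((hcl.inter isClosed_Iic).isCompact :
    IsCompact (α ⁻¹' range β ∩ Iic t₀)).exists_isGreatest ⟨0, ⟨0, h0.symm⟩, t₀.2.1⟩
  obtain ⟨b, ⟨hbβ, hbt⟩, hbmin⟩ := ((hcl.inter isClosed_Ici).isCompact :
    IsCompact (α ⁻¹' range β ∩ Ici t₀)).exists_isLeast ⟨1, ⟨1, h1.symm⟩, t₀.2.2⟩
  have hab : a ≤ b := le_trans hat hbt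
  have hne : a ≠ b := by
    intro e
    have : a = t₀ := le_antisymm hat (e ▸ hbt)
    exact ht₀ (this ▸ haβ)
  obtain ⟨c, hc⟩ := haβ
  obtain ⟨d, hd⟩ := hbβ
  have hcd : c ≠ d := by
    rintro rfl
    exact hne (iα (hc.symm.trans hd))
  refine circle_of_arcs (α := α ∘ lerp a b) (β := β ∘ lerp c d) (hα.comp (lerp_continuous _ _))
    (hβ.comp (lerp_continuous _ _)) (iα.comp (lerp_injective hne)) (iβ.comp (lerp_injective hcd))
    (by simp only [Function.comp, lerp_zero, hc]) (by simp only [Function.comp, lerp_one, hd]) ?_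
  intro s t hst
  simp only [Function.comp] at hst
  have hm := lerp_mem hab s
  have hmem : α (lerp a b s) ∈ range β := ⟨_, hst.symm⟩
  rcases le_total (lerp a b s) t₀ with h | h
  · left
    have e : lerp a b s = a := le_antisymm (hamax ⟨hmem, h⟩) hm.1
    refine ⟨lerp_injective hne (e.trans (lerp_zero a b).symm), ?_⟩
    rw [e, ← hc] at hst
    exact lerp_injective hcd ((iβ hst).symm.trans (lerp_zero c d).symm)
  · right
    have e : lerp a b s = b := le_antisymm hm.2 (hbmin ⟨hmem, h⟩)
    refine ⟨lerp_injective hne (e.trans (lerp_one a b).symm), ?_⟩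
    rw [e, ← hd] at hst
    exact lerp_injective hcd ((iβ hst).symm.trans (lerp_one c d).symm)

/-- In a dendrite, any two distinct points are separated by a third. -/
lemma exists_separating [MetricSpace X] [CompactSpace X] [ConnectedSpace X]
    [LocallyConnectedSpace X] (hno : ¬ ∃ S : Set X, Nonempty (S ≃ₜ Circle)) {p q : X}
    (hpq : p ≠ q) : ∃ z, z ≠ p ∧ z ≠ q ∧ q ∉ connectedComponentIn {z}ᶜ p := by
  have := locallyPathConnected X
  have hpc : PathConnectedSpace X := PathConnectedSpace.of_locallyPathConnectedSpace
  obtain ⟨γ⟩ := PathConnectedSpace.joined p q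
  obtain ⟨α, hα, iα, a0, a1, -⟩ := arc_of_path γ.continuous (by simpa using hpq)
  rw [γ.source] at a0
  rw [γ.target] at a1
  let t₀ : unitInterval := ⟨1 / 2, by norm_num, by norm_num⟩
  have hp : α t₀ ≠ p := by
    rw [← a0]
    intro h
    have := congrArg Subtype.val (iα h)
    norm_num [t₀] at this
  have hq : α t₀ ≠ q := by
    rw [← a1]
    intro h
    have := congrArg Subtype.val (iα h)
    norm_num [t₀] at this
  refine ⟨α t₀, hp, hq, fun hmem => hno ?_⟩
  have hpm : p ∈ ({α t₀}ᶜ : Set X) := fun h => hp h.symm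
  have hop : IsOpen (connectedComponentIn {α t₀}ᶜ p) :=
    (isOpen_compl_singleton).connectedComponentIn
  have hconn : IsConnected (connectedComponentIn {α t₀}ᶜ p) :=
    ⟨⟨p, mem_connectedComponentIn hpm⟩, isPreconnected_connectedComponentIn⟩
  obtain ⟨γ', hγ'⟩ := (hop.isConnected_iff_isPathConnected.1 hconn).joinedIn p
    (mem_connectedComponentIn hpm) q hmem
  obtain ⟨β, hβ, iβ, b0, b1, hr⟩ := arc_of_path γ'.continuous (by simpa using hpq)
  rw [γ'.source] at b0
  rw [γ'.target] at b1
  refine circle_of_arc_avoiding hα hβ iα iβ (a0.trans b0.symm) (a1.trans b1.symm) t₀ ?_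
  intro h
  obtain ⟨s, hs⟩ := hr h
  have := connectedComponentIn_subset _ _ (hγ' s)
  exact this hs

end

section
variable {X : Type*} [TopologicalSpace X]

/-- The component of the root `e` in the complement of `x`. -/
def rootComp (e x : X) : Set X := connectedComponentIn {x}ᶜ e

lemma notMem_rootComp (e x : X) : x ∉ rootComp e x := fun h =>
  connectedComponentIn_subset _ _ h rfl

lemma rootComp_self (e : X) : rootComp e e = ∅ :=
  connectedComponentIn_eq_empty (by simp)

lemma mem_rootComp {e x : X} (h : x ≠ e) : e ∈ rootComp e x :=
  mem_connectedComponentIn (fun h' => h h'.symm)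

lemma subset_rootComp {e x : X} {S : Set X} (hS : IsPreconnected S) (he : e ∈ S) (hx : x ∉ S) :
    S ⊆ rootComp e x :=
  hS.subset_connectedComponentIn he (fun _ hy h => hx (h ▸ hy))

variable [T2Space X] [LocallyConnectedSpace X]

lemma isOpen_rootComp (e x : X) : IsOpen (rootComp e x) :=
  isOpen_compl_singleton.connectedComponentIn

lemma isClosed_insert_comp (x y : X) : IsClosed (insert x (connectedComponentIn {x}ᶜ y)) := by
  rw [← isOpen_compl_iff, isOpen_iff_mem_nhds]
  intro w hw
  rw [mem_compl_iff, mem_insert_iff, not_or] at hw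
  have hwm : w ∈ ({x}ᶜ : Set X) := hw.1
  refine Filter.mem_of_superset ((isOpen_compl_singleton.connectedComponentIn).mem_nhds
    (mem_connectedComponentIn hwm)) ?_
  intro v hv hv'
  rcases hv' with rfl | hv'
  · exact connectedComponentIn_subset _ _ hv rfl
  · have h1 := connectedComponentIn_eq hv
    have h2 := connectedComponentIn_eq hv'
    apply hw.2
    rw [h2, ← h1]
    exact mem_connectedComponentIn hwm

variable [ConnectedSpace X]

lemma mem_closure_comp {x y : X} (h : y ≠ x) : x ∈ closure (connectedComponentIn {x}ᶜ y) := by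
  by_contra hx
  have hcl : IsClosed (connectedComponentIn {x}ᶜ y) := by
    refine isClosed_of_closure_subset fun w hw => ?_
    rcases closure_minimal (subset_insert _ _) (isClosed_insert_comp x y) hw with rfl | h'
    · exact absurd hw hx
    · exact h'
  have hu := IsClopen.eq_univ ⟨hcl, isOpen_compl_singleton.connectedComponentIn⟩
    ⟨y, mem_connectedComponentIn (show y ∈ ({x}ᶜ : Set X) from h)⟩
  exact connectedComponentIn_subset _ _ (hu ▸ mem_univ x : x ∈ connectedComponentIn {x}ᶜ y) rfl

lemma isPreconnected_insert_comp {x y : X} (h : y ≠ x) :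
    IsPreconnected (insert x (connectedComponentIn {x}ᶜ y)) :=
  isPreconnected_connectedComponentIn.subset_closure (subset_insert _ _)
    (insert_subset (mem_closure_comp h) subset_closure)

lemma isPreconnected_upper (e x : X) : IsPreconnected (rootComp e x)ᶜ := by
  refine isPreconnected_of_forall x fun y hy => ?_
  by_cases h : y = x
  · subst h
    exact ⟨{y}, by simpa using hy, rfl, rfl, isPreconnected_singleton⟩
  · refine ⟨_, ?_, mem_insert _ _, mem_insert_of_mem _
      (mem_connectedComponentIn (show y ∈ ({x}ᶜ : Set X) from h)), isPreconnected_insert_comp h⟩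
    rintro w (rfl | hw)
    · exact notMem_rootComp e w
    · intro hw'
      apply hy
      have h1 := connectedComponentIn_eq hw
      have h2 := connectedComponentIn_eq hw'
      unfold rootComp
      rw [h2, ← h1]
      exact mem_connectedComponentIn h

/-- The cut-point order with root `e`. -/
def le (e x y : X) : Prop := y ∉ rootComp e x

omit [T2Space X] [LocallyConnectedSpace X] [ConnectedSpace X] in
lemma le_refl' (e x : X) : le e x x := notMem_rootComp e x

omit [T2Space X] [LocallyConnectedSpace X] [ConnectedSpace X] in
lemma root_le (e x : X) : le e e x := by simp [le, rootComp_self]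

omit [T2Space X] [LocallyConnectedSpace X] [ConnectedSpace X] in
lemma rootComp_mono {e x y : X} (h : le e x y) : rootComp e x ⊆ rootComp e y := by
  by_cases hx : x = e
  · subst hx; rw [rootComp_self]; exact empty_subset _
  · exact subset_rootComp isPreconnected_connectedComponentIn (mem_rootComp hx) h

omit [T2Space X] [LocallyConnectedSpace X] [ConnectedSpace X] in
lemma le_trans' {e x y z : X} (h : le e x y) (h' : le e y z) : le e x z :=
  fun hz => h' (rootComp_mono h hz)

lemma le_antisymm' {e x y : X} (h : le e x y) (h' : le e y x) : x = y := by
  have hC : rootComp e x = rootComp e y := (rootComp_mono h).antisymm (rootComp_mono h')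
  by_cases hx : x = e
  · subst hx
    by_contra hne
    rw [rootComp_self] at hC
    have := mem_rootComp (Ne.symm hne : y ≠ x)
    rw [← hC] at this
    exact this
  · have h1 : x ∈ closure (rootComp e x) := mem_closure_comp (Ne.symm hx)
    rw [hC] at h1
    rcases closure_minimal (subset_insert _ _) (isClosed_insert_comp y e) h1 with h2 | h2
    · exact h2
    · exact absurd h2 h'

omit [ConnectedSpace X] in
lemma isClosed_le (e x : X) : IsClosed {y | le e x y} := (isOpen_rootComp e x).isClosed_compl

omit [ConnectedSpace X] in
lemma isOpen_gt (e x : X) : IsOpen {y | le e x y ∧ y ≠ x} := by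
  have := (isClosed_insert_comp x e).isOpen_compl
  convert this using 1
  ext y
  simp only [le, rootComp, mem_ofPred_eq, mem_compl_iff, mem_insert_iff, not_or]
  tauto

lemma le_total_below {e z z' y : X} (h : le e z y) (h' : le e z' y) : le e z z' ∨ le e z' z := by
  by_contra hcon
  push Not at hcon
  obtain ⟨h1, h2⟩ := hcon
  have hz : z ∈ rootComp e z' := not_not.1 h2
  have hz' : z' ∈ rootComp e z := not_not.1 h1
  have hsub : (rootComp e z)ᶜ ⊆ connectedComponentIn {z'}ᶜ z :=
    (isPreconnected_upper e z).subset_connectedComponentIn (notMem_rootComp e z)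
      (fun w hw hwz => hw (hwz ▸ hz'))
  have := hsub h
  rw [← connectedComponentIn_eq hz] at this
  exact h' this

variable (hsep : ∀ p q : X, p ≠ q → ∃ z, z ≠ p ∧ z ≠ q ∧ q ∉ connectedComponentIn {z}ᶜ p)
include hsep

lemma exists_between' {e x y : X} (h : le e x y) (hne : x ≠ y) :
    ∃ z, le e x z ∧ z ≠ x ∧ le e z y ∧ z ≠ y := by
  obtain ⟨z, hzx, hzy, hz⟩ := hsep x y hne
  have hxz : le e x z := by
    intro hcon
    apply hz
    have hs : (rootComp e x)ᶜ ⊆ ({z}ᶜ : Set X) := by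
      intro w hw hwz
      rw [mem_singleton_iff] at hwz
      subst hwz
      exact hw hcon
    exact (isPreconnected_upper e x).subset_connectedComponentIn (notMem_rootComp e x) hs h
  refine ⟨z, hxz, hzx, ?_, hzy⟩
  have hx : x ∈ rootComp e z := by
    by_contra hcon
    exact hzx (le_antisymm' hcon hxz)
  intro hy
  apply hz
  rw [← connectedComponentIn_eq hx]
  exact hy

variable [CompactSpace X]

lemma accumulate {e x y : X} (h : le e x y) (hne : x ≠ y) :
    x ∈ closure {z | le e x z ∧ z ≠ x ∧ le e z y} := by
  let I : Set X := {z | le e x z ∧ z ≠ x ∧ le e z y}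
  have hyI : y ∈ I := ⟨h, hne.symm, le_refl' e y⟩
  have : Nonempty I := ⟨⟨y, hyI⟩⟩
  obtain ⟨q, hq⟩ := IsCompact.nonempty_iInter_of_directed_nonempty_isCompact_isClosed
    (fun z : I => closure {w | w ∈ I ∧ le e w z}) (by
      intro a b
      rcases le_total_below a.2.2.2 b.2.2.2 with hab | hab
      · exact ⟨a, subset_rfl, closure_mono fun w hw => ⟨hw.1, le_trans' hw.2 hab⟩⟩
      · exact ⟨b, closure_mono fun w hw => ⟨hw.1, le_trans' hw.2 hab⟩, subset_rfl⟩)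
    (fun a => ⟨a, subset_closure ⟨a.2, le_refl' e a⟩⟩)
    (fun a => isClosed_closure.isCompact) (fun a => isClosed_closure)
  rw [mem_iInter] at hq
  have hqI : q ∈ closure I := closure_mono (fun w hw => hw.1) (hq ⟨y, hyI⟩)
  by_cases hqx : x = q
  · have hqI' : x ∈ closure I := hqx.symm ▸ hqI
    exact hqI'
  exfalso
  have hxq : le e x q := closure_minimal (fun w hw => hw.1) (isClosed_le e x) hqI
  obtain ⟨s, hxs, hsx, hsq, hsq'⟩ := exists_between' hsep hxq hqx
  obtain ⟨w, ⟨hsw, -⟩, hwI⟩ := mem_closure_iff.1 hqI _ (isOpen_gt e s) ⟨hsq, hsq'.symm⟩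
  have hsI : s ∈ I := ⟨hxs, hsx, le_trans' hsw hwI.2.2⟩
  obtain ⟨v, ⟨hsv, hvs⟩, hvI, hvs'⟩ :=
    mem_closure_iff.1 (hq ⟨s, hsI⟩) _ (isOpen_gt e s) ⟨hsq, hsq'.symm⟩
  exact hvs (le_antisymm' hvs' hsv)

lemma chain_bound (e : X) {f : X → X} (hf : Continuous f) (c : Set X)
    (hc : ∀ a ∈ c, le e a (f a)) (hch : ∀ a ∈ c, ∀ b ∈ c, le e a b ∨ le e b a) :
    ∃ q, le e q (f q) ∧ ∀ a ∈ c, le e a q := by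
  by_cases hmax : ∃ b ∈ c, ∀ a ∈ c, le e a b
  · obtain ⟨b, hb, h⟩ := hmax
    exact ⟨b, hc b hb, h⟩
  rcases c.eq_empty_or_nonempty with rfl | hne
  · exact ⟨e, root_le e _, fun a ha => ha.elim⟩
  have hnm : ∀ a ∈ c, ∃ b ∈ c, a ∈ rootComp e b := by
    intro a ha
    push Not at hmax
    obtain ⟨b, hb, h⟩ := hmax a ha
    exact ⟨b, hb, not_not.1 h⟩
  have : Nonempty c := hne.to_subtype
  obtain ⟨q, hq⟩ := IsCompact.nonempty_iInter_of_directed_nonempty_isCompact_isClosed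
    (fun a : c => closure {b | b ∈ c ∧ le e a b}) (by
      intro a b
      rcases hch a a.2 b b.2 with hab | hab
      · exact ⟨b, closure_mono fun w hw => ⟨hw.1, le_trans' hab hw.2⟩, subset_rfl⟩
      · exact ⟨a, subset_rfl, closure_mono fun w hw => ⟨hw.1, le_trans' hab hw.2⟩⟩)
    (fun a => ⟨a, subset_closure ⟨a.2, le_refl' e a⟩⟩)
    (fun a => isClosed_closure.isCompact) (fun a => isClosed_closure)
  rw [mem_iInter] at hq
  have hub : ∀ a ∈ c, le e a q := fun a ha =>
    closure_minimal (fun w hw => hw.2) (isClosed_le e a) (hq ⟨a, ha⟩)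
  have hfub : ∀ a ∈ c, le e a (f q) := fun a ha => by
    have h1 : f q ∈ closure {y | le e a y} := map_mem_closure hf (hq ⟨a, ha⟩)
      (fun w hw => le_trans' hw.2 (hc w hw.1))
    rw [(isClosed_le e a).closure_eq] at h1
    exact h1
  refine ⟨q, ?_, hub⟩
  let W : Set X := ⋃ a ∈ c, rootComp e a
  have hWo : IsOpen W := isOpen_biUnion fun a _ => isOpen_rootComp e a
  have hcW : c ⊆ W := fun a ha => by
    obtain ⟨b, hb, h⟩ := hnm a ha
    exact mem_biUnion hb h
  have heW : e ∈ W := by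
    obtain ⟨a, ha⟩ := hne
    obtain ⟨b, hb, h⟩ := hnm a ha
    refine mem_biUnion hb (mem_rootComp ?_)
    rintro rfl
    rw [rootComp_self] at h
    exact h
  have hWp : IsPreconnected W := by
    refine isPreconnected_of_forall e fun y hy => ?_
    obtain ⟨a, ha, hya⟩ := mem_iUnion₂.1 hy
    refine ⟨rootComp e a, subset_biUnion_of_mem (u := fun a => rootComp e a) ha,
      mem_rootComp ?_, hya, isPreconnected_connectedComponentIn⟩
    rintro rfl
    rw [rootComp_self] at hya
    exact hya
  have hqW : q ∈ closure W := by
    obtain ⟨a, ha⟩ := hne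
    exact closure_mono (fun w hw => hcW hw.1) (hq ⟨a, ha⟩)
  have hclW : closure W ⊆ insert q W := by
    intro p hp
    by_contra hcon
    rw [mem_insert_iff, not_or] at hcon
    obtain ⟨z, hzp, hzq, hz⟩ := hsep p q hcon.1
    have hz' : ∀ S : Set X, IsPreconnected S → p ∈ S → q ∈ S → z ∈ S := by
      intro S hS hpS hqS
      by_contra hzS
      have hs : S ⊆ ({z}ᶜ : Set X) := by
        intro w hw h
        rw [mem_singleton_iff] at h
        subst h
        exact hzS hw
      exact hz (hS.subset_connectedComponentIn hpS hs hqS)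
    have hzW : z ∈ W := by
      have := hz' (insert p (insert q W)) (hWp.subset_closure
        ((subset_insert _ _).trans (subset_insert _ _))
        (insert_subset hp (insert_subset hqW subset_closure))) (mem_insert _ _)
        (mem_insert_of_mem _ (mem_insert _ _))
      rcases this with h | h | h
      · exact absurd h hzp
      · exact absurd h hzq
      · exact h
    obtain ⟨a, ha, hza⟩ := mem_iUnion₂.1 hzW
    exact hz' _ (isPreconnected_upper e a) (fun h => hcon.2 (mem_biUnion ha h)) (hub a ha) hza
  have hsub : rootComp e q ⊆ W := by
    by_cases hqe : q = e
    · rw [hqe, rootComp_self]; exact empty_subset _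
    refine IsPreconnected.subset_left_of_subset_union hWo isClosed_closure.isOpen_compl
      (disjoint_compl_right.mono_left subset_closure) ?_ ⟨e, mem_rootComp hqe, heW⟩
      isPreconnected_connectedComponentIn
    intro w hw
    by_cases hwc : w ∈ closure W
    · rcases hclW hwc with rfl | h
      · exact absurd hw (notMem_rootComp e w)
      · exact Or.inl h
    · exact Or.inr hwc
  intro hcon
  obtain ⟨a, ha, h⟩ := mem_iUnion₂.1 (hsub hcon)
  exact hfub a ha h

/-- The fixed point property. -/
lemma exists_fixed (e : X) {f : X → X} (hf : Continuous f) : ∃ x, f x = x := by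
  obtain ⟨⟨x, hx⟩, hxmax⟩ := exists_maximal_of_chains_bounded
    (r := fun a b : {x // le e x (f x)} => le e a.1 b.1) (by
      intro c hc
      obtain ⟨q, h1, h2⟩ := chain_bound hsep e hf (Subtype.val '' c)
        (by rintro _ ⟨a, -, rfl⟩; exact a.2) (by
          rintro _ ⟨a, ha, rfl⟩ _ ⟨b, hb, rfl⟩
          by_cases hab : a = b
          · subst hab; exact Or.inl (le_refl' e _)
          · exact hc ha hb hab)
      exact ⟨⟨q, h1⟩, fun a ha => h2 _ (mem_image_of_mem _ ha)⟩)
    (fun h h' => le_trans' h h')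
  by_contra hno
  push Not at hno
  obtain ⟨y, hxy, hyx, hyf, hyf'⟩ := exists_between' hsep hx (hno x).symm
  obtain ⟨z, hz, hxz, hzx, hzy⟩ := mem_closure_iff.1 (accumulate hsep hxy hyx.symm) _
    ((isOpen_gt e y).preimage hf) ⟨hyf, hyf'.symm⟩
  have hzf : le e z (f z) := le_trans' hzy hz.1
  exact hzx (le_antisymm' (hxmax ⟨z, hzf⟩ hxz) hxz)

end

end DendriteAux

/-- Any homeomorphism commuting with a non-elementary group action on a dendrite
fixes the unique minimal invariant set pointwise. -/
theorem commuting_homeo_fixes_minimal_set (G X : Type*) [Group G] [TopologicalSpace X]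
    [MulAction G X] (hcont : ∀ g : G, Continuous fun x : X => g • x)
    (hX : IsDendrite X) (hne : ¬ ElementaryAction G X)
    (M : Set X) (hMne : M.Nonempty) (hMcl : IsClosed M)
    (hMinv : ∀ g : G, (g • ·) '' M = M)
    (hMmin : ∀ N : Set X, N.Nonempty → IsClosed N → (∀ g : G, (g • ·) '' N = N) → M ⊆ N)
    (h : X ≃ₜ X) (hcomm : ∀ (g : G) (x : X), h (g • x) = g • h x) :
    ∀ m ∈ M, h m = m := by
  obtain ⟨⟨e⟩, _, _, _, _, hno⟩ := hX
  letI := TopologicalSpace.metrizableSpaceMetric X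
  have hfix : {x | h x = x}.Nonempty :=
    DendriteAux.exists_fixed (fun p q hpq => DendriteAux.exists_separating hno hpq) e h.continuous
  refine hMmin {x | h x = x} hfix (isClosed_eq h.continuous continuous_id) fun g => ?_
  ext x
  constructor
  · rintro ⟨y, hy, rfl⟩
    change h (g • y) = g • y
    rw [hcomm, show h y = y from hy]
  · intro hx
    refine ⟨g⁻¹ • x, ?_, smul_inv_smul g x⟩
    change h (g⁻¹ • x) = g⁻¹ • x
    rw [hcomm, show h x = x from hx]
end

section
/- Let G₁ × G₂ be a direct product of two groups acting by homeomorphisms on a dendrite X. Then at least one of the factors G₁, G₂ acts elementarily (fixes a point or preserves a two-point set). -/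
open Set

namespace DendAux

open Topology Filter


theorem unif_loc_conn {X : Type*} [MetricSpace X] [CompactSpace X] [LocallyConnectedSpace X]
    (ε : ℝ) (hε : 0 < ε) : ∃ δ > 0, ∀ x y : X, dist x y < δ →
      ∃ C : Set X, IsPreconnected C ∧ x ∈ C ∧ y ∈ C ∧ C ⊆ Metric.ball x ε := by
  obtain ⟨δ, hδ, h⟩ := lebesgue_number_lemma_of_metric (s := (univ : Set X)) (ι := X)
    (c := fun z => connectedComponentIn (Metric.ball z (ε / 2)) z) isCompact_univ
    (fun z => Metric.isOpen_ball.connectedComponentIn)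
    (fun z _ => mem_iUnion.2 ⟨z, mem_connectedComponentIn (Metric.mem_ball_self (by linarith))⟩)
  refine ⟨δ, hδ, fun x y hxy => ?_⟩
  obtain ⟨z, hz⟩ := h x (mem_univ x)
  have hx := hz (Metric.mem_ball_self hδ)
  refine ⟨_, isPreconnected_connectedComponentIn, hx,
    hz (by rwa [Metric.mem_ball, dist_comm]), ?_⟩
  intro w hw
  have h1 := connectedComponentIn_subset _ _ hw
  have h2 := connectedComponentIn_subset _ _ hx
  rw [Metric.mem_ball] at *
  have := dist_triangle_right w x z
  linarith

/-- Paths in the ambient space made of short segments with vertices in `X`. -/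
inductive ChainP {X E : Type*} [MetricSpace X] [NormedAddCommGroup E] [NormedSpace ℝ E]
    (ι : X → E) (δ : ℝ) : ∀ {x y : X}, Path (ι x) (ι y) → Prop
  | seg (x y : X) (h : dist x y < δ) : ChainP ι δ (Path.segment (ι x) (ι y))
  | trans {x y z : X} (p : Path (ι x) (ι y)) (q : Path (ι y) (ι z)) (hp : ChainP ι δ p)
      (hq : ChainP ι δ q) : ChainP ι δ (p.trans q)

section
variable {X E : Type*} [MetricSpace X] [NormedAddCommGroup E] [NormedSpace ℝ E]

theorem chain_near {ι : X → E} (hι : Isometry ι) {δ : ℝ} {x y : X} {p : Path (ι x) (ι y)}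
    (hp : ChainP ι δ p) (t : unitInterval) : ∃ z, dist (p t) (ι z) < δ := by
  induction hp generalizing t with
  | seg x y h =>
    have hd : 0 < δ := lt_of_le_of_lt dist_nonneg h
    have : Path.segment (ι x) (ι y) t ∈ segment ℝ (ι x) (ι y) := by
      rw [← Path.range_segment]; exact mem_range_self t
    refine ⟨x, ?_⟩
    have h2 : segment ℝ (ι x) (ι y) ⊆ Metric.ball (ι x) δ :=
      (convex_ball (ι x) δ).segment_subset (Metric.mem_ball_self hd)
        (by rw [Metric.mem_ball, hι.dist_eq, dist_comm]; exact h)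
    exact h2 this
  | trans p q hp hq ihp ihq =>
    rw [Path.trans_apply]
    split_ifs
    · exact ihp _
    · exact ihq _

theorem chain_exists {ι : X → E} (hι : Isometry ι) {δ : ℝ} (hδ : 0 < δ) {C : Set X}
    (hC : IsPreconnected C) {z : X} {ε : ℝ} (hCz : C ⊆ Metric.ball z ε) {x y : X}
    (hx : x ∈ C) (hy : y ∈ C) :
    ∃ p : Path (ι x) (ι y), ChainP ι δ p ∧ ∀ t, p t ∈ Metric.ball (ι z) ε := by
  refine hC.induction₂' (fun x y => ∃ p : Path (ι x) (ι y), ChainP ι δ p ∧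
    ∀ t, p t ∈ Metric.ball (ι z) ε) ?_ ?_ hx hy
  · intro x hx
    have h1 : ∀ᶠ y in 𝓝[C] x, y ∈ C := eventually_mem_nhdsWithin
    have h2 : ∀ᶠ y in 𝓝[C] x, dist y x < δ :=
      eventually_nhdsWithin_of_eventually_nhds (Metric.eventually_nhds_iff.2 ⟨δ, hδ, fun _ h => h⟩)
    have key : ∀ x ∈ C, ∀ y ∈ C, dist x y < δ → ∃ p : Path (ι x) (ι y), ChainP ι δ p ∧
        ∀ t, p t ∈ Metric.ball (ι z) ε := by
      intro x hx y hy h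
      refine ⟨_, ChainP.seg x y h, fun t => ?_⟩
      have : Path.segment (ι x) (ι y) t ∈ segment ℝ (ι x) (ι y) := by
        rw [← Path.range_segment]; exact mem_range_self t
      refine (convex_ball (ι z) ε).segment_subset ?_ ?_ this
      · have := hCz hx
        rw [Metric.mem_ball] at *
        rwa [hι.dist_eq]
      · have := hCz hy
        rw [Metric.mem_ball] at *
        rwa [hι.dist_eq]
    filter_upwards [h1, h2] with y hy hd
    exact ⟨key x hx y hy (by rwa [dist_comm]), key y hy x hx hd⟩
  · rintro a b c - - - ⟨p, hp, hp'⟩ ⟨q, hq, hq'⟩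
    refine ⟨_, ChainP.trans p q hp hq, fun t => ?_⟩
    rw [Path.trans_apply]
    split_ifs
    · exact hp' _
    · exact hq' _

theorem chain_refine {ι : X → E} (hι : Isometry ι) {δ δ' ε : ℝ} (hδ' : 0 < δ')
    (hδε : δ ≤ ε)
    (H : ∀ x y : X, dist x y < δ →
      ∃ C : Set X, IsPreconnected C ∧ x ∈ C ∧ y ∈ C ∧ C ⊆ Metric.ball x ε)
    {x y : X} {p : Path (ι x) (ι y)} (hp : ChainP ι δ p) :
    ∃ p' : Path (ι x) (ι y), ChainP ι δ' p' ∧ ∀ t, dist (p t) (p' t) ≤ 2 * ε := by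
  induction hp with
  | seg x y h =>
    obtain ⟨C, hC, hx, hy, hCx⟩ := H x y h
    obtain ⟨p', hp', hb⟩ := chain_exists hι hδ' hC hCx hx hy
    refine ⟨p', hp', fun t => ?_⟩
    have hd : 0 < δ := lt_of_le_of_lt dist_nonneg h
    have : Path.segment (ι x) (ι y) t ∈ segment ℝ (ι x) (ι y) := by
      rw [← Path.range_segment]; exact mem_range_self t
    have h2 : segment ℝ (ι x) (ι y) ⊆ Metric.ball (ι x) δ :=
      (convex_ball (ι x) δ).segment_subset (Metric.mem_ball_self hd)
        (by rw [Metric.mem_ball, hι.dist_eq, dist_comm]; exact h)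
    have h3 := h2 this
    have h4 := hb t
    rw [Metric.mem_ball] at h3 h4
    have := dist_triangle_right (Path.segment (ι x) (ι y) t) (p' t) (ι x)
    linarith
  | trans p q hp hq ihp ihq =>
    obtain ⟨p', hp', hpd⟩ := ihp
    obtain ⟨q', hq', hqd⟩ := ihq
    refine ⟨_, ChainP.trans p' q' hp' hq', fun t => ?_⟩
    rw [Path.trans_apply, Path.trans_apply]
    split_ifs
    · exact hpd _
    · exact hqd _

end

theorem unif_loc_path {X : Type*} [MetricSpace X] [CompactSpace X] [LocallyConnectedSpace X]
    (η : ℝ) (hη : 0 < η) : ∃ δ > 0, ∀ x y : X, dist x y < δ →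
      ∃ p : Path x y, ∀ t, p t ∈ Metric.ball x η := by
  obtain ⟨ι, hι⟩ := KuratowskiEmbedding.exists_isometric_embedding X
  set ε : ℕ → ℝ := fun n => η / 16 / 2 ^ n with hεdef
  have hε : ∀ n, 0 < ε n := fun n => by positivity
  have hx : ∀ n, ∃ δ > 0, δ ≤ ε n ∧ ∀ x y : X, dist x y < δ →
      ∃ C : Set X, IsPreconnected C ∧ x ∈ C ∧ y ∈ C ∧ C ⊆ Metric.ball x (ε n) := by
    intro n
    obtain ⟨δ, hδ, h⟩ := unif_loc_conn (X := X) (ε n) (hε n)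
    exact ⟨min δ (ε n), lt_min hδ (hε n), min_le_right _ _,
      fun x y hxy => h x y (hxy.trans_le (min_le_left _ _))⟩
  choose δ hδ0 hδε hδ using hx
  refine ⟨δ 0, hδ0 0, fun x y hxy => ?_⟩
  let T : ℕ → Type _ := fun n => {p : Path (ι x) (ι y) // ChainP ι (δ n) p}
  have hstep : ∀ n (p : T n), ∃ q : T (n + 1), ∀ t, dist (p.1 t) (q.1 t) ≤ 2 * ε n := by
    intro n p
    obtain ⟨q, hq, hd⟩ := chain_refine hι (hδ0 (n + 1)) (hδε n) (hδ n) p.2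
    exact ⟨⟨q, hq⟩, hd⟩
  choose nxt hnxt using hstep
  let P : ∀ n, T n := fun n => Nat.rec ⟨_, ChainP.seg x y hxy⟩ (fun n p => nxt n p) n
  have hP : ∀ n t, dist ((P n).1 t) ((P (n + 1)).1 t) ≤ 2 * ε n := fun n t => hnxt n (P n) t
  let F : ℕ → C(unitInterval, lp (fun _ : ℕ => ℝ) ⊤) := fun n => (P n).1.toContinuousMap
  have hF : ∀ n, dist (F n) (F (n + 1)) ≤ (η / 4) / 2 / 2 ^ n := by
    intro n
    rw [ContinuousMap.dist_le (by positivity)]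
    intro t
    refine (hP n t).trans (le_of_eq ?_)
    simp only [hεdef]; ring
  obtain ⟨f, hf⟩ := cauchySeq_tendsto_of_complete (cauchySeq_of_le_geometric_two hF)
  have hf0 : dist (F 0) f ≤ η / 4 := dist_le_of_le_geometric_two_of_tendsto₀ hF hf
  have hft : ∀ t, Tendsto (fun n => F n t) atTop (𝓝 (f t)) := fun t =>
    ((continuous_eval_const t).tendsto f).comp hf
  have hεlim : Tendsto ε atTop (𝓝 0) := by
    have : Tendsto (fun n : ℕ => η / 16 * (1 / 2 : ℝ) ^ n) atTop (𝓝 (η / 16 * 0)) :=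
      (tendsto_pow_atTop_nhds_zero_of_lt_one (by norm_num) (by norm_num)).const_mul _
    rw [mul_zero] at this
    refine this.congr fun n => ?_
    simp only [hεdef, one_div, inv_pow]; ring
  have hclosed : IsClosed (range ι) := (isCompact_range hι.continuous).isClosed
  have hmem : ∀ t, f t ∈ range ι := by
    intro t
    rw [← hclosed.closure_eq, Metric.mem_closure_iff]
    intro r hr
    have h1 := Metric.tendsto_nhds.1 (hft t) (r / 2) (by linarith)
    have h2 := hεlim.eventually (gt_mem_nhds (show (0 : ℝ) < r / 2 by linarith))
    obtain ⟨n, hn1, hn2⟩ := (h1.and h2).exists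
    obtain ⟨z, hz⟩ := chain_near hι (P n).2 t
    refine ⟨ι z, mem_range_self z, ?_⟩
    have h3 : dist (F n t) (ι z) < δ n := hz
    have := dist_triangle_left (f t) (ι z) (F n t)
    have := hδε n
    linarith
  choose g hg using hmem
  have hgc : Continuous g := by
    rw [hι.isEmbedding.continuous_iff]
    have : ι ∘ g = f := funext hg
    rw [this]; exact f.continuous
  have h0 : g 0 = x := hι.injective (by
    rw [hg]
    refine tendsto_nhds_unique (hft 0) ?_
    have : (fun n => F n 0) = fun _ => ι x := funext fun n => (P n).1.source
    rw [this]; exact tendsto_const_nhds)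
  have h1 : g 1 = y := hι.injective (by
    rw [hg]
    refine tendsto_nhds_unique (hft 1) ?_
    have : (fun n => F n 1) = fun _ => ι y := funext fun n => (P n).1.target
    rw [this]; exact tendsto_const_nhds)
  refine ⟨⟨⟨g, hgc⟩, h0, h1⟩, fun t => ?_⟩
  change g t ∈ _
  rw [Metric.mem_ball, ← hι.dist_eq, hg]
  have h2 : dist (F 0 t) (f t) ≤ η / 4 := (ContinuousMap.dist_apply_le_dist t).trans hf0
  have h3 : F 0 t ∈ Metric.ball (ι x) (δ 0) := by
    have : F 0 t ∈ segment ℝ (ι x) (ι y) := by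
      rw [← Path.range_segment]; exact mem_range_self t
    exact (convex_ball (ι x) (δ 0)).segment_subset (Metric.mem_ball_self (hδ0 0))
        (by rw [Metric.mem_ball, hι.dist_eq, dist_comm]; exact hxy) this
  rw [Metric.mem_ball] at h3
  have h4 := dist_triangle_left (f t) (ι x) (F 0 t)
  have h5 := hδε 0
  have h6 : ε 0 = η / 16 := by simp [hεdef]
  linarith

theorem joinedIn_of_open_conn {X : Type*} [MetricSpace X] [CompactSpace X]
    [LocallyConnectedSpace X] {U : Set X} (hU : IsOpen U) (hc : IsPreconnected U) {x y : X}
    (hx : x ∈ U) (hy : y ∈ U) : JoinedIn U x y := by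
  refine hc.induction₂' (fun x y => JoinedIn U x y) ?_ ?_ hx hy
  · intro x hx
    obtain ⟨η, hη, hb⟩ := Metric.isOpen_iff.1 hU x hx
    obtain ⟨δ, hδ, h⟩ := unif_loc_path (X := X) η hη
    have h2 : ∀ᶠ y in 𝓝[U] x, dist y x < δ :=
      eventually_nhdsWithin_of_eventually_nhds (Metric.eventually_nhds_iff.2 ⟨δ, hδ, fun _ h => h⟩)
    filter_upwards [h2] with y hd
    obtain ⟨p, hp⟩ := h x y (by rwa [dist_comm])
    have : JoinedIn U x y := ⟨p, fun t => hb (hp t)⟩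
    exact ⟨this, this.symm⟩
  · intro a b c _ _ _ h1 h2
    exact h1.trans h2



section
variable {X : Type*} [MetricSpace X]

theorem exists_min_set {a b : X} (γ : Path a b) : ∃ F : Set unitInterval, IsClosed F ∧ 0 ∈ F ∧
    1 ∈ F ∧ (∀ u ∈ F, ∀ v ∈ F, u < v → (∀ w ∈ F, ¬ (u < w ∧ w < v)) → γ u = γ v) ∧
    (∀ u ∈ F, ∀ v ∈ F, u < v → γ u = γ v → ∀ w ∈ F, ¬ (u < w ∧ w < v)) := by
  let S : Set (Set unitInterval) := {F | IsClosed F ∧ 0 ∈ F ∧ 1 ∈ F ∧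
    (∀ u ∈ F, ∀ v ∈ F, u < v → (∀ w ∈ F, ¬ (u < w ∧ w < v)) → γ u = γ v)}
  have huniv : univ ∈ S := by
    refine ⟨isClosed_univ, mem_univ _, mem_univ _, fun u _ v _ huv h => ?_⟩
    obtain ⟨w, hw⟩ := exists_between huv
    exact absurd hw (h w (mem_univ w))
  obtain ⟨F, -, hF⟩ := zorn_superset_nonempty S (by
    intro c hcS hc hne
    refine ⟨⋂₀ c, ⟨isClosed_sInter fun F hF => (hcS hF).1, fun F hF => (hcS hF).2.1,
      fun F hF => (hcS hF).2.2.1, ?_⟩, fun s hs => sInter_subset_of_mem hs⟩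
    intro u hu v hv huv hgap
    refine eq_of_forall_dist_le fun r hr => ?_
    obtain ⟨m, hum, hmv⟩ := exists_between huv
    have h1 : {t | dist (γ t) (γ u) < r / 2} ∈ 𝓝[≥] u := by
      refine mem_nhdsWithin_of_mem_nhds ?_
      exact (Metric.tendsto_nhds.1 (γ.continuous.tendsto u)) (r / 2) (by linarith)
    have h2 : {t | dist (γ t) (γ v) < r / 2} ∈ 𝓝[≤] v := by
      refine mem_nhdsWithin_of_mem_nhds ?_
      exact (Metric.tendsto_nhds.1 (γ.continuous.tendsto v)) (r / 2) (by linarith)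
    have hU : ∃ u₁ ∈ Ioc u m, Icc u u₁ ⊆ {t | dist (γ t) (γ u) < r / 2} := by
      obtain ⟨u₂, hu₂, hu₂'⟩ := (mem_nhdsGE_iff_exists_mem_Ioc_Ico_subset hum).1 h1
      obtain ⟨u₁, h3, h4⟩ := exists_between hu₂.1
      exact ⟨u₁, ⟨h3, h4.le.trans hu₂.2⟩, fun t ht => hu₂' ⟨ht.1, ht.2.trans_lt h4⟩⟩
    have hV : ∃ v₁ ∈ Ico m v, Icc v₁ v ⊆ {t | dist (γ t) (γ v) < r / 2} := by
      obtain ⟨v₂, hv₂, hv₂'⟩ := (mem_nhdsLE_iff_exists_mem_Ico_Ioc_subset hmv).1 h2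
      obtain ⟨v₁, h3, h4⟩ := exists_between hv₂.2
      exact ⟨v₁, ⟨hv₂.1.trans h3.le, h4⟩, fun t ht => hv₂' ⟨h3.trans_le ht.1, ht.2⟩⟩
    obtain ⟨u₁, hu₁, hu₁'⟩ := hU
    obtain ⟨v₁, hv₁, hv₁'⟩ := hV
    have hex : ∃ F ∈ c, Icc u₁ v₁ ∩ F = ∅ := by
      by_contra hcon
      push Not at hcon
      have : Nonempty c := hne.to_subtype
      have := IsCompact.nonempty_iInter_of_directed_nonempty_isCompact_isClosed
        (fun F : c => Icc u₁ v₁ ∩ F.1) (by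
          intro A B
          rcases hc.total A.2 B.2 with h | h
          · exact ⟨A, Subset.rfl, inter_subset_inter_right _ h⟩
          · exact ⟨B, inter_subset_inter_right _ h, Subset.rfl⟩)
        (fun F => hcon F.1 F.2) (fun F => (isClosed_Icc.inter (hcS F.2).1).isCompact)
        (fun F => (isClosed_Icc.inter (hcS F.2).1))
      obtain ⟨w, hw⟩ := this
      rw [mem_iInter] at hw
      obtain ⟨F₀, hF₀⟩ := hne
      have hw1 := (hw ⟨F₀, hF₀⟩).1
      exact hgap w (fun F hF => (hw ⟨F, hF⟩).2)
        ⟨hu₁.1.trans_le hw1.1, hw1.2.trans_lt hv₁.2⟩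
    obtain ⟨F, hFc, hFe⟩ := hex
    have hFS := hcS hFc
    obtain ⟨u', hu'⟩ := (isClosed_Icc.inter hFS.1 : IsClosed (Icc u u₁ ∩ F)).isCompact.exists_isGreatest
      ⟨u, ⟨le_rfl, hu₁.1.le⟩, hu F hFc⟩
    obtain ⟨v', hv'⟩ := (isClosed_Icc.inter hFS.1 : IsClosed (Icc v₁ v ∩ F)).isCompact.exists_isLeast
      ⟨v, ⟨hv₁.2.le, le_rfl⟩, hv F hFc⟩
    have huv' : u' < v' := by
      rcases lt_or_eq_of_le ((hu'.1.1.2.trans hu₁.2).trans (hv₁.1.trans hv'.1.1.1)) with h | h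
      · exact h
      · exfalso
        have : u' ∈ Icc u₁ v₁ ∩ F := ⟨⟨?_, ?_⟩, hu'.1.2⟩
        · rw [hFe] at this; exact this
        · rw [h]; exact hu₁.2.trans (hv₁.1.trans hv'.1.1.1)
        · exact hu'.1.1.2.trans (hu₁.2.trans hv₁.1)
    have hg : γ u' = γ v' := by
      refine hFS.2.2.2 u' hu'.1.2 v' hv'.1.2 huv' ?_
      rintro w hw ⟨hw1, hw2⟩
      by_cases h3 : w ≤ u₁
      · exact absurd (hu'.2 ⟨⟨hu'.1.1.1.trans hw1.le, h3⟩, hw⟩) (not_le.2 hw1)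
      by_cases h4 : v₁ ≤ w
      · exact absurd (hv'.2 ⟨⟨h4, hw2.le.trans hv'.1.1.2⟩, hw⟩) (not_le.2 hw2)
      have : w ∈ Icc u₁ v₁ ∩ F := ⟨⟨(not_le.1 h3).le, (not_le.1 h4).le⟩, hw⟩
      rw [hFe] at this; exact this
    have e1 : dist (γ u') (γ u) < r / 2 := hu₁' hu'.1.1
    have e2 : dist (γ v') (γ v) < r / 2 := hv₁' hv'.1.1
    rw [hg] at e1
    have := dist_triangle_left (γ u) (γ v) (γ v')
    linarith) univ huniv
  refine ⟨F, hF.1.1, hF.1.2.1, hF.1.2.2.1, hF.1.2.2.2, ?_⟩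
  intro s hs t ht hst hγ w hw hwst
  have hmem : F \ Ioo s t ∈ S := by
    refine ⟨hF.1.1.sdiff isOpen_Ioo, ⟨hF.1.2.1, fun h => not_lt.2 unitInterval.nonneg' h.1⟩,
      ⟨hF.1.2.2.1, fun h => not_lt.2 unitInterval.le_one' h.2⟩, ?_⟩
    rintro u ⟨hu, hu'⟩ v ⟨hv, hv'⟩ huv hgap
    have hs' : s ∈ F \ Ioo s t := ⟨hs, fun h => lt_irrefl _ h.1⟩
    have ht' : t ∈ F \ Ioo s t := ⟨ht, fun h => lt_irrefl _ h.2⟩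
    have g1 := hgap s hs'
    have g2 := hgap t ht'
    simp only [mem_Ioo, not_and, not_lt] at hu' hv' g1 g2
    by_cases hus : u < s
    · have hvs := g1 hus
      refine hF.1.2.2.2 u hu v hv huv fun w hw h => hgap w ⟨hw, fun h' => ?_⟩ h
      exact absurd (h'.1.trans (h.2.trans_le hvs)) (lt_irrefl _)
    · rw [not_lt] at hus
      by_cases hut : t ≤ u
      · refine hF.1.2.2.2 u hu v hv huv fun w hw h => hgap w ⟨hw, fun h' => ?_⟩ h
        exact absurd (h'.2.trans_le (hut.trans h.1.le)) (lt_irrefl _)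
      · rw [not_le] at hut
        have hus' : u = s := by
          rcases hus.lt_or_eq with h | h
          · exact absurd hut (not_lt.2 (hu' h))
          · exact h.symm
        have hvt : v = t := by
          refine le_antisymm (g2 hut) ?_
          exact hv' (hus' ▸ huv)
        rw [hus', hvt, hγ]
  have := hF.2 hmem sdiff_subset hw
  exact this.2 hwst

theorem exists_mono_path {a b : X} (γ : Path a b) : ∃ g : Path a b, range g ⊆ range γ ∧
    ∀ s u t : unitInterval, s ≤ u → u ≤ t → g s = g t → g u = g s := by
  obtain ⟨F, hFc, h0, h1, hgap, hmin⟩ := exists_min_set γ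
  have hσ : ∀ t : unitInterval, ∃ s, IsGreatest (F ∩ Iic t) s := fun t =>
    (hFc.inter isClosed_Iic).isCompact.exists_isGreatest ⟨0, h0, unitInterval.nonneg'⟩
  choose σ hσ using hσ
  have key : ∀ s s' : unitInterval, s ≤ s' → γ (σ s) = γ (σ s') ∨ ∃ x ∈ Icc s s', ∃ y ∈ Icc s s',
      γ (σ s) = γ x ∧ γ (σ s') = γ y := by
    intro s s' hss
    by_cases h : σ s = σ s'
    · left; rw [h]
    right
    have hσs' : s ≤ σ s' := by
      by_contra hlt
      refine h (le_antisymm ((hσ s').2 ⟨(hσ s).1.1, (hσ s).1.2.trans hss⟩)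
        ((hσ s).2 ⟨(hσ s').1.1, (not_le.1 hlt).le⟩))
    obtain ⟨τ, hτ⟩ := (hFc.inter isClosed_Ici : IsClosed (F ∩ Ici s)).isCompact.exists_isLeast
        ⟨1, h1, unitInterval.le_one'⟩
    have hτs : τ ≤ σ s' := hτ.2 ⟨(hσ s').1.1, hσs'⟩
    refine ⟨τ, ⟨hτ.1.2, hτs.trans (hσ s').1.2⟩, σ s', ⟨hσs', (hσ s').1.2⟩, ?_, rfl⟩
    have hle : σ s ≤ τ := le_trans (hσ s).1.2 hτ.1.2
    rcases hle.lt_or_eq with hlt | heq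
    · refine hgap _ (hσ s).1.1 _ hτ.1.1 hlt fun w hw hw' => ?_
      rcases le_total w s with h2 | h2
      · exact absurd ((hσ s).2 ⟨hw, h2⟩) (not_le.2 hw'.1)
      · exact absurd (hτ.2 ⟨hw, h2⟩) (not_le.2 hw'.2)
    · rw [heq]
  have hmono : ∀ s t, s ≤ t → σ s ≤ σ t := fun s t hst =>
    (hσ t).2 ⟨(hσ s).1.1, (hσ s).1.2.trans hst⟩
  have hcont : Continuous fun t => γ (σ t) := by
    have hu := CompactSpace.uniformContinuous_of_continuous γ.continuous
    refine UniformContinuous.continuous ?_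
    rw [Metric.uniformContinuous_iff] at hu ⊢
    intro ε hε
    obtain ⟨δ, hδ, h⟩ := hu ε hε
    have main : ∀ s t : unitInterval, s ≤ t → dist s t < δ → dist (γ (σ s)) (γ (σ t)) < ε := by
      intro s t hst hd
      rcases key s t hst with h2 | ⟨x, hx, y, hy, hx', hy'⟩
      · rw [h2, dist_self]; exact hε
      · rw [hx', hy']
        refine h (lt_of_le_of_lt ?_ hd)
        rw [Subtype.dist_eq, Subtype.dist_eq]
        exact Real.dist_le_of_mem_uIcc (Icc_subset_uIcc ⟨hx.1, hx.2⟩) (Icc_subset_uIcc ⟨hy.1, hy.2⟩)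
    refine ⟨δ, hδ, fun {s t} hd => ?_⟩
    rcases le_total s t with hst | hst
    · exact main s t hst hd
    · rw [dist_comm] at hd ⊢; exact main t s hst hd
  have hs0 : σ 0 = 0 := le_antisymm (hσ 0).1.2 unitInterval.nonneg'
  have hs1 : σ 1 = 1 := le_antisymm unitInterval.le_one' ((hσ 1).2 ⟨h1, mem_Iic.2 le_rfl⟩)
  refine ⟨⟨⟨_, hcont⟩, by simp [hs0], by simp [hs1]⟩, ?_, ?_⟩
  · rintro _ ⟨t, rfl⟩
    exact mem_range_self _
  · intro s u t hsu hut hst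
    change γ (σ s) = γ (σ t) at hst
    change γ (σ u) = γ (σ s)
    rcases (hmono s u hsu).lt_or_eq with h2 | h2
    · rcases (hmono u t hut).lt_or_eq with h3 | h3
      · exact absurd ⟨h2, h3⟩ (hmin _ (hσ s).1.1 _ (hσ t).1.1 (h2.trans h3) hst _ (hσ u).1.1)
      · rw [h3, hst]
    · rw [h2]

theorem exists_arc {a b : X} (hab : a ≠ b) (γ : Path a b) : ∃ α : Path a b,
    range α ⊆ range γ ∧ Function.Injective α := by
  obtain ⟨g, hgγ, hg⟩ := exists_mono_path γ
  let D : unitInterval → unitInterval → ℝ := fun q s => dist (g (max s q)) (g q)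
  let m : unitInterval → unitInterval → ℝ := fun q t => sSup ((fun s => D q (min s t)) '' univ)
  have hDc : ∀ q, Continuous (D q) := fun q => by
    have := g.continuous
    fun_prop
  have hmc : ∀ q, Continuous (m q) := fun q => by
    refine IsCompact.continuous_sSup isCompact_univ (f := fun t s => D q (min s t)) ?_
    have := hDc q
    exact this.comp (by fun_prop)
  have hD0 : ∀ q s, s ≤ q → D q s = 0 := fun q s h => by simp [D, max_eq_right h]
  obtain ⟨B, hB⟩ : ∃ B, ∀ s t, dist (g s) (g t) ≤ B := by
    obtain ⟨B, hB⟩ := Metric.isBounded_iff.1 (isCompact_range g.continuous).isBounded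
    exact ⟨B, fun s t => hB (mem_range_self s) (mem_range_self t)⟩
  have hbdd : ∀ q t, BddAbove ((fun s => D q (min s t)) '' univ) := fun q t =>
    ⟨B, by rintro _ ⟨s, -, rfl⟩; exact hB _ _⟩
  have hne : ∀ q t, ((fun s => D q (min s t)) '' univ).Nonempty := fun q t =>
    ⟨_, 0, mem_univ _, rfl⟩
  have hne' := hne
  have hm0 : ∀ q t, 0 ≤ m q t := fun q t =>
    le_csSup_of_le (hbdd q t) ⟨0, mem_univ _, rfl⟩ dist_nonneg
  have hmB : ∀ q t, m q t ≤ B := fun q t =>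
    csSup_le (hne q t) (by rintro _ ⟨s, -, rfl⟩; exact hB _ _)
  have hmono : ∀ q s t, s ≤ t → m q s ≤ m q t := fun q s t hst => by
    refine csSup_le_csSup (hbdd q t) (hne q s) ?_
    rintro _ ⟨r, -, rfl⟩
    refine ⟨min r s, mem_univ _, ?_⟩
    simp only
    rw [min_assoc, min_eq_left hst]
  have heq : ∀ q s t, s ≤ t → g s = g t → m q t ≤ m q s := fun q s t hst hgst => by
    refine csSup_le_csSup (hbdd q s) (hne q t) ?_
    rintro _ ⟨r, -, rfl⟩
    rcases le_or_gt (min r t) s with h | h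
    · exact ⟨min r t, mem_univ _, by simp only; rw [min_eq_left h]⟩
    · refine ⟨s, mem_univ _, ?_⟩
      simp only [min_self]
      rcases le_or_gt (min r t) q with h2 | h2
      · rw [hD0 q _ h2, hD0 q s (h.le.trans h2)]
      · have e : g (min r t) = g s := hg s _ t h.le (min_le_right _ _) hgst
        rcases le_or_gt q s with h3 | h3
        · simp only [D]
          rw [max_eq_left h3, max_eq_left h2.le, e]
        · rw [hD0 q s h3.le]
          simp only [D]
          rw [max_eq_left h2.le, e, hg s q t h3.le (h2.le.trans (min_le_right _ _)) hgst, dist_self]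
  let Q : ℕ → unitInterval := TopologicalSpace.denseSeq unitInterval
  let f : ℕ → unitInterval → ℝ := fun n t => (1 / 2 : ℝ) ^ n * m (Q n) t
  have hsum : Summable fun n : ℕ => (1 / 2 : ℝ) ^ n * B := summable_geometric_two.mul_right B
  have hf0 : ∀ n t, 0 ≤ f n t := fun n t => mul_nonneg (by positivity) (hm0 _ _)
  have hfB : ∀ n t, f n t ≤ (1 / 2 : ℝ) ^ n * B := fun n t =>
    mul_le_mul_of_nonneg_left (hmB _ _) (by positivity)
  have hfs : ∀ t, Summable fun n => f n t := fun t =>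
    Summable.of_nonneg_of_le (fun n => hf0 n t) (fun n => hfB n t) hsum
  let φ : unitInterval → ℝ := fun t => ∑' n, f n t
  have hφc : Continuous φ := continuous_tsum (fun n => (hmc (Q n)).const_mul _) hsum
    (fun n t => by rw [Real.norm_of_nonneg (hf0 n t)]; exact hfB n t)
  have hφmono : Monotone φ := fun s t hst => (hfs s).tsum_le_tsum
    (fun n => mul_le_mul_of_nonneg_left (hmono _ _ _ hst) (by positivity)) (hfs t)
  have hφeq : ∀ s t, s ≤ t → g s = g t → φ s = φ t := fun s t hst h =>
    le_antisymm (hφmono hst) ((hfs t).tsum_le_tsum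
    (fun n => mul_le_mul_of_nonneg_left (heq _ _ _ hst h) (by positivity)) (hfs s))
  have hφlt : ∀ s t, s ≤ t → g s ≠ g t → φ s < φ t := by
    intro s t hst h
    have hlt : s < t := lt_of_le_of_ne hst fun e => h (by rw [e])
    have hopen : IsOpen {u | g u ≠ g t} := isOpen_ne_fun g.continuous continuous_const
    have hne : ({u | g u ≠ g t} ∩ Ioo s t).Nonempty := by
      have h1 : {u | g u ≠ g t} ∈ 𝓝[≥] s := mem_nhdsWithin_of_mem_nhds (hopen.mem_nhds h)
      obtain ⟨u₂, hu₂, hu₂'⟩ := (mem_nhdsGE_iff_exists_mem_Ioc_Ico_subset hlt).1 h1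
      obtain ⟨u₁, h3, h4⟩ := exists_between hu₂.1
      exact ⟨u₁, hu₂' ⟨h3.le, h4⟩, h3, h4.trans_le hu₂.2⟩
    obtain ⟨q, ⟨hq1, hq2⟩, n, rfl⟩ := (TopologicalSpace.denseRange_denseSeq unitInterval).inter_open_nonempty
      _ (hopen.inter isOpen_Ioo) hne
    refine Summable.tsum_lt_tsum_of_nonneg (i := n) (fun n => hf0 n s)
      (fun n => mul_le_mul_of_nonneg_left (hmono _ _ _ hst) (by positivity)) ?_ (hfs t)
    refine mul_lt_mul_of_pos_left ?_ (by positivity)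
    have e1 : m (Q n) s ≤ 0 := csSup_le (hne' (Q n) s) (by
      rintro _ ⟨r, -, rfl⟩
      exact (hD0 _ _ ((min_le_right _ _).trans hq2.1.le)).le)
    have e2 : 0 < m (Q n) t := by
      refine lt_of_lt_of_le ?_ (le_csSup (hbdd (Q n) t) ⟨t, mem_univ _, rfl⟩)
      simp only [min_self, D]
      rw [max_eq_left hq2.2.le]
      exact dist_pos.2 (Ne.symm hq1)
    exact lt_of_le_of_lt e1 e2
  have hφiff : ∀ s t, φ s = φ t → g s = g t := by
    intro s t h
    by_contra hne
    rcases le_total s t with hst | hst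
    · exact (hφlt s t hst hne).ne h
    · exact (hφlt t s hst (Ne.symm hne)).ne h.symm
  have h01 : φ 0 < φ 1 := hφlt 0 1 unitInterval.nonneg' (by rw [g.source, g.target]; exact hab)
  have hd : 0 < φ 1 - φ 0 := by linarith
  have hψI : ∀ t, (φ t - φ 0) / (φ 1 - φ 0) ∈ unitInterval := fun t => by
    have h1 : φ 0 ≤ φ t := hφmono unitInterval.nonneg'
    have h2 : φ t ≤ φ 1 := hφmono unitInterval.le_one'
    exact ⟨div_nonneg (by linarith) hd.le, (div_le_one hd).2 (by linarith)⟩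
  let ψ : unitInterval → unitInterval := fun t => ⟨_, hψI t⟩
  have hψc : Continuous ψ := by
    refine Continuous.subtype_mk ?_ _
    fun_prop
  have hψ0 : ψ 0 = 0 := Subtype.ext (by simp [ψ])
  have hψ1 : ψ 1 = 1 := Subtype.ext (by simp [ψ, hd.ne'])
  have hsurj : Function.Surjective ψ := by
    intro y
    have := intermediate_value_univ (0 : unitInterval) 1 hψc
    rw [hψ0, hψ1] at this
    exact this ⟨unitInterval.nonneg', unitInterval.le_one'⟩
  have hψφ : ∀ s t, ψ s = ψ t ↔ φ s = φ t := by
    intro s t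
    simp only [ψ, Subtype.mk.injEq]
    rw [div_left_inj' hd.ne', sub_left_inj]
  have hq := IsQuotientMap.of_surjective_continuous hsurj hψc
  let G : unitInterval → X := fun y => g (Function.surjInv hsurj y)
  have hGψ : ∀ t, G (ψ t) = g t := fun t =>
    hφiff _ _ ((hψφ _ _).1 (Function.surjInv_eq hsurj (ψ t)))
  have hGc : Continuous G := by
    rw [hq.continuous_iff]
    have : G ∘ ψ = g := funext hGψ
    rw [this]; exact g.continuous
  refine ⟨⟨⟨G, hGc⟩, ?_, ?_⟩, ?_, ?_⟩
  · change G 0 = a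
    rw [← hψ0, hGψ, g.source]
  · change G 1 = b
    rw [← hψ1, hGψ, g.target]
  · rintro _ ⟨t, rfl⟩
    exact hgγ (mem_range_self _)
  · intro y y' h
    obtain ⟨t, rfl⟩ := hsurj y
    obtain ⟨t', rfl⟩ := hsurj y'
    change G (ψ t) = G (ψ t') at h
    rw [hGψ, hGψ] at h
    rw [hψφ]
    rcases le_total t t' with hst | hst
    · exact hφeq _ _ hst h
    · exact (hφeq _ _ hst h.symm).symm
end

section
variable {X : Type*} [MetricSpace X]

theorem circle_of_arcs {a b : X} (α β : Path a b) (hα : Function.Injective α)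
    (hβ : Function.Injective β) (hab : ∀ s t, α s = β t → α s = a ∨ α s = b) :
    ∃ S : Set X, Nonempty (S ≃ₜ Circle) := by
  let p := α.trans β.symm
  have hf1 : ∀ t (h : t ∈ Icc (0 : ℝ) (1 / 2)), p.extend t = α ⟨2 * t, by
      constructor <;> linarith [h.1, h.2]⟩ := by
    intro t h
    rw [Path.extend_trans_of_le_half _ _ h.2, Path.extend_apply _ (by constructor <;> linarith [h.1, h.2])]
  have hf2 : ∀ t (h : t ∈ Icc (1 / 2 : ℝ) 1), p.extend t = β ⟨2 - 2 * t, by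
      constructor <;> linarith [h.1, h.2]⟩ := by
    intro t h
    rw [Path.extend_trans_of_half_le _ _ h.1, Path.extend_symm_apply,
      Path.extend_apply _ (by constructor <;> linarith [h.1, h.2])]
    congr 1
    ext
    simp only
    ring
  have cross : ∀ s t : ℝ, s ∈ Icc (0 : ℝ) (1 / 2) → t ∈ Ioo (1 / 2 : ℝ) 1 →
      p.extend s ≠ p.extend t := by
    intro s t hs ht h
    rw [hf1 s hs, hf2 t ⟨ht.1.le, ht.2.le⟩] at h
    rcases hab _ _ h with h' | h'
    · rw [h] at h'
      have := hβ (h'.trans β.source.symm)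
      have : 2 - 2 * t = 0 := congrArg Subtype.val this
      linarith [ht.2]
    · rw [h] at h'
      have := hβ (h'.trans β.target.symm)
      have : 2 - 2 * t = 1 := congrArg Subtype.val this
      linarith [ht.1]
  have hinj : ∀ s ∈ Ico (0 : ℝ) 1, ∀ t ∈ Ico (0 : ℝ) 1, p.extend s = p.extend t → s = t := by
    intro s hs t ht h
    rcases le_or_gt s (1 / 2) with h1 | h1 <;> rcases le_or_gt t (1 / 2) with h2 | h2
    · rw [hf1 s ⟨hs.1, h1⟩, hf1 t ⟨ht.1, h2⟩] at h
      have := congrArg Subtype.val (hα h)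
      simp only at this
      linarith
    · exact absurd h (cross s t ⟨hs.1, h1⟩ ⟨h2, ht.2⟩)
    · exact absurd h.symm (cross t s ⟨ht.1, h2⟩ ⟨h1, hs.2⟩)
    · rw [hf2 s ⟨h1.le, hs.2.le⟩, hf2 t ⟨h2.le, ht.2.le⟩] at h
      have := congrArg Subtype.val (hβ h)
      simp only at this
      linarith
  have : Fact ((0 : ℝ) < 1) := ⟨one_pos⟩
  let F : AddCircle (1 : ℝ) → X := AddCircle.liftIco 1 0 p.extend
  have hFc : Continuous F := AddCircle.liftIco_zero_continuous (by simp)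
    p.extend.continuous.continuousOn
  have hFi : Function.Injective F := by
    intro x y hxy
    have hx : x ∈ ((↑) : ℝ → AddCircle (1 : ℝ)) '' Ico 0 (0 + 1) := by
      rw [AddCircle.coe_image_Ico_eq]; exact mem_univ _
    have hy : y ∈ ((↑) : ℝ → AddCircle (1 : ℝ)) '' Ico 0 (0 + 1) := by
      rw [AddCircle.coe_image_Ico_eq]; exact mem_univ _
    rw [zero_add] at hx hy
    obtain ⟨s, hs, rfl⟩ := hx
    obtain ⟨t, ht, rfl⟩ := hy
    simp only [F] at hxy
    rw [AddCircle.liftIco_zero_coe_apply hs, AddCircle.liftIco_zero_coe_apply ht] at hxy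
    rw [hinj s hs t ht hxy]
  have hemb := (hFc.isClosedEmbedding hFi).isEmbedding
  exact ⟨range F, ⟨hemb.toHomeomorph.symm.trans (AddCircle.homeomorphCircle one_ne_zero)⟩⟩

theorem subpath_inj {a b : X} {γ : Path a b} (hγ : Function.Injective γ) {s t : unitInterval}
    (hst : s ≠ t) : Function.Injective (γ.subpath s t) := by
  intro x y h
  have h2 := congrArg Subtype.val (hγ h)
  have hst' : (s : ℝ) ≠ t := fun e => hst (Subtype.ext e)
  have h3 : (1 - (x : ℝ)) * s + x * t = (1 - (y : ℝ)) * s + y * t := by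
    simpa [Set.Icc.convexComb] using h2
  have h4 : ((x : ℝ) - y) * (t - s) = 0 := by linarith
  rcases mul_eq_zero.1 h4 with h5 | h5
  · exact Subtype.ext (by linarith)
  · exact absurd (by linarith) hst'

theorem arc_subset (hX : ¬ ∃ S : Set X, Nonempty (S ≃ₜ Circle)) {a b : X} (α β : Path a b)
    (hα : Function.Injective α) (hβ : Function.Injective β) : range α ⊆ range β := by
  rintro _ ⟨t₀, rfl⟩
  by_contra hcon
  apply hX
  have hK : IsClosed (α ⁻¹' (range β)) :=
    (isCompact_range β.continuous).isClosed.preimage α.continuous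
  obtain ⟨s, hs⟩ := (hK.inter isClosed_Iic : IsClosed (_ ∩ Iic t₀)).isCompact.exists_isGreatest
    ⟨0, ⟨0, by simp⟩, unitInterval.nonneg'⟩
  obtain ⟨s', hs'⟩ := (hK.inter isClosed_Ici : IsClosed (_ ∩ Ici t₀)).isCompact.exists_isLeast
    ⟨1, ⟨1, by simp⟩, unitInterval.le_one'⟩
  obtain ⟨u, hu⟩ := hs.1.1
  obtain ⟨u', hu'⟩ := hs'.1.1
  have hst : s < t₀ := lt_of_le_of_ne hs.1.2 (by rintro rfl; exact hcon hs.1.1)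
  have hst' : t₀ < s' := lt_of_le_of_ne hs'.1.2 (by rintro rfl; exact hcon hs'.1.1)
  have hss : s ≠ s' := (hst.trans hst').ne
  have huu : u ≠ u' := by
    rintro rfl
    exact hss (hα (hu.symm.trans hu'))
  refine circle_of_arcs (α.subpath s s') ((β.subpath u u').cast hu.symm hu'.symm)
    (subpath_inj hα hss) (subpath_inj hβ huu) ?_
  intro x y hxy
  have h1 : α.subpath s s' x ∈ range (α.subpath s s') := mem_range_self x
  rw [Path.range_subpath_of_le _ _ _ (hst.trans hst').le] at h1
  obtain ⟨r, hr, hrx⟩ := h1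
  have h2 : r ∈ α ⁻¹' (range β) := by
    change α r ∈ range β
    rw [hrx, hxy]
    exact mem_range_self _
  rw [← hrx]
  rcases le_total r t₀ with h | h
  · left; rw [le_antisymm (hs.2 ⟨h2, h⟩) hr.1]
  · right; rw [le_antisymm hr.2 (hs'.2 ⟨h2, h⟩)]

end

/-- Intersections of connected sets are connected. -/
def Unic (X : Type*) [TopologicalSpace X] : Prop :=
  ∀ S : Set (Set X), (∀ C ∈ S, IsPreconnected C) → IsPreconnected (⋂₀ S)

theorem Unic.inter {X : Type*} [TopologicalSpace X] (h : Unic X) {C D : Set X}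
    (hC : IsPreconnected C) (hD : IsPreconnected D) : IsPreconnected (C ∩ D) := by
  rw [← sInter_pair]
  refine h _ ?_
  rintro E (rfl | rfl)
  · exact hC
  · exact hD

section
variable {X : Type*} [MetricSpace X] [CompactSpace X] [ConnectedSpace X] [LocallyConnectedSpace X]

theorem joined_compact {U : Set X} (hU : IsOpen U) (hc : IsPreconnected U) {x y : X}
    (hx : x ∈ U) (hy : y ∈ U) : ∃ K : Set X, IsCompact K ∧ IsPreconnected K ∧ K ⊆ U ∧
      x ∈ K ∧ y ∈ K := by
  obtain ⟨p, hp⟩ := joinedIn_of_open_conn hU hc hx hy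
  refine ⟨range p, isCompact_range p.continuous, isPreconnected_range p.continuous, ?_,
    ⟨0, p.source⟩, ⟨1, p.target⟩⟩
  rintro _ ⟨t, rfl⟩
  exact hp t

theorem unic_of_no_circle (hX : ¬ ∃ S : Set X, Nonempty (S ≃ₜ Circle)) : Unic X := by
  intro S hS
  refine isPreconnected_of_forall_pair fun a ha b hb => ?_
  by_cases hab : a = b
  · subst hab
    exact ⟨{a}, singleton_subset_iff.2 ha, rfl, rfl, isPreconnected_singleton⟩
  obtain ⟨γ, -⟩ := joinedIn_of_open_conn isOpen_univ isPreconnected_univ (mem_univ a) (mem_univ b)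
  obtain ⟨α, -, hα⟩ := exists_arc hab γ
  refine ⟨range α, ?_, ⟨0, α.source⟩, ⟨1, α.target⟩, isPreconnected_range α.continuous⟩
  intro p hp C hC
  by_contra hpC
  have haC := ha C hC
  have hbC := hb C hC
  have hsub : C ⊆ connectedComponentIn {p}ᶜ a :=
    (hS C hC).subset_connectedComponentIn haC fun x hx hxp => hpC (hxp ▸ hx)
  obtain ⟨γ', hγ'⟩ := joinedIn_of_open_conn (isOpen_compl_singleton.connectedComponentIn)
    isPreconnected_connectedComponentIn (hsub haC) (hsub hbC)
  obtain ⟨β, hβγ, hβ⟩ := exists_arc hab γ'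
  obtain ⟨t, ht⟩ := hβγ (arc_subset hX α β hα hβ hp)
  exact connectedComponentIn_subset _ _ (hγ' t) ht

theorem closure_comp_subset {Y : Set X} (hY : IsClosed Y) (x : X) :
    closure (connectedComponentIn Yᶜ x) ⊆ connectedComponentIn Yᶜ x ∪ Y := by
  intro z hz
  by_cases hzY : z ∈ Y
  · exact Or.inr hzY
  left
  have hopen : IsOpen (connectedComponentIn Yᶜ z) := hY.isOpen_compl.connectedComponentIn
  obtain ⟨w, hw1, hw2⟩ := mem_closure_iff.1 hz _ hopen (mem_connectedComponentIn hzY)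
  rw [connectedComponentIn_eq hw2, ← connectedComponentIn_eq hw1]
  exact mem_connectedComponentIn hzY

theorem closure_comp_meets {Y : Set X} (hY : IsClosed Y) (hne : Y.Nonempty) {x : X} (hx : x ∉ Y) :
    ∃ p ∈ Y, p ∈ closure (connectedComponentIn Yᶜ x) := by
  by_contra hcon
  push Not at hcon
  have hcl : IsClosed (connectedComponentIn Yᶜ x) := by
    refine isClosed_of_closure_subset fun z hz => ?_
    rcases closure_comp_subset hY x hz with h | h
    · exact h
    · exact absurd hz (hcon z h)
  have hopen : IsOpen (connectedComponentIn Yᶜ x) := hY.isOpen_compl.connectedComponentIn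
  have := IsClopen.eq_univ ⟨hcl, hopen⟩ ⟨x, mem_connectedComponentIn hx⟩
  obtain ⟨y, hy⟩ := hne
  have h2 : y ∈ connectedComponentIn Yᶜ x := by rw [this]; exact mem_univ y
  exact connectedComponentIn_subset _ _ h2 hy

/-- Adding the cut point to a component of its complement gives a connected set. -/
theorem insert_comp_preconn (x y : X) :
    IsPreconnected (insert x (connectedComponentIn {x}ᶜ y)) := by
  by_cases hxy : y = x
  · rw [connectedComponentIn_eq_empty (by simp [hxy])]
    simpa using isPreconnected_singleton
  · refine isPreconnected_connectedComponentIn.subset_closure (subset_insert _ _) ?_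
    refine insert_subset ?_ subset_closure
    obtain ⟨p, hp, hp'⟩ := closure_comp_meets (isClosed_singleton (x := x)) ⟨x, rfl⟩
      (x := y) (by simpa using hxy)
    rw [mem_singleton_iff] at hp
    rwa [hp] at hp'

theorem small_conn (x : X) {z : X} (hxz : x ≠ z) : ∃ N : Set X, IsOpen N ∧ IsPreconnected N ∧
    x ∈ N ∧ z ∉ closure N := by
  obtain ⟨U, V, hU, hV, hxU, hzV, hUV⟩ := t2_separation hxz
  refine ⟨connectedComponentIn U x, hU.connectedComponentIn, isPreconnected_connectedComponentIn,
    mem_connectedComponentIn hxU, fun h => ?_⟩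
  obtain ⟨w, hw1, hw2⟩ := mem_closure_iff.1 h V hV hzV
  exact (disjoint_left.1 hUV) (connectedComponentIn_subset _ _ hw2) hw1

theorem gate (hI : Unic X) {Y : Set X} (hY : IsClosed Y) (hYc : IsPreconnected Y)
    (hne : Y.Nonempty) {x : X} (hx : x ∉ Y) :
    ∃ p ∈ Y, ∀ e : X ≃ₜ X, e '' Y = Y → e x ∈ connectedComponentIn Yᶜ x → e p = p := by
  obtain ⟨p, hp, hpc⟩ := closure_comp_meets hY hne hx
  set W := connectedComponentIn Yᶜ x with hW
  have huniq : ∀ q ∈ Y, q ∈ closure W → q = p := by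
    intro q hq hqc
    by_contra hqp
    obtain ⟨U, V, hU, hV, hqU, hpV, hUV⟩ := t2_separation hqp
    have hA : IsOpen (connectedComponentIn U q) := hU.connectedComponentIn
    have hB : IsOpen (connectedComponentIn V p) := hV.connectedComponentIn
    have hqA : q ∈ connectedComponentIn U q := mem_connectedComponentIn hqU
    have hpB : p ∈ connectedComponentIn V p := mem_connectedComponentIn hpV
    obtain ⟨w, hw1, hw2⟩ := mem_closure_iff.1 hqc _ hA hqA
    obtain ⟨v, hv1, hv2⟩ := mem_closure_iff.1 hpc _ hB hpB
    have hWc : IsPreconnected W := isPreconnected_connectedComponentIn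
    have h1 : IsPreconnected (connectedComponentIn U q ∪ W) :=
      IsPreconnected.union w hw1 hw2 isPreconnected_connectedComponentIn hWc
    have h2 : IsPreconnected (connectedComponentIn V p ∪ (connectedComponentIn U q ∪ W)) :=
      IsPreconnected.union v hv1 (Or.inr hv2) isPreconnected_connectedComponentIn h1
    have h3 := hI.inter hYc h2
    obtain ⟨z, hz, hz1, hz2⟩ := h3 _ _ hA hB (by
      rintro z ⟨hzY, hz | hz | hz⟩
      · exact Or.inr hz
      · exact Or.inl hz
      · exact absurd hzY (connectedComponentIn_subset _ _ hz))
      ⟨q, ⟨hq, Or.inr (Or.inl hqA)⟩, hqA⟩ ⟨p, ⟨hp, Or.inl hpB⟩, hpB⟩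
    exact disjoint_left.1 hUV (connectedComponentIn_subset _ _ hz1)
      (connectedComponentIn_subset _ _ hz2)
  refine ⟨p, hp, fun e heY hex => huniq _ ?_ ?_⟩
  · rw [← heY]; exact mem_image_of_mem e hp
  · have h1 : e '' W ⊆ W := by
      have hWe : IsPreconnected (e '' W) :=
        isPreconnected_connectedComponentIn.image _ e.continuous.continuousOn
      have h2 : e '' W ⊆ connectedComponentIn Yᶜ (e x) := by
        refine hWe.subset_connectedComponentIn (mem_image_of_mem e (mem_connectedComponentIn hx)) ?_
        rintro _ ⟨w, hw, rfl⟩ hwY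
        rw [← heY] at hwY
        obtain ⟨y, hy, hyw⟩ := hwY
        rw [e.injective hyw] at hy
        exact connectedComponentIn_subset _ _ hw hy
      rwa [← connectedComponentIn_eq hex] at h2
    have h2 : e p ∈ e '' closure W := mem_image_of_mem e hpc
    rw [e.image_closure] at h2
    exact closure_mono h1 h2

theorem exists_min_cont (hI : Unic X) (Φ : Set (X ≃ₜ X)) :
    ∃ Y : Set X, IsClosed Y ∧ IsPreconnected Y ∧ Y.Nonempty ∧ (∀ e ∈ Φ, MapsTo e Y Y) ∧
      ∀ Z : Set X, IsClosed Z → IsPreconnected Z → Z.Nonempty → (∀ e ∈ Φ, MapsTo e Z Z) →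
        Z ⊆ Y → Y ⊆ Z := by
  let S : Set (Set X) := {Y | IsClosed Y ∧ IsPreconnected Y ∧ Y.Nonempty ∧ ∀ e ∈ Φ, MapsTo e Y Y}
  obtain ⟨Y, -, hY⟩ := zorn_superset_nonempty S (by
    intro c hcS hc hne
    refine ⟨⋂₀ c, ⟨isClosed_sInter fun F hF => (hcS hF).1, hI c fun F hF => (hcS hF).2.1, ?_, ?_⟩,
      fun s hs => sInter_subset_of_mem hs⟩
    · have : Nonempty c := hne.to_subtype
      rw [sInter_eq_iInter]
      refine IsCompact.nonempty_iInter_of_directed_nonempty_isCompact_isClosed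
        (fun F : c => F.1) ?_ (fun F => (hcS F.2).2.2.1) (fun F => (hcS F.2).1.isCompact)
        (fun F => (hcS F.2).1)
      intro A B
      rcases hc.total A.2 B.2 with h | h
      · exact ⟨A, Subset.rfl, h⟩
      · exact ⟨B, h, Subset.rfl⟩
    · intro e he x hx F hF
      exact (hcS hF).2.2.2 e he (hx F hF)) univ
    ⟨isClosed_univ, isPreconnected_univ, univ_nonempty, fun e _ => mapsTo_univ _ _⟩
  exact ⟨Y, hY.1.1, hY.1.2.1, hY.1.2.2.1, hY.1.2.2.2, fun Z h1 h2 h3 h4 h5 => hY.2 ⟨h1, h2, h3, h4⟩ h5⟩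

theorem fixed_point (hI : Unic X) (h : X ≃ₜ X) : ∃ x, h x = x := by
  by_contra hcon
  push Not at hcon
  obtain ⟨Y, hYcl, hYc, hYne, hYinv, hYmin⟩ := exists_min_cont hI {h}
  have hYh : MapsTo h Y Y := hYinv h rfl
  let W : X → Set X := fun x => connectedComponentIn {x}ᶜ (h x)
  have hWself : ∀ x, h x ∈ W x := fun x => mem_connectedComponentIn (by simpa using hcon x)
  have hWc : ∀ x, IsPreconnected (W x) := fun x => isPreconnected_connectedComponentIn
  have hWx : ∀ x, x ∉ W x := fun x hx => connectedComponentIn_subset _ _ hx rfl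
  have hWsub : ∀ x (C : Set X), IsPreconnected C → x ∉ C → (C ∩ W x).Nonempty → C ⊆ W x := by
    rintro x C hC hxC ⟨y, hyC, hyW⟩
    have := hC.subset_connectedComponentIn hyC (F := {x}ᶜ) fun z hz hzx => hxC (hzx ▸ hz)
    rwa [← connectedComponentIn_eq hyW] at this
  have hB : ∀ x ∈ Y, h.symm x ∈ W x := by
    intro x hx
    by_contra hns
    have hV : h '' (insert x (W x)) ⊆ W x := by
      refine hWsub x _ ((insert_comp_preconn x (h x)).image _ h.continuous.continuousOn) ?_
        ⟨h x, mem_image_of_mem h (mem_insert _ _), hWself x⟩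
      rintro ⟨y, hy | hy, hyx⟩
      · rw [hy] at hyx; exact hcon x hyx
      · have e : h.symm x = y := by rw [← hyx, h.symm_apply_apply]
        apply hns
        rw [e]; exact hy
    have hcl : closure (W x) ⊆ insert x (W x) := by
      intro z hz
      rcases closure_comp_subset isClosed_singleton _ hz with h1 | h1
      · exact Or.inr h1
      · exact Or.inl h1
    have h1 : Y ⊆ Y ∩ closure (W x) := by
      refine hYmin _ (hYcl.inter isClosed_closure) (hI.inter hYc (hWc x).closure)
        ⟨h x, hYh hx, subset_closure (hWself x)⟩ ?_ inter_subset_left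
      rintro e rfl z ⟨hz1, hz2⟩
      exact ⟨hYh hz1, subset_closure (hV (mem_image_of_mem _ (hcl hz2)))⟩
    have h2 : Y ⊆ h '' Y := by
      refine hYmin _ (h.isClosedMap _ hYcl) (hYc.image _ h.continuous.continuousOn)
        (hYne.image _) ?_ hYh.image_subset
      rintro e rfl _ ⟨z, hz, rfl⟩
      exact mem_image_of_mem _ (hYh hz)
    obtain ⟨y, hy, hyx⟩ := h2 hx
    apply hWx x
    have := hV (mem_image_of_mem h (hcl (h1 hy).2))
    rwa [hyx] at this
  have hC : ∀ x ∈ Y, ∀ p, p ∈ W x ∨ h p ∈ W x := by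
    intro x hx p
    by_contra hpp
    push Not at hpp
    have hD := insert_comp_preconn x (h p)
    have hpD : h p ∈ insert x (connectedComponentIn {x}ᶜ (h p)) := by
      by_cases hpx : h p = x
      · exact Or.inl hpx
      · exact Or.inr (mem_connectedComponentIn (by simpa using hpx))
    have hpre : IsPreconnected (h.symm '' (insert x (connectedComponentIn {x}ᶜ (h p)))) :=
      hD.image _ h.symm.continuous.continuousOn
    have hxin : x ∈ h.symm '' (insert x (connectedComponentIn {x}ᶜ (h p))) := by
      by_contra hxn
      have := hWsub x _ hpre hxn ⟨h.symm x, mem_image_of_mem _ (mem_insert _ _), hB x hx⟩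
      apply hpp.1
      exact this ⟨h p, hpD, h.symm_apply_apply p⟩
    obtain ⟨y, hy, hyx⟩ := hxin
    have hyx' : y = h x := by rw [← hyx, h.apply_symm_apply]
    rw [hyx'] at hy
    rcases hy with hy | hy
    · exact hcon x hy
    · apply hpp.2
      change h p ∈ connectedComponentIn {x}ᶜ (h x)
      rw [← connectedComponentIn_eq hy]
      refine mem_connectedComponentIn ?_
      by_contra hpx
      rw [connectedComponentIn_eq_empty hpx] at hy
      exact hy
  have hO : ∀ z, IsOpen {x | z ∈ W x} := by
    intro z
    rw [isOpen_iff_mem_nhds]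
    intro x hx
    obtain ⟨K, hKc, hKp, hKW, hKz, hKx⟩ := joined_compact
      (isOpen_compl_singleton.connectedComponentIn) (hWc x) hx (hWself x)
    obtain ⟨N, hNo, hNp, hNx, hxN⟩ := small_conn (h x) (hcon x)
    have e1 : ∀ᶠ x' in 𝓝 x, x' ∉ closure N := isClosed_closure.isOpen_compl.mem_nhds hxN
    have e2 : ∀ᶠ x' in 𝓝 x, x' ∉ K :=
      hKc.isClosed.isOpen_compl.mem_nhds fun hxK => hWx x (hKW hxK)
    have e3 : ∀ᶠ x' in 𝓝 x, h x' ∈ N := h.continuous.continuousAt (hNo.mem_nhds hNx)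
    filter_upwards [e1, e2, e3] with x' h1 h2 h3
    refine hWsub x' (K ∪ N) (IsPreconnected.union (h x) hKx hNx hKp hNp) ?_
      ⟨h x', Or.inr h3, hWself x'⟩ (Or.inl hKz)
    rintro (h4 | h4)
    · exact h2 h4
    · exact h1 (subset_closure h4)
  obtain ⟨p, hp⟩ := hYne
  let T : Set X := ⋂₀ {C | IsPreconnected C ∧ p ∈ C ∧ h p ∈ C}
  have hT : IsPreconnected T := hI _ fun C hC => hC.1
  have hTY : T ⊆ Y := sInter_subset_of_mem ⟨hYc, hp, hYh hp⟩
  have hpT : p ∈ T := fun C hC => hC.2.1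
  have hqT : h p ∈ T := fun C hC => hC.2.2
  obtain ⟨x, hxT, hx1, hx2⟩ := hT _ _ (hO p) (hO (h p)) (fun x hx => hC x (hTY hx) p)
    ⟨h p, hqT, by
      have := hB (h p) (hYh hp)
      rwa [h.symm_apply_apply] at this⟩ ⟨p, hpT, hWself p⟩
  exact hWx x (hxT (W x) ⟨hWc x, hx1, hx2⟩)

theorem exists_end (Y : Set X) (hY : IsClosed Y) (hYn : Y.Nontrivial) :
    ∃ e ∈ Y, ∀ F ⊆ Y, IsClosed F → e ∉ F →
      ∃ C : Set X, IsClosed C ∧ IsPreconnected C ∧ F ⊆ C ∧ e ∉ C := by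
  obtain ⟨a, ha, b, hb, hab⟩ := hYn
  let r : Y → Y → Prop := fun y z => (z : X) ∉ connectedComponentIn {(y : X)}ᶜ a
  have htrans : ∀ {x y z : Y}, r x y → r y z → r x z := by
    intro x y z hxy hyz hz
    apply hyz
    have hane : a ∈ ({(x : X)}ᶜ : Set X) := by
      by_contra hax
      rw [connectedComponentIn_eq_empty hax] at hz
      exact hz
    refine isPreconnected_connectedComponentIn.subset_connectedComponentIn
      (mem_connectedComponentIn hane) ?_ hz
    intro w hw hwy
    rw [mem_singleton_iff] at hwy
    exact hxy (hwy ▸ hw)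
  have hrefl : ∀ y, r y y := fun y hy => connectedComponentIn_subset _ _ hy rfl
  obtain ⟨⟨e, heY⟩, he⟩ := exists_maximal_of_chains_bounded (r := r) (by
    intro c hc
    rcases c.eq_empty_or_nonempty with rfl | hne
    · exact ⟨⟨a, ha⟩, fun _ h => absurd h (notMem_empty _)⟩
    have : Nonempty c := hne.to_subtype
    have hcl : ∀ y : c, IsClosed (Y ∩ (connectedComponentIn {((y : Y) : X)}ᶜ a)ᶜ) := fun y =>
      hY.inter (isOpen_compl_singleton.connectedComponentIn).isClosed_compl
    obtain ⟨z, hz⟩ := IsCompact.nonempty_iInter_of_directed_nonempty_isCompact_isClosed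
      (fun y : c => Y ∩ (connectedComponentIn {((y : Y) : X)}ᶜ a)ᶜ) (by
        intro y y'
        have key : ∀ y y' : c, r y y' → Y ∩ (connectedComponentIn {((y' : Y) : X)}ᶜ a)ᶜ ⊆
            Y ∩ (connectedComponentIn {((y : Y) : X)}ᶜ a)ᶜ := by
          rintro y y' hr w ⟨hw1, hw2⟩
          exact ⟨hw1, htrans (z := ⟨w, hw1⟩) hr hw2⟩
        by_cases hyy : (y : Y) = y'
        · have : y = y' := Subtype.ext hyy
          exact ⟨y, Subset.rfl, by rw [this]⟩
        · rcases hc y.2 y'.2 hyy with h | h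
          · exact ⟨y', key _ _ h, Subset.rfl⟩
          · exact ⟨y, Subset.rfl, key _ _ h⟩)
      (fun y => ⟨y.1, y.1.2, hrefl y.1⟩) (fun y => (hcl y).isCompact) hcl
    rw [mem_iInter] at hz
    obtain ⟨y₀, hy₀⟩ := hne
    exact ⟨⟨z, (hz ⟨y₀, hy₀⟩).1⟩, fun y hy => (hz ⟨y, hy⟩).2⟩) htrans
  have hea : e ≠ a := by
    rintro rfl
    refine he ⟨b, hb⟩ ?_ ?_
    · intro h
      rw [connectedComponentIn_eq_empty (by simp)] at h
      exact h
    · exact mem_connectedComponentIn (by simpa using hab)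
  have hmem : ∀ z ∈ Y, z ≠ e → z ∈ connectedComponentIn {e}ᶜ a := by
    intro z hz hze
    by_contra hzn
    refine he ⟨z, hz⟩ hzn ?_
    refine (insert_comp_preconn e a).subset_connectedComponentIn
      (Or.inr (mem_connectedComponentIn (by simpa using hea.symm))) ?_ (mem_insert _ _)
    rintro w (hw | hw) hwz
    · have hwz' : w = z := hwz
      exact hze (hwz'.symm.trans hw)
    · have hwz' : w = z := hwz
      subst hwz'
      exact hzn hw
  refine ⟨e, heY, fun F hFY hF heF => ?_⟩
  have hloc : ∀ f : X, f ∈ F → ∃ N C : Set X, N ∈ 𝓝 f ∧ N ⊆ C ∧ IsClosed C ∧ IsPreconnected C ∧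
      a ∈ C ∧ e ∉ C := by
    intro f hf
    have hfe : f ≠ e := fun h => heF (h ▸ hf)
    obtain ⟨N, hNo, hNp, hNf, heN⟩ := small_conn f hfe
    obtain ⟨K, hKc, hKp, hKW, hKa, hKf⟩ := joined_compact (x := a) (y := f)
      (isOpen_compl_singleton (x := e).connectedComponentIn) isPreconnected_connectedComponentIn
      (mem_connectedComponentIn (by simpa using hea.symm)) (hmem f (hFY hf) hfe)
    refine ⟨N, K ∪ closure N, hNo.mem_nhds hNf, subset_closure.trans subset_union_right,
      hKc.isClosed.union isClosed_closure,
      IsPreconnected.union f hKf (subset_closure hNf) hKp hNp.closure, Or.inl hKa, ?_⟩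
    rintro (h | h)
    · exact connectedComponentIn_subset _ _ (hKW h) rfl
    · exact heN h
  choose! N C hN hNC hCc hCp hCa hCe using hloc
  obtain ⟨t, htF, ht⟩ := hF.isCompact.elim_nhds_subcover N hN
  refine ⟨⋃ f ∈ t, C f, ?_, ?_, ?_, ?_⟩
  · exact t.finite_toSet.isClosed_biUnion fun f hf => hCc f (htF f hf)
  · have hU : (⋃ f ∈ t, C f) = ⋃₀ (C '' (t : Set X)) := by simp [sUnion_image]
    rw [hU]
    refine isPreconnected_sUnion a _ ?_ ?_
    · rintro _ ⟨f, hf, rfl⟩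
      exact hCa f (htF f hf)
    · rintro _ ⟨f, hf, rfl⟩
      exact hCp f (htF f hf)
  · refine ht.trans ?_
    exact iUnion₂_mono fun f hf => hNC f (htF f hf)
  · intro h
    obtain ⟨f, hf, hef⟩ := mem_iUnion₂.1 h
    exact hCe f (htF f hf) hef

/-- The action-free core: a set of homeomorphisms closed under inverses and a homeomorphism set
commuting with it. -/
theorem core (hI : Unic X) (Φ Ψ : Set (X ≃ₜ X)) (hΦ : ∀ e ∈ Φ, e.symm ∈ Φ)
    (hΨ : ∀ e ∈ Ψ, e.symm ∈ Ψ) (hcomm : ∀ g ∈ Φ, ∀ h ∈ Ψ, ∀ x, g (h x) = h (g x)) :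
    (∃ x, ∀ g ∈ Φ, g x = x) ∨ (∃ x, ∀ h ∈ Ψ, h x = x) := by
  by_contra hcon
  push Not at hcon
  obtain ⟨hΦfix, hΨfix⟩ := hcon
  obtain ⟨Y, hYcl, hYc, hYne, hYinv, hYmin⟩ := exists_min_cont hI Φ
  have himage : ∀ (Z : Set X), (∀ e ∈ Φ, MapsTo e Z Z) → ∀ e ∈ Φ, e '' Z = Z := by
    intro Z hZ e he
    refine Subset.antisymm (hZ e he).image_subset fun z hz => ?_
    exact ⟨e.symm z, hZ _ (hΦ e he) hz, e.apply_symm_apply z⟩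
  have hYn : Y.Nontrivial := by
    by_contra hn
    rw [not_nontrivial_iff] at hn
    obtain ⟨y, hy⟩ := hYne
    obtain ⟨g, hg, hgy⟩ := hΦfix y
    exact hgy (hn (hYinv g hg hy) hy)
  obtain ⟨e, heY, he⟩ := exists_end Y hYcl hYn
  obtain ⟨h, hh, hhe⟩ := hΨfix e
  have hsub : ∀ k ∈ Ψ, Y ⊆ k '' Y := by
    intro k hk
    have hZinv : ∀ g ∈ Φ, MapsTo g (k '' Y) (k '' Y) := by
      rintro g hg _ ⟨y, hy, rfl⟩
      rw [hcomm g hg k hk]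
      exact mem_image_of_mem _ (hYinv g hg hy)
    have hZcl : IsClosed (k '' Y) := k.isClosedMap _ hYcl
    have hZc : IsPreconnected (k '' Y) := hYc.image _ k.continuous.continuousOn
    by_cases hdis : (Y ∩ k '' Y).Nonempty
    · refine (hYmin _ (hYcl.inter hZcl) (hI.inter hYc hZc) hdis ?_ inter_subset_left).trans
        inter_subset_right
      rintro g hg z ⟨h1, h2⟩
      exact ⟨hYinv g hg h1, hZinv g hg h2⟩
    · exfalso
      rw [not_nonempty_iff_eq_empty] at hdis
      obtain ⟨y, hy⟩ := hYne
      have hdis' : k '' Y ⊆ Yᶜ := fun z hz hzY => by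
        have : z ∈ Y ∩ k '' Y := ⟨hzY, hz⟩
        rw [hdis] at this; exact this
      have hky : k y ∈ k '' Y := mem_image_of_mem k hy
      obtain ⟨p, hpY, hp⟩ := gate hI hYcl hYc ⟨y, hy⟩ (hdis' hky)
      obtain ⟨g, hg, hgp⟩ := hΦfix p
      exact hgp (hp g (himage Y hYinv g hg)
        (hZc.subset_connectedComponentIn hky hdis' (hZinv g hg hky)))
  have hhY : h '' Y = Y := by
    refine Subset.antisymm ?_ (hsub h hh)
    rintro _ ⟨y, hy, rfl⟩
    obtain ⟨z, hz, hzy⟩ := hsub h.symm (hΨ h hh) hy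
    rw [← hzy, h.apply_symm_apply]
    exact hz
  let F : Set X := Y ∩ {y | h y = y}
  have hFcl : IsClosed F := hYcl.inter (isClosed_eq h.continuous continuous_id)
  have hFinv : ∀ g ∈ Φ, MapsTo g F F := by
    rintro g hg y ⟨hy1, hy2⟩
    refine ⟨hYinv g hg hy1, ?_⟩
    change h (g y) = g y
    rw [← hcomm g hg h hh, show h y = y from hy2]
  have hFne : F.Nonempty := by
    obtain ⟨x, hx⟩ := fixed_point hI h
    by_cases hxY : x ∈ Y
    · exact ⟨x, hxY, hx⟩
    · obtain ⟨p, hpY, hp⟩ := gate hI hYcl hYc hYne hxY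
      exact ⟨p, hpY, hp h hhY (by rw [hx]; exact mem_connectedComponentIn hxY)⟩
  obtain ⟨C, hCcl, hCc, hFC, heC⟩ := he F inter_subset_left hFcl fun h => hhe h.2
  let H : Set X := ⋂₀ {D | IsClosed D ∧ IsPreconnected D ∧ F ⊆ D}
  have hYH : Y ⊆ Y ∩ H := by
    refine hYmin _ (hYcl.inter (isClosed_sInter fun D hD => hD.1))
      (hI.inter hYc (hI _ fun D hD => hD.2.1)) ?_ ?_ inter_subset_left
    · obtain ⟨f, hf⟩ := hFne
      exact ⟨f, hf.1, fun D hD => hD.2.2 hf⟩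
    · rintro g hg z ⟨hz1, hz2⟩
      refine ⟨hYinv g hg hz1, fun D hD => ?_⟩
      have : z ∈ g.symm '' D := by
        refine hz2 _ ⟨g.symm.isClosedMap _ hD.1,
          hD.2.1.image _ g.symm.continuous.continuousOn, fun f hf => ?_⟩
        exact ⟨g f, hD.2.2 (hFinv g hg hf), g.symm_apply_apply f⟩
      obtain ⟨d, hd, hdz⟩ := this
      rw [← hdz, g.apply_symm_apply]
      exact hd
  exact heC ((hYH heY).2 C ⟨hCcl, hCc, hFC⟩)

end

end DendAux


/-- When a direct product of two groups acts by homeomorphisms on a dendrite,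
at least one of the factors acts elementarily: it fixes a point or preserves a
set of exactly two points. -/
theorem factor_acts_elementarily (G₁ G₂ X : Type*) [Group G₁] [Group G₂]
    [TopologicalSpace X] [MulAction (G₁ × G₂) X]
    (hcont : ∀ g : G₁ × G₂, Continuous fun x : X => g • x)
    (hX : IsDendrite X) :
    ((∃ x : X, ∀ g : G₁, ((g, (1 : G₂)) : G₁ × G₂) • x = x) ∨
      (∃ P : Set X, P.ncard = 2 ∧ ∀ g : G₁, (((g, (1 : G₂)) : G₁ × G₂) • ·) '' P = P)) ∨
    ((∃ x : X, ∀ g : G₂, (((1 : G₁), g) : G₁ × G₂) • x = x) ∨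
      (∃ P : Set X, P.ncard = 2 ∧ ∀ g : G₂, ((((1 : G₁), g) : G₁ × G₂) • ·) '' P = P)) := by
  obtain ⟨hne, hcomp, hconn, hmet, hloc, hcirc⟩ := hX
  letI : MetricSpace X := TopologicalSpace.metrizableSpaceMetric X
  have hI := DendAux.unic_of_no_circle hcirc
  let E : G₁ × G₂ → (X ≃ₜ X) := fun g =>
    { toFun := fun x => g • x
      invFun := fun x => g⁻¹ • x
      left_inv := fun x => inv_smul_smul g x
      right_inv := fun x => smul_inv_smul g x
      continuous_toFun := hcont g
      continuous_invFun := hcont g⁻¹ }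
  have hE : ∀ g, (E g).symm = E g⁻¹ := fun g => Homeomorph.ext fun x => rfl
  rcases DendAux.core hI (range fun g : G₁ => E (g, 1)) (range fun g : G₂ => E (1, g))
    (by
      rintro _ ⟨g, rfl⟩
      refine ⟨g⁻¹, ?_⟩
      simp only [hE, Prod.inv_mk, inv_one])
    (by
      rintro _ ⟨g, rfl⟩
      refine ⟨g⁻¹, ?_⟩
      simp only [hE, Prod.inv_mk, inv_one])
    (by
      rintro _ ⟨g, rfl⟩ _ ⟨h, rfl⟩ x
      change ((g, (1 : G₂)) : G₁ × G₂) • (((1 : G₁), h) : G₁ × G₂) • x =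
        (((1 : G₁), h) : G₁ × G₂) • ((g, (1 : G₂)) : G₁ × G₂) • x
      rw [smul_smul, smul_smul]
      simp) with ⟨x, hx⟩ | ⟨x, hx⟩
  · exact Or.inl (Or.inl ⟨x, fun g => hx _ ⟨g, rfl⟩⟩)
  · exact Or.inr (Or.inl ⟨x, fun g => hx _ ⟨g, rfl⟩⟩)
end

section
/- Let G be a group acting by homeomorphisms on a dendrite X. Then either G contains a non-abelian free subgroup, or the action is elementary (G fixes a point or preserves a two-point set). -/
open Set

theorem pingpong_aux {G : Type*} [Group G] {α : Type*} [MulAction G α]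
    (U1 U2 U3 : Set α) (h12 : Disjoint U1 U2) (h13 : Disjoint U1 U3) (h23 : Disjoint U2 U3)
    (hn2 : U2.Nonempty) 
    (g1 g2 g3 : G) (hg1 : ∀ x, x ∉ U1 → g1 • x ∈ U1) (hg2 : ∀ x, x ∉ U2 → g2 • x ∈ U2)
    (hg3 : ∀ x, x ∉ U3 → g3 • x ∈ U3) :
    ∃ f : FreeGroup (Fin 2) →* G, Function.Injective f := by
  classical
  rw [Set.disjoint_left] at h12 h13 h23
  -- contraction of translates
  have key : ∀ (A B : Set α) (a b : G), (∀ x ∈ A, x ∉ B) → (∀ x, x ∉ A → a • x ∈ A) →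
      (∀ x, x ∉ B → b • x ∈ B) → (∀ x, x ∉ A → (b * a) • x ∈ B) ∧
        (∀ x, x ∉ B → (b * a)⁻¹ • x ∈ A) := by
    intro A B a b hAB ha hb
    have h1 : ∀ x, x ∉ A → (b * a) • x ∈ B := by
      intro x hx
      rw [mul_smul]
      exact hb _ (hAB _ (ha _ hx))
    refine ⟨h1, fun x hx => ?_⟩
    by_contra hc
    have := h1 _ hc
    rw [smul_inv_smul] at this
    exact hx this
  let V2 : Set α := {x | g1⁻¹ • x ∈ U2}
  let V3 : Set α := {x | g1⁻¹ • x ∈ U3}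
  have hV2 : ∀ x ∈ V2, x ∈ U1 := by
    intro x hx
    have := hg1 (g1⁻¹ • x) (fun h => h12 h hx)
    rwa [smul_inv_smul] at this
  have hV3 : ∀ x ∈ V3, x ∈ U1 := by
    intro x hx
    have := hg1 (g1⁻¹ • x) (fun h => h13 h hx)
    rwa [smul_inv_smul] at this
  have c2 : ∀ x, x ∉ V2 → (g1 * g2 * g1⁻¹) • x ∈ V2 := by
    intro x hx
    change g1⁻¹ • _ ∈ U2
    rw [mul_smul, mul_smul, inv_smul_smul]
    exact hg2 _ hx
  have c3 : ∀ x, x ∉ V3 → (g1 * g3 * g1⁻¹) • x ∈ V3 := by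
    intro x hx
    change g1⁻¹ • _ ∈ U3
    rw [mul_smul, mul_smul, inv_smul_smul]
    exact hg3 _ hx
  obtain ⟨p1, p2⟩ := key U2 U3 g2 g3 (fun x hx h => h23 hx h) hg2 hg3
  obtain ⟨q1, q2⟩ := key V2 V3 _ _ (fun x hx h => h23 hx h) c2 c3
  set a := g3 * g2
  set b := g1 * g3 * g1⁻¹ * (g1 * g2 * g1⁻¹)
  have hn3 : U3.Nonempty := by
    obtain ⟨x, hx⟩ := hn2
    exact ⟨_, hg3 x (fun h => h23 hx h)⟩
  have hnV3 : V3.Nonempty := by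
    obtain ⟨x, hx⟩ := hn3
    exact ⟨g1 • x, by change g1⁻¹ • _ ∈ U3; rwa [inv_smul_smul]⟩
  let A : ULift (Fin 2) → G := fun i => if i.down = 0 then a else b
  let XX : ULift (Fin 2) → Set α := fun i => if i.down = 0 then U3 else V3
  let YY : ULift (Fin 2) → Set α := fun i => if i.down = 0 then U2 else V2
  have hinj : Function.Injective (FreeGroup.lift A) := by
    apply FreeGroup.injective_lift_of_ping_pong A XX YY
    · rintro ⟨i⟩
      fin_cases i <;> simp [XX, hn3, hnV3]
    · rintro ⟨i⟩ ⟨j⟩ hij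
      fin_cases i <;> fin_cases j <;> simp [XX, Function.onFun, Set.disjoint_left] at hij ⊢
      · intro x hx h; exact h13 (hV3 x h) hx
      · intro x hx h; exact h13 (hV3 x hx) h
    · rintro ⟨i⟩ ⟨j⟩ hij
      fin_cases i <;> fin_cases j <;> simp [YY, Function.onFun, Set.disjoint_left] at hij ⊢
      · intro x hx h; exact h12 (hV2 x h) hx
      · intro x hx h; exact h12 (hV2 x hx) h
    · rintro ⟨i⟩ ⟨j⟩
      fin_cases i <;> fin_cases j <;> simp [XX, YY, Set.disjoint_left]
      · intro x hx h; exact h23 h hx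
      · intro x hx h; exact h13 (hV2 x h) hx
      · intro x hx h; exact h12 (hV3 x hx) h
      · intro x hx h; exact h23 h hx
    · rintro ⟨i⟩
      fin_cases i
      · rintro _ ⟨x, hx, rfl⟩
        exact p1 x (by simpa [YY] using hx)
      · rintro _ ⟨x, hx, rfl⟩
        exact q1 x (by simpa [YY] using hx)
    · rintro ⟨i⟩
      fin_cases i
      · rintro _ ⟨x, hx, rfl⟩
        exact p2 x (by simpa [XX] using hx)
      · rintro _ ⟨x, hx, rfl⟩
        exact q2 x (by simpa [XX] using hx)
  refine ⟨(FreeGroup.lift A).comp (FreeGroup.freeGroupCongr Equiv.ulift.symm).toMonoidHom, ?_⟩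
  exact hinj.comp (MulEquiv.injective _)

set_option linter.unusedSectionVars false

/-- Abstract system of arcs: `J x y` is the smallest connected set containing `x` and `y`. -/
structure ArcSys (X : Type*) [TopologicalSpace X] where
  J : X → X → Set X
  conn : ∀ x y, IsPreconnected (J x y)
  closed : ∀ x y, IsClosed (J x y)
  left : ∀ x y, x ∈ J x y
  right : ∀ x y, y ∈ J x y
  min : ∀ x y (C : Set X), IsPreconnected C → x ∈ C → y ∈ C → J x y ⊆ C
  anti : ∀ x y p, p ∈ J x y → p ≠ y → y ∉ J x p

namespace ArcSys

variable {X : Type*} [TopologicalSpace X]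

theorem sInter_conn (A : ArcSys X) (S : Set (Set X)) (hS : ∀ s ∈ S, IsPreconnected s) :
    IsPreconnected (⋂₀ S) := by
  apply isPreconnected_of_forall_pair
  intro x hx y hy
  exact ⟨A.J x y, fun z hz s hs => A.min x y s (hS s hs) (hx s hs) (hy s hs) hz,
    A.left x y, A.right x y, A.conn x y⟩

theorem inter_conn (A : ArcSys X) {s t : Set X} (hs : IsPreconnected s) (ht : IsPreconnected t) :
    IsPreconnected (s ∩ t) := by
  have := A.sInter_conn {s, t} (by rintro u (rfl | rfl) <;> assumption)
  rwa [sInter_pair] at this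

theorem helly3 (A : ArcSys X) {a b c : Set X} (ha : IsPreconnected a) (hb : IsPreconnected b)
    (hc : IsPreconnected c) (hb' : IsClosed b) (hc' : IsClosed c)
    (hab : (a ∩ b).Nonempty) (hac : (a ∩ c).Nonempty) (hbc : (b ∩ c).Nonempty) :
    (a ∩ (b ∩ c)).Nonempty := by
  have h1 : IsPreconnected (b ∪ c) := by
    obtain ⟨x, hx1, hx2⟩ := hbc
    exact IsPreconnected.union x hx1 hx2 hb hc
  have h2 := A.inter_conn ha h1
  rw [isPreconnected_closed_iff] at h2
  have := h2 b c hb' hc' (fun x hx => hx.2) 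
    (by obtain ⟨x, hx1, hx2⟩ := hab; exact ⟨x, ⟨hx1, Or.inl hx2⟩, hx2⟩)
    (by obtain ⟨x, hx1, hx2⟩ := hac; exact ⟨x, ⟨hx1, Or.inr hx2⟩, hx2⟩)
  obtain ⟨x, hx1, hx2⟩ := this
  exact ⟨x, hx1.1, hx2⟩

theorem helly_fin [Nonempty X] (A : ArcSys X) {ι : Type*} (s : Finset ι) :
    ∀ (K : ι → Set X), (∀ i, IsClosed (K i)) → (∀ i, IsPreconnected (K i)) →
    (∀ i j, (K i ∩ K j).Nonempty) → (⋂ i ∈ s, K i).Nonempty := by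
  classical
  induction s using Finset.induction_on with
  | empty => intro K _ _ _; simp
  | insert a s _ ih =>
    intro K hcl hcon hne
    by_cases hs : s.Nonempty
    · have := ih (fun i => K i ∩ K a) (fun i => (hcl i).inter (hcl a))
        (fun i => A.inter_conn (hcon i) (hcon a)) (fun i j => by
          obtain ⟨x, h1, h2, h3⟩ :=
            A.helly3 (hcon i) (hcon j) (hcon a) (hcl j) (hcl a) (hne i j) (hne i a) (hne j a)
          exact ⟨x, ⟨h1, h3⟩, h2, h3⟩)
      obtain ⟨x, hx⟩ := this
      simp only [mem_iInter] at hx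
      obtain ⟨i, hi⟩ := hs
      refine ⟨x, ?_⟩
      simp only [mem_iInter, Finset.mem_insert]
      rintro j (rfl | hj)
      · exact (hx i hi).2
      · exact (hx j hj).1
    · rw [Finset.not_nonempty_iff_eq_empty] at hs
      subst hs
      obtain ⟨x, hx, _⟩ := hne a a
      exact ⟨x, by simpa using hx⟩

theorem mem_J_iff (A : ArcSys X) (a x y : X) :
    x ∈ A.J a y ↔ y ∉ connectedComponentIn {x}ᶜ a := by
  constructor
  · intro h hy
    have ha : a ∈ ({x}ᶜ : Set X) := by
      by_contra hc
      rw [connectedComponentIn_eq_empty hc] at hy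
      exact hy
    have := A.min a y _ isPreconnected_connectedComponentIn (mem_connectedComponentIn ha) hy h
    exact connectedComponentIn_subset _ _ this rfl
  · intro h
    by_contra hc
    have hsub : A.J a y ⊆ ({x}ᶜ : Set X) := by
      intro z hz hzx
      rw [mem_singleton_iff] at hzx
      exact hc (hzx ▸ hz)
    exact h ((A.conn a y).subset_connectedComponentIn (A.left a y) hsub (A.right a y))

variable [CompactSpace X] [T2Space X] [ConnectedSpace X] [LocallyConnectedSpace X]

theorem helly [Nonempty X] (A : ArcSys X) {ι : Type*}
    (K : ι → Set X) (hcl : ∀ i, IsClosed (K i)) (hcon : ∀ i, IsPreconnected (K i))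
    (hne : ∀ i j, (K i ∩ K j).Nonempty) : (⋂ i, K i).Nonempty := by
  have := isCompact_univ.inter_iInter_nonempty (X := X) K hcl (fun u => by
    rw [univ_inter]; exact A.helly_fin u K hcl hcon hne)
  rwa [univ_inter] at this

theorem isClosed_above (A : ArcSys X) (a x : X) : IsClosed {y | x ∈ A.J a y} := by
  have : {y | x ∈ A.J a y} = (connectedComponentIn {x}ᶜ a)ᶜ := by
    ext y; simp [A.mem_J_iff]
  rw [this, isClosed_compl_iff]
  exact isOpen_compl_singleton.connectedComponentIn

/-- the complement of a component of the complement of a point is connected -/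
theorem compl_comp_conn (a m : X) : IsPreconnected (connectedComponentIn ({m}ᶜ : Set X) a)ᶜ := by
  apply isPreconnected_of_forall m
  intro y hy
  by_cases hym : y = m
  · subst hym
    exact ⟨{y}, by simpa using hy, rfl, rfl, isPreconnected_singleton⟩
  set W := connectedComponentIn ({m}ᶜ : Set X) y with hW
  have hyW : y ∈ W := mem_connectedComponentIn hym
  have hm : m ∈ closure W := by
    by_contra hc
    have h1 : closure W ⊆ W := by
      apply (isPreconnected_connectedComponentIn.closure).subset_connectedComponentIn
        (subset_closure hyW)
      intro z hz hzm
      rw [mem_singleton_iff] at hzm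
      exact hc (hzm ▸ hz)
    have h2 : IsClopen W := ⟨isClosed_of_closure_subset h1,
      isOpen_compl_singleton.connectedComponentIn⟩
    have h3 := h2.eq_univ ⟨y, hyW⟩
    have h4 : m ∈ W := h3 ▸ mem_univ m
    exact connectedComponentIn_subset _ _ h4 rfl
  refine ⟨insert m W, ?_, mem_insert _ _, mem_insert_of_mem _ hyW, ?_⟩
  · rintro z (rfl | hz)
    · exact fun h => connectedComponentIn_subset _ _ h rfl
    · intro h
      apply hy
      rw [connectedComponentIn_eq h, ← connectedComponentIn_eq hz]
      exact hyW
  · exact isPreconnected_connectedComponentIn.subset_closure (subset_insert _ _)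
      (insert_subset hm subset_closure)

/-- End points relative to a closed connected set. -/
def Ends (A : ArcSys X) (Y : Set X) : Set X :=
  {e | e ∈ Y ∧ ∀ x ∈ Y, ∀ y ∈ Y, e ∈ A.J x y → e = x ∨ e = y}

theorem J_trans (A : ArcSys X) {a x y : X} (h : x ∈ A.J a y) : A.J a x ⊆ A.J a y :=
  A.min _ _ _ (A.conn a y) (A.left a y) h

theorem exists_end (A : ArcSys X) {Y : Set X} (hY : IsClosed Y) {a b : X} 
    (ha : a ∈ Y) (hb : b ∈ Y) (hab : a ≠ b) : ∃ e ∈ A.Ends Y, e ≠ a := by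
  let P : Type _ := {y : X // y ∈ Y ∧ b ∈ A.J a y}
  let r : P → P → Prop := fun x y => x.1 ∈ A.J a y.1
  have : Nonempty P := ⟨⟨b, hb, A.right a b⟩⟩
  have rtrans : ∀ {x y z : P}, r x y → r y z → r x z := fun {x y z} hxy hyz =>
    A.J_trans hyz hxy
  obtain ⟨⟨e, heY, hbe⟩, he⟩ := exists_maximal_of_nonempty_chains_bounded (r := r) (by
    intro c hc hcne
    have : Nonempty c := hcne.to_subtype
    have := IsCompact.nonempty_iInter_of_directed_nonempty_isCompact_isClosed
      (fun x : c => Y ∩ {y | x.1.1 ∈ A.J a y}) (by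
        intro x y
        rcases eq_or_ne x y with rfl | hne
        · exact ⟨x, subset_rfl, subset_rfl⟩
        rcases hc x.2 y.2 (fun h => hne (Subtype.ext h)) with h | h
        · exact ⟨y, fun z hz => ⟨hz.1, A.J_trans hz.2 h⟩, subset_rfl⟩
        · exact ⟨x, subset_rfl, fun z hz => ⟨hz.1, A.J_trans hz.2 h⟩⟩)
      (fun x => ⟨x.1.1, x.1.2.1, A.right _ _⟩)
      (fun x => (hY.inter (A.isClosed_above a _)).isCompact)
      (fun x => hY.inter (A.isClosed_above a _))
    obtain ⟨z, hz⟩ := this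
    simp only [mem_iInter] at hz
    obtain ⟨w, hw⟩ := hcne
    refine ⟨⟨z, (hz ⟨w, hw⟩).1, A.J_trans (hz ⟨w, hw⟩).2 w.2.2⟩, fun x hx => (hz ⟨x, hx⟩).2⟩)
    rtrans
  have hJaa : A.J a a ⊆ {a} := A.min a a _ isPreconnected_singleton rfl rfl
  refine ⟨e, ⟨heY, ?_⟩, ?_⟩
  · intro x hx y hy hxy
    have key : ∀ z ∈ Y, e ∈ A.J a z → e = z := by
      intro z hz hez
      have h1 : z ∈ A.J a e := he ⟨z, hz, A.J_trans hez hbe⟩ hez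
      by_contra hne
      exact A.anti a z e hez hne h1
    have hsub : A.J x y ⊆ A.J a x ∪ A.J a y :=
      A.min _ _ _ (IsPreconnected.union a (A.left a x) (A.left a y) (A.conn a x) (A.conn a y))
        (Or.inl (A.right a x)) (Or.inr (A.right a y))
    rcases hsub hxy with h | h
    · exact Or.inl (key x hx h)
    · exact Or.inr (key y hy h)
  · rintro rfl
    exact hab (hJaa hbe).symm

theorem main (A : ArcSys X) {G : Type*} [Group G] [MulAction G X]
    (hcont : ∀ g : G, Continuous fun x : X => g • x) :
    (∃ f : FreeGroup (Fin 2) →* G, Function.Injective f) ∨ ((∃ x : X, ∀ g : G, g • x = x) ∨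
    (∃ P : Set X, P.ncard = 2 ∧ ∀ g : G, (g • ·) '' P = P)) := by
  classical
  let S : Set (Set X) := {Y | IsClosed Y ∧ Y.Nonempty ∧ IsPreconnected Y ∧
    ∀ (g : G), ∀ x ∈ Y, g • x ∈ Y}
  obtain ⟨Y, hYmin⟩ := zorn_superset S (by
    intro c hcS hc
    rcases c.eq_empty_or_nonempty with rfl | hcne
    · exact ⟨univ, ⟨isClosed_univ, univ_nonempty, isPreconnected_univ, fun _ _ _ => mem_univ _⟩,
        by simp⟩
    have : Nonempty c := hcne.to_subtype
    refine ⟨⋂₀ c, ⟨isClosed_sInter fun s hs => (hcS hs).1, ?_,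
      A.sInter_conn _ fun s hs => (hcS hs).2.2.1,
      fun g x hx s hs => (hcS hs).2.2.2 g x (hx s hs)⟩, fun s hs => sInter_subset_of_mem hs⟩
    apply IsCompact.nonempty_sInter_of_directed_nonempty_isCompact_isClosed
    · intro s hs t ht
      rcases hc.total hs ht with h | h
      · exact ⟨s, hs, subset_rfl, h⟩
      · exact ⟨t, ht, h, subset_rfl⟩
    · exact fun s hs => (hcS hs).2.1
    · exact fun s hs => (hcS hs).1.isCompact
    · exact fun s hs => (hcS hs).1)
  obtain ⟨⟨hYcl, hYne, hYcon, hYinv⟩, hmin⟩ := hYmin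
  -- disjoining lemma
  have disj : ∀ K : Set X, IsClosed K → IsPreconnected K → K ⊆ Y → K ≠ Y →
      ∃ g : G, ∀ x ∈ K, g • x ∉ K := by
    intro K hKcl hKcon hKY hKne
    by_contra hcon
    push Not at hcon
    have himg : ∀ g : G, {x | g • x ∈ K} = (fun x : X => g⁻¹ • x) '' K := by
      intro g
      ext x
      constructor
      · intro hx
        exact ⟨g • x, hx, inv_smul_smul g x⟩
      · rintro ⟨y, hy, rfl⟩
        change g • g⁻¹ • y ∈ K
        rwa [smul_inv_smul]
    have hC : ∀ g : G, IsPreconnected {x | g • x ∈ K} := by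
      intro g
      rw [himg]
      exact hKcon.image _ (hcont _).continuousOn
    have hne := A.helly (fun g : G => {x | g • x ∈ K}) (fun g => hKcl.preimage (hcont g)) hC (by
      intro g h
      obtain ⟨x, hx, hx'⟩ := hcon (h * g⁻¹)
      refine ⟨g⁻¹ • x, ?_, ?_⟩
      · change g • g⁻¹ • x ∈ K
        rwa [smul_inv_smul]
      · change h • g⁻¹ • x ∈ K
        rwa [← mul_smul])
    have hsub : (⋂ g : G, {x | g • x ∈ K}) ⊆ K := by
      intro x hx
      have := mem_iInter.1 hx 1
      simpa using this
    have hmem : (⋂ g : G, {x | g • x ∈ K}) ∈ S := by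
      refine ⟨isClosed_iInter fun g => hKcl.preimage (hcont g), hne, ?_, ?_⟩
      · exact A.sInter_conn _ (by rintro _ ⟨g, rfl⟩; exact hC g)
      · intro g x hx
        rw [mem_iInter] at hx ⊢
        intro h
        change h • g • x ∈ K
        rw [← mul_smul]
        exact hx (h * g)
    have := hmin hmem (hsub.trans hKY)
    exact hKne (hKY.antisymm (this.trans hsub))
  by_cases hsing : Y.Subsingleton
  · obtain ⟨x, hx⟩ := hYne
    exact Or.inr (Or.inl ⟨x, fun g => hsing (hYinv g x hx) hx⟩)
  rw [not_subsingleton_iff] at hsing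
  obtain ⟨a, ha, b, hb, hab⟩ := hsing
  obtain ⟨e1, he1, he1a⟩ := A.exists_end hYcl ha hb hab
  obtain ⟨e2, he2, he21⟩ := A.exists_end hYcl he1.1 ha he1a
  have hEinv : ∀ (g : G), ∀ e ∈ A.Ends Y, g • e ∈ A.Ends Y := by
    intro g e he
    refine ⟨hYinv g e he.1, fun x hx y hy hexy => ?_⟩
    have h1 : A.J (g⁻¹ • x) (g⁻¹ • y) ⊆ _ := A.min _ _ _ (A.conn _ _) (A.left _ _) (A.right _ _)
    have h2 : A.J x y ⊆ (fun z : X => g • z) '' A.J (g⁻¹ • x) (g⁻¹ • y) := 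
      A.min _ _ _ ((A.conn _ _).image _ (hcont g).continuousOn)
        ⟨_, A.left _ _, smul_inv_smul g x⟩ ⟨_, A.right _ _, smul_inv_smul g y⟩
    obtain ⟨z, hz, hze⟩ := h2 hexy
    have hze' : z = e := smul_left_cancel g hze
    subst hze'
    rcases he.2 _ (hYinv g⁻¹ x hx) _ (hYinv g⁻¹ y hy) hz with h | h
    · left; rw [h, smul_inv_smul]
    · right; rw [h, smul_inv_smul]
  by_cases h3 : ∃ e3 ∈ A.Ends Y, e3 ≠ e1 ∧ e3 ≠ e2
  · left
    obtain ⟨e3, he3, he31, he32⟩ := h3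
    obtain ⟨m, hm12, hm13, hm23⟩ := A.helly3 (A.conn e1 e2) (A.conn e1 e3) (A.conn e2 e3)
      (A.closed _ _) (A.closed _ _) ⟨e1, A.left _ _, A.left _ _⟩ ⟨e2, A.right _ _, A.left _ _⟩
      ⟨e3, A.right _ _, A.right _ _⟩
    have hmY : m ∈ Y := A.min _ _ _ hYcon he1.1 he2.1 hm12
    have hm1 : e1 ≠ m := by
      rintro rfl
      rcases he1.2 _ he2.1 _ he3.1 hm23 with h | h
      · exact he21 h.symm
      · exact he31 h.symm
    have hm2 : e2 ≠ m := by
      rintro rfl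
      rcases he2.2 _ he1.1 _ he3.1 hm13 with h | h
      · exact he21 h
      · exact he32 h.symm
    have hm3 : e3 ≠ m := by
      rintro rfl
      rcases he3.2 _ he1.1 _ he2.1 hm12 with h | h
      · exact he31 h
      · exact he32 h
    let V : X → Set X := fun e => connectedComponentIn ({m}ᶜ : Set X) e
    have hself : ∀ e, e ≠ m → e ∈ V e := fun e he => mem_connectedComponentIn he
    have hdis : ∀ e e', e ≠ m → e' ≠ m → m ∈ A.J e e' → ∀ x, x ∈ V e → x ∉ V e' := by
      intro e e' he he' hmJ x hx hx'
      rw [A.mem_J_iff] at hmJ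
      apply hmJ
      rw [connectedComponentIn_eq hx, ← connectedComponentIn_eq hx']
      exact hself e' he'
    have hg : ∀ e ∈ Y, e ≠ m → ∃ g : G, ∀ x ∈ Y, x ∉ V e → g • x ∈ V e := by
      intro e heY he
      obtain ⟨g, hg⟩ := disj (Y ∩ (V e)ᶜ)
        (hYcl.inter (isClosed_compl_iff.2 isOpen_compl_singleton.connectedComponentIn))
        (A.inter_conn hYcon (compl_comp_conn e m)) inter_subset_left
        (fun h => by
          have : e ∈ Y ∩ (V e)ᶜ := h.symm.subset heY
          exact this.2 (hself e he))
      refine ⟨g, fun x hx hxV => ?_⟩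
      by_contra hc
      exact hg x ⟨hx, hxV⟩ ⟨hYinv g x hx, hc⟩
    let YS : SubMulAction G X := ⟨Y, fun g {x} hx => hYinv g x hx⟩
    obtain ⟨g1, hg1⟩ := hg e1 he1.1 hm1
    obtain ⟨g2, hg2⟩ := hg e2 he2.1 hm2
    obtain ⟨g3, hg3⟩ := hg e3 he3.1 hm3
    refine pingpong_aux (α := YS) {x | x.1 ∈ V e1} {x | x.1 ∈ V e2} {x | x.1 ∈ V e3}
      (Set.disjoint_left.2 fun x => hdis e1 e2 hm1 hm2 hm12 x.1)
      (Set.disjoint_left.2 fun x => hdis e1 e3 hm1 hm3 hm13 x.1)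
      (Set.disjoint_left.2 fun x => hdis e2 e3 hm2 hm3 hm23 x.1)
      ⟨⟨e2, he2.1⟩, hself e2 hm2⟩ g1 g2 g3 (fun x => hg1 x.1 x.2)
      (fun x => hg2 x.1 x.2) (fun x => hg3 x.1 x.2)
  · right; right
    have hE : A.Ends Y = {e1, e2} := by
      ext e
      constructor
      · intro he
        by_contra hc
        simp only [mem_insert_iff, mem_singleton_iff, not_or] at hc
        exact h3 ⟨e, he, hc⟩
      · rintro (rfl | rfl)
        · exact he1
        · exact he2
    refine ⟨A.Ends Y, ?_, fun g => ?_⟩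
    · rw [hE]; exact ncard_pair he21.symm
    · ext e
      constructor
      · rintro ⟨x, hx, rfl⟩
        exact hEinv g x hx
      · intro he
        exact ⟨g⁻¹ • e, hEinv _ _ he, smul_inv_smul g e⟩

end ArcSys

section LPC

variable {X : Type*} [MetricSpace X] [CompactSpace X] [LocallyConnectedSpace X]

theorem ulc (ε : ℝ) (hε : 0 < ε) : ∃ δ > 0, ∀ x y : X, dist x y < δ →
    ∃ C : Set X, IsPreconnected C ∧ x ∈ C ∧ y ∈ C ∧ ∀ z ∈ C, dist x z < ε := by
  have h := lebesgue_number_lemma_of_metric (s := (univ : Set X))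
    (c := fun p : X => connectedComponentIn (Metric.ball p (ε / 2)) p) isCompact_univ
    (fun p => Metric.isOpen_ball.connectedComponentIn)
    (fun p _ => mem_iUnion.2 ⟨p, mem_connectedComponentIn (Metric.mem_ball_self (by positivity))⟩)
  obtain ⟨δ, hδ, h⟩ := h
  refine ⟨δ, hδ, fun x y hxy => ?_⟩
  obtain ⟨p, hp⟩ := h x (mem_univ x)
  have hx := hp (Metric.mem_ball_self hδ)
  refine ⟨_, isPreconnected_connectedComponentIn, hx,
    hp (by rwa [Metric.mem_ball, dist_comm]), fun z hz => ?_⟩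
  have h1 := connectedComponentIn_subset _ _ hx
  have h2 := connectedComponentIn_subset _ _ hz
  rw [Metric.mem_ball] at h1 h2
  linarith [dist_triangle_right x z p]

/-- `δ`-chains in connected sets. -/
theorem chain_conn {X : Type*} [MetricSpace X] {C : Set X} (hC : IsPreconnected C) {x y : X} (hx : x ∈ C) (hy : y ∈ C)
    {δ : ℝ} (hδ : 0 < δ) : ∃ (m : ℕ) (c : ℕ → X), c 0 = x ∧ (∀ n, m ≤ n → c n = y) ∧
      (∀ n, c n ∈ C) ∧ ∀ n, dist (c n) (c (n + 1)) < δ := by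
  let R : Set X := {z | z ∈ C ∧ ∃ (m : ℕ) (c : ℕ → X), c 0 = x ∧ (∀ n, m ≤ n → c n = z) ∧
      (∀ n, c n ∈ C) ∧ ∀ n, dist (c n) (c (n + 1)) < δ}
  have step : ∀ z ∈ R, ∀ w ∈ C, dist z w < δ → w ∈ R := by
    rintro z ⟨hz, m, c, h0, h1, h2, h3⟩ w hw hzw
    refine ⟨hw, m + 1, fun n => if n ≤ m then c n else w, by simp [h0], ?_, ?_, ?_⟩
    · intro n hn
      exact if_neg (by omega)
    · intro n
      dsimp only
      split_ifs
      · exact h2 n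
      · exact hw
    · intro n
      dsimp only
      split_ifs with ha hb
      · exact h3 n
      · rw [h1 n (by omega)]; exact hzw
      · omega
      · simpa using hδ
  have hxR : x ∈ R := ⟨hx, 0, fun _ => x, rfl, fun _ _ => rfl, fun _ => hx, fun _ => by simpa⟩
  suffices y ∈ R from this.2
  by_contra hyR
  have := hC (⋃ z ∈ R, Metric.ball z (δ / 2)) (⋃ z ∈ C \ R, Metric.ball z (δ / 2))
    (isOpen_biUnion fun _ _ => Metric.isOpen_ball) (isOpen_biUnion fun _ _ => Metric.isOpen_ball)
    (fun z hz => by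
      by_cases hzR : z ∈ R
      · exact Or.inl (mem_biUnion hzR (Metric.mem_ball_self (by positivity)))
      · exact Or.inr (mem_biUnion (show z ∈ C \ R from ⟨hz, hzR⟩) (Metric.mem_ball_self (by positivity))))
    ⟨x, hx, mem_biUnion hxR (Metric.mem_ball_self (by positivity))⟩
    ⟨y, hy, mem_biUnion (show y ∈ C \ R from ⟨hy, hyR⟩) (Metric.mem_ball_self (by positivity))⟩
  obtain ⟨w, hw, hw1, hw2⟩ := this
  simp only [mem_iUnion, Metric.mem_ball] at hw1 hw2
  obtain ⟨z1, hz1, hd1⟩ := hw1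
  obtain ⟨z2, hz2, hd2⟩ := hw2
  exact hz2.2 (step z1 hz1 z2 hz2.1 (by linarith [dist_triangle_left z1 z2 w]))

/-- One refinement step. -/
theorem refine_chain {X : Type*} [MetricSpace X] {ε δ η : ℝ} (hη : 0 < η)
    (h : ∀ x y : X, dist x y < δ →
      ∃ C : Set X, IsPreconnected C ∧ x ∈ C ∧ y ∈ C ∧ ∀ z ∈ C, dist x z < ε) (hε : 0 < ε)
    (m : ℕ) (c : ℕ → X) (hc : ∀ i < m, dist (c i) (c (i + 1)) < δ) :
    ∃ (M : ℕ) (c' : ℕ → X), 0 < M ∧ c' 0 = c 0 ∧ c' (m * M) = c m ∧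
      (∀ i < m * M, dist (c' i) (c' (i + 1)) < η) ∧ ∀ i ≤ m * M, dist (c (i / M)) (c' i) < ε := by
  have h1 : ∀ i, ∃ (k : ℕ) (b : ℕ → X), i < m → b 0 = c i ∧ (∀ n, k ≤ n → b n = c (i + 1)) ∧
      (∀ n, dist (c i) (b n) < ε) ∧ ∀ n, dist (b n) (b (n + 1)) < η := by
    intro i
    by_cases hi : i < m
    · obtain ⟨C, hC, hx, hy, hd⟩ := h _ _ (hc i hi)
      obtain ⟨k, b, hb0, hb1, hb2, hb3⟩ := chain_conn hC hx hy hη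
      exact ⟨k, b, fun _ => ⟨hb0, hb1, fun n => hd _ (hb2 n), hb3⟩⟩
    · exact ⟨0, fun _ => c 0, fun h => absurd h hi⟩
  choose k b hb using h1
  let M := (Finset.range m).sup k + 1
  have hM : ∀ i < m, k i ≤ M := fun i hi =>
    (Finset.le_sup (f := k) (Finset.mem_range.2 hi)).trans (Nat.le_succ _)
  have hMpos : 0 < M := Nat.succ_pos _
  clear_value M
  let c' : ℕ → X := fun i => if i < m * M then b (i / M) (i % M) else c m
  have hdiv : ∀ i, i < m * M → i / M < m := fun i hi => (Nat.div_lt_iff_lt_mul hMpos).2 hi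
  refine ⟨M, c', hMpos, ?_, by simp [c'], ?_, ?_⟩
  · by_cases hm : m = 0
    · simp [c', hm]
    · have : 0 < m * M := by positivity
      simp only [c', this, if_true, Nat.zero_div, Nat.zero_mod]
      exact (hb 0 (by omega)).1
  · intro i hi
    have hid := hdiv i hi
    obtain ⟨p0, p1, p2, p3⟩ := hb _ hid
    have hc'i : c' i = b (i / M) (i % M) := if_pos hi
    rw [hc'i]
    have hdm := Nat.div_add_mod i M
    have hlt := Nat.mod_lt i hMpos
    have hc'i1 : c' (i + 1) = b (i / M) (i % M + 1) := by
      by_cases hlast : i % M + 1 = M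
      · rw [hlast, p1 M (hM _ hid)]
        have e1 : i + 1 = (i / M + 1) * M := by
          rw [add_mul, one_mul, mul_comm (i / M)]; omega
        by_cases hi' : i + 1 < m * M
        · have e2 : (i + 1) / M = i / M + 1 := by rw [e1]; exact Nat.mul_div_cancel _ hMpos
          have e3 : (i + 1) % M = 0 := by rw [e1]; exact Nat.mul_mod_left _ _
          have : c' (i + 1) = b ((i + 1) / M) ((i + 1) % M) := if_pos hi'
          rw [this, e2, e3]
          exact (hb _ (e2 ▸ hdiv _ hi')).1
        · have e4 : i + 1 = m * M := by omega
          have e5 : i / M + 1 = m := by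
            apply Nat.eq_of_mul_eq_mul_right hMpos
            rw [← e1, e4]
          have : c' (i + 1) = c m := if_neg hi'
          rw [this, e5]
      · have e2 : (i + 1) / M = i / M := by
          rw [Nat.div_eq_iff hMpos, mul_comm]
          omega
        have e3 : (i + 1) % M = i % M + 1 := by
          have := Nat.div_add_mod (i + 1) M
          rw [e2] at this
          omega
        have hi' : i + 1 < m * M := by
          have : M * (i / M + 1) ≤ M * m := Nat.mul_le_mul_left _ hid
          rw [mul_comm m]
          rw [mul_add] at this
          omega
        have : c' (i + 1) = b ((i + 1) / M) ((i + 1) % M) := if_pos hi'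
        rw [this, e2, e3]
    rw [hc'i1]
    exact p3 _
  · intro i hi
    by_cases hi' : i < m * M
    · have hc'i : c' i = b (i / M) (i % M) := if_pos hi'
      rw [hc'i]
      exact (hb _ (hdiv i hi')).2.2.1 _
    · have e : i = m * M := by omega
      have : c' i = c m := if_neg hi'
      rw [this, e, Nat.mul_div_cancel _ hMpos, dist_self]
      exact hε

theorem local_path (ε : ℝ) (hε : 0 < ε) : ∃ δ > 0, ∀ x y : X, dist x y < δ →
    JoinedIn (Metric.ball x (4 * ε)) x y := by
  have hεn : ∀ n : ℕ, 0 < 2 * ε / 2 / 2 ^ n := fun n => by positivity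
  choose δ₀ hδ₀ hulc₀ using fun n : ℕ => ulc (X := X) _ (hεn n)
  let δ : ℕ → ℝ := fun n => min (δ₀ n) (2 * ε / 2 / 2 ^ n)
  have hδ : ∀ n, 0 < δ n := fun n => lt_min (hδ₀ n) (hεn n)
  have hδle : ∀ n, δ n ≤ 2 * ε / 2 / 2 ^ n := fun n => min_le_right _ _
  have hulc : ∀ n, ∀ x y : X, dist x y < δ n → ∃ C : Set X, IsPreconnected C ∧ x ∈ C ∧ y ∈ C ∧
      ∀ z ∈ C, dist x z < 2 * ε / 2 / 2 ^ n :=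
    fun n x y h => hulc₀ n x y (h.trans_le (min_le_left _ _))
  clear_value δ
  refine ⟨δ 0, hδ 0, fun x y hxy => ?_⟩
  let State : ℕ → Type _ := fun n => {p : ℕ × (ℕ → X) // 0 < p.1 ∧ p.2 0 = x ∧ p.2 p.1 = y ∧
    ∀ i < p.1, dist (p.2 i) (p.2 (i + 1)) < δ n}
  have hstep : ∀ (n : ℕ) (s : State n), ∃ s' : State (n + 1), ∃ M, 0 < M ∧ s'.1.1 = s.1.1 * M ∧
      ∀ i ≤ s.1.1 * M, dist (s.1.2 (i / M)) (s'.1.2 i) < 2 * ε / 2 / 2 ^ n := by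
    rintro n ⟨⟨m, c⟩, hm, h0, h1, h2⟩
    obtain ⟨M, c', hM, p0, p1, p2, p3⟩ := refine_chain (hδ (n + 1)) (hulc n) (hεn n) m c h2
    exact ⟨⟨⟨m * M, c'⟩, Nat.mul_pos hm hM, p0.trans h0, p1.trans h1, p2⟩, M, hM, rfl, p3⟩
  choose next M hMpos hM1 hM2 using hstep
  let s0 : State 0 := ⟨⟨1, fun i => if i = 0 then x else y⟩, one_pos, by simp, by simp, by
    intro i hi
    have : i = 0 := by simpa using hi
    subst this
    simpa using hxy⟩
  let σ : ∀ n, State n := fun n => Nat.rec s0 (fun n s => next n s) n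
  have hσ : ∀ n, σ (n + 1) = next n (σ n) := fun n => rfl
  have hσ0 : σ 0 = s0 := rfl
  clear_value σ
  let m : ℕ → ℕ := fun n => (σ n).1.1
  let F : ℝ → ℕ → X := fun t n => (σ n).1.2 ⌊(m n : ℝ) * t⌋₊
  have hmpos : ∀ n, 0 < m n := fun n => (σ n).2.1
  have hF : ∀ t ∈ Icc (0:ℝ) 1, ∀ n, dist (F t n) (F t (n + 1)) ≤ 2 * ε / 2 / 2 ^ n := by
    intro t ht n
    have hm1 : m (n + 1) = m n * M n (σ n) := by
      change (σ (n + 1)).1.1 = _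
      rw [hσ, hM1]
    have hMp := hMpos n (σ n)
    have h1 := hM2 n (σ n) ⌊(m (n + 1) : ℝ) * t⌋₊ (by
      change _ ≤ m n * _
      rw [← hm1]
      apply Nat.floor_le_of_le
      exact mul_le_of_le_one_right (Nat.cast_nonneg _) ht.2)
    rw [← Nat.floor_div_natCast] at h1
    have h2 : (m (n + 1) : ℝ) * t / (M n (σ n) : ℝ) = m n * t := by
      have : (M n (σ n) : ℝ) ≠ 0 := by positivity
      rw [hm1]
      push_cast
      field_simp
    rw [h2] at h1
    have h3 : F t (n + 1) = (next n (σ n)).1.2 ⌊(m (n + 1) : ℝ) * t⌋₊ := by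
      rw [← hσ]
    rw [h3]
    exact h1.le
  have hlim : ∀ t ∈ Icc (0:ℝ) 1, ∃ z, Filter.Tendsto (F t) Filter.atTop (nhds z) := fun t ht =>
    cauchySeq_tendsto_of_complete (cauchySeq_of_le_geometric_two (hF t ht))
  let f : ℝ → X := fun t => if ht : t ∈ Icc (0:ℝ) 1 then (hlim t ht).choose else x
  have hf : ∀ t ∈ Icc (0:ℝ) 1, Filter.Tendsto (F t) Filter.atTop (nhds (f t)) := by
    intro t ht
    have : f t = (hlim t ht).choose := dif_pos ht
    rw [this]
    exact (hlim t ht).choose_spec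
  have hfd : ∀ t ∈ Icc (0:ℝ) 1, ∀ n, dist (F t n) (f t) ≤ 2 * ε / 2 ^ n := fun t ht n =>
    dist_le_of_le_geometric_two_of_tendsto (hF t ht) (hf t ht) n
  have hstep1 : ∀ n, ∀ i j : ℕ, i ≤ j → j ≤ i + 1 → j ≤ m n →
      dist ((σ n).1.2 i) ((σ n).1.2 j) ≤ 2 * ε / 2 / 2 ^ n := by
    intro n i j h1 h2 h3
    rcases (show j = i ∨ j = i + 1 by omega) with rfl | rfl
    · rw [dist_self]; exact (hεn n).le
    · exact ((σ n).2.2.2.2 i (by change _ < m n; omega)).le.trans (hδle n)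
  have hosc : ∀ n, ∀ s ∈ Icc (0:ℝ) 1, ∀ t ∈ Icc (0:ℝ) 1, s ≤ t → t - s < 1 / m n →
      dist (F s n) (F t n) ≤ 2 * ε / 2 / 2 ^ n := by
    intro n s hs t ht hst hlt
    have hmp : (0:ℝ) < m n := by exact_mod_cast hmpos n
    apply hstep1
    · exact Nat.floor_le_floor (mul_le_mul_of_nonneg_left hst hmp.le)
    · rw [← Nat.floor_add_one (mul_nonneg hmp.le hs.1)]
      apply Nat.floor_le_floor
      rw [lt_div_iff₀ hmp] at hlt
      nlinarith
    · apply Nat.floor_le_of_le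
      exact mul_le_of_le_one_right hmp.le ht.2
  have hcts : ContinuousOn f (Icc 0 1) := by
    rw [Metric.continuousOn_iff]
    intro t ht η hη
    obtain ⟨n, hn⟩ : ∃ n : ℕ, 5 * ε / 2 ^ n < η := by
      obtain ⟨n, hn⟩ := exists_pow_lt_of_lt_one (show 0 < η / (5 * ε) by positivity)
        (show (1/2 : ℝ) < 1 by norm_num)
      refine ⟨n, ?_⟩
      rw [lt_div_iff₀ (by positivity)] at hn
      calc 5 * ε / 2 ^ n = (1/2 : ℝ) ^ n * (5 * ε) := by rw [one_div, inv_pow]; ring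
        _ < η := hn
    have hmp : (0:ℝ) < m n := by exact_mod_cast hmpos n
    refine ⟨1 / m n, by positivity, fun s hs hst => ?_⟩
    have h1 : dist (F s n) (F t n) ≤ 2 * ε / 2 / 2 ^ n := by
      rw [Real.dist_eq, abs_lt] at hst
      rcases le_total s t with h | h
      · exact hosc n s hs t ht h (by linarith)
      · rw [dist_comm]; exact hosc n t ht s hs h (by linarith)
    have h2 := hfd s hs n
    have h3 := hfd t ht n
    have h4 := dist_triangle4_left (F s n) (F t n) (f s) (f t)
    have h5 : 2 * ε / 2 / 2 ^ n + (2 * ε / 2 ^ n + 2 * ε / 2 ^ n) = 5 * ε / 2 ^ n := by ring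
    linarith
  have hf0 : f 0 = x := by
    have h := hf 0 (by simp)
    have : F 0 = fun _ => x := by
      funext n
      simp only [F, mul_zero, Nat.floor_zero]
      exact (σ n).2.2.1
    rw [this] at h
    exact (tendsto_nhds_unique h tendsto_const_nhds)
  have hf1 : f 1 = y := by
    have h := hf 1 (by simp)
    have : F 1 = fun _ => y := by
      funext n
      simp only [F, mul_one, Nat.floor_natCast]
      exact (σ n).2.2.2.1
    rw [this] at h
    exact (tendsto_nhds_unique h tendsto_const_nhds)
  refine JoinedIn.ofLine hcts hf0 hf1 ?_
  rintro _ ⟨t, ht, rfl⟩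
  rw [Metric.mem_ball]
  have h1 := hfd t ht 0
  have h2 : dist x (F t 0) ≤ ε := by
    simp only [F, hσ0, s0]
    split_ifs
    · simpa using hε.le
    · have := hδle 0
      simp only [pow_zero, div_one] at this
      linarith
  rw [pow_zero, div_one] at h1
  have h3 := dist_triangle x (F t 0) (f t)
  rw [dist_comm]
  linarith

theorem locPath : LocallyPathConnectedSpace X := by
  rw [locallyPathConnectedSpace_iff_pathComponentIn_mem_nhds]
  intro x u hu hxu
  obtain ⟨ε, hε, hb⟩ := Metric.isOpen_iff.1 hu x hxu
  obtain ⟨δ, hδ, h⟩ := local_path (X := X) (ε / 4) (by positivity)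
  refine Metric.mem_nhds_iff.2 ⟨δ, hδ, fun y hy => ?_⟩
  rw [Metric.mem_ball, dist_comm] at hy
  have := h x y hy
  rw [mul_div_cancel₀ _ (by norm_num : (4:ℝ) ≠ 0)] at this
  exact this.mono hb

end LPC

section Arc

open unitInterval

theorem quot_lift {T S X : Type*} [TopologicalSpace T] [TopologicalSpace S] [TopologicalSpace X]
    [CompactSpace T] [T2Space S] (u : T → S) (v : T → X) (hu : Continuous u)
    (hus : Function.Surjective u) (hv : Continuous v) (huv : ∀ a b, u a = u b → v a = v b) :
    ∃ f : S → X, Continuous f ∧ ∀ a, f (u a) = v a := by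
  have hq : Topology.IsQuotientMap u := hu.isClosedMap.isQuotientMap hu hus
  choose g hg using hus
  have h : ∀ a, v (g (u a)) = v a := fun a => huv _ _ (hg _)
  refine ⟨fun s => v (g s), ?_, h⟩
  rw [hq.continuous_iff]
  exact hv.congr (fun a => (h a).symm)

/-- Every path can be replaced by one with order-connected fibres. -/
theorem exists_monotone_path {X : Type*} [TopologicalSpace X] [T2Space X] {x y : X}
    (γ : Path x y) : ∃ β : Path x y, range β ⊆ range γ ∧
      ∀ s t u : I, s ≤ t → t ≤ u → β s = β u → β t = β s := by
  let Q : Set I → Set I → I → Set (I × I) := fun F F' t =>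
    {p | p.1 ∈ F ∧ p.2 ∈ F ∧ p.1 ≤ t ∧ t ≤ p.2 ∧ (∀ c ∈ F', ¬ (p.1 < c ∧ c < p.2)) ∧ γ p.1 = γ p.2}
  let S : Set (Set I) := {F | IsClosed F ∧ 0 ∈ F ∧ 1 ∈ F ∧ ∀ t, (Q F F t).Nonempty}
  have hQcl : ∀ F F' t, IsClosed F → IsClosed (Q F F' t) := by
    intro F F' t hF
    refine (hF.preimage continuous_fst).inter ((hF.preimage continuous_snd).inter
      ((isClosed_le continuous_fst continuous_const).inter
      ((isClosed_le continuous_const continuous_snd).inter (IsClosed.inter ?_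
      (isClosed_eq (γ.continuous.comp continuous_fst) (γ.continuous.comp continuous_snd))))))
    have : {p : I × I | ∀ c ∈ F', ¬ (p.1 < c ∧ c < p.2)} =
        ⋂ c ∈ F', {p : I × I | c ≤ p.1 ∨ p.2 ≤ c} := by
      ext p
      simp only [mem_ofPred_eq, mem_iInter, not_and, not_lt]
      refine forall₂_congr fun c _ => ?_
      rw [or_iff_not_imp_left, not_le]
    change IsClosed {p : I × I | ∀ c ∈ F', ¬ (p.1 < c ∧ c < p.2)}
    rw [this]
    exact isClosed_biInter fun c _ => (isClosed_le (by fun_prop) (by fun_prop)).union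
      (isClosed_le (by fun_prop) (by fun_prop))
  obtain ⟨F, hFmin⟩ := zorn_superset S (by
    intro c hcS hc
    rcases c.eq_empty_or_nonempty with rfl | hcne
    · refine ⟨univ, ⟨isClosed_univ, mem_univ _, mem_univ _, fun t => ⟨(t, t), mem_univ _,
        mem_univ _, le_rfl, le_rfl, fun c _ h => lt_asymm h.1 h.2, rfl⟩⟩, by simp⟩
    have : Nonempty c := hcne.to_subtype
    refine ⟨⋂₀ c, ⟨isClosed_sInter fun s hs => (hcS hs).1, fun s hs => (hcS hs).2.1,
      fun s hs => (hcS hs).2.2.1, fun t => ?_⟩, fun s hs => sInter_subset_of_mem hs⟩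
    have := IsCompact.nonempty_iInter_of_directed_nonempty_isCompact_isClosed
      (fun F : c => Q F (⋂₀ c) t) (by
        intro A B
        rcases hc.total A.2 B.2 with h | h
        · exact ⟨A, subset_rfl, fun p hp => ⟨h hp.1, h hp.2.1, hp.2.2⟩⟩
        · exact ⟨B, fun p hp => ⟨h hp.1, h hp.2.1, hp.2.2⟩, subset_rfl⟩)
      (fun A => by
        obtain ⟨p, h1, h2, h3, h4, h5, h6⟩ := (hcS A.2).2.2.2 t
        exact ⟨p, h1, h2, h3, h4, fun z hz => h5 z (hz A.1 A.2), h6⟩)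
      (fun A => (hQcl _ _ _ (hcS A.2).1).isCompact)
      (fun A => (hQcl _ _ _ (hcS A.2).1))
    obtain ⟨p, hp⟩ := this
    simp only [mem_iInter] at hp
    obtain ⟨A, hA⟩ := hcne
    obtain ⟨_, _, h3, h4, h5, h6⟩ := hp ⟨A, hA⟩
    exact ⟨p, fun B hB => (hp ⟨B, hB⟩).1, fun B hB => (hp ⟨B, hB⟩).2.1, h3, h4, h5, h6⟩)
  obtain ⟨⟨hFcl, hF0, hF1, hFQ⟩, hmin⟩ := hFmin
  have hgap : ∀ s ∈ F, ∀ t ∈ F, s < t → γ s = γ t → ∀ c ∈ F, ¬ (s < c ∧ c < t) := by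
    intro s hs t ht hst hγ c hc hsct
    have hmem : F \ Ioo s t ∈ S := by
      refine ⟨hFcl.sdiff isOpen_Ioo, ⟨hF0, fun h => not_lt_bot h.1⟩,
        ⟨hF1, fun h => not_top_lt h.2⟩, fun u => ?_⟩
      by_cases hu : s ≤ u ∧ u ≤ t
      · exact ⟨(s, t), ⟨hs, fun h => lt_irrefl _ h.1⟩, ⟨ht, fun h => lt_irrefl _ h.2⟩,
          hu.1, hu.2, fun z hz hz' => hz.2 hz', hγ⟩
      · obtain ⟨⟨a, b⟩, h1, h2, h3, h4, h5, h6⟩ := hFQ u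
        have hs5 := h5 s hs
        have ht5 := h5 t ht
        dsimp only at *
        refine ⟨(a, b), ⟨h1, fun h => ?_⟩, ⟨h2, fun h => ?_⟩, h3, h4,
          fun z hz => h5 z hz.1, h6⟩
        · exact hu ⟨h.1.le.trans h3, by
            by_contra hc; push Not at hc; exact ht5 ⟨h.2, hc.trans_le h4⟩⟩
        · exact hu ⟨by
            by_contra hc; push Not at hc; exact hs5 ⟨h3.trans_lt hc, h.1⟩, h4.trans h.2.le⟩
    exact (hmin hmem sdiff_subset hc).2 hsct
  -- the compact graph
  let T : Set (I × I × I) := {p | (p.1, p.2.1) ∈ Q F F p.2.2}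
  have hTcl : IsClosed T := by
    have h1 : T = {p : I × I × I | (p.1, p.2.1) ∈ {q : I × I | q.1 ∈ F ∧ q.2 ∈ F ∧
        (∀ c ∈ F, ¬ (q.1 < c ∧ c < q.2)) ∧ γ q.1 = γ q.2}} ∩
        ({p | p.1 ≤ p.2.2} ∩ {p | p.2.2 ≤ p.2.1}) := by
      ext p
      constructor
      · rintro ⟨h1, h2, h3, h4, h5, h6⟩
        exact ⟨⟨h1, h2, h5, h6⟩, h3, h4⟩
      · rintro ⟨⟨h1, h2, h5, h6⟩, h3, h4⟩
        exact ⟨h1, h2, h3, h4, h5, h6⟩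
    rw [h1]
    refine IsClosed.inter (IsClosed.preimage (by fun_prop) ?_) ((isClosed_le (by fun_prop)
      (by fun_prop)).inter (isClosed_le (by fun_prop) (by fun_prop)))
    refine (hFcl.preimage continuous_fst).inter ((hFcl.preimage continuous_snd).inter
      (IsClosed.inter ?_
      (isClosed_eq (γ.continuous.comp continuous_fst) (γ.continuous.comp continuous_snd))))
    have : {p : I × I | ∀ c ∈ F, ¬ (p.1 < c ∧ c < p.2)} =
        ⋂ c ∈ F, {p : I × I | c ≤ p.1 ∨ p.2 ≤ c} := by
      ext p
      simp only [mem_ofPred_eq, mem_iInter, not_and, not_lt]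
      refine forall₂_congr fun c _ => ?_
      rw [or_iff_not_imp_left, not_le]
    change IsClosed {p : I × I | ∀ c ∈ F, ¬ (p.1 < c ∧ c < p.2)}
    rw [this]
    exact isClosed_biInter fun c _ => (isClosed_le (by fun_prop) (by fun_prop)).union
      (isClosed_le (by fun_prop) (by fun_prop))
  have : CompactSpace T := isCompact_iff_compactSpace.1 hTcl.isCompact
  have huniq : ∀ t, ∀ p ∈ Q F F t, ∀ q ∈ Q F F t, γ p.1 = γ q.1 := by
    rintro t ⟨a, b⟩ ⟨h1, h2, h3, h4, h5, h6⟩ ⟨a', b'⟩ ⟨h1', h2', h3', h4', h5', h6'⟩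
    dsimp only at *
    rcases h3.eq_or_lt with rfl | h3
    · have := h5' a h1
      rcases h3'.eq_or_lt with rfl | h3'
      · rfl
      · rcases h4'.eq_or_lt with rfl | h4'
        · exact h6'.symm
        · exact absurd ⟨h3', h4'⟩ this
    · rcases h4.eq_or_lt with rfl | h4
      · have := h5' t h2
        rcases h3'.eq_or_lt with rfl | h3'
        · exact h6
        · rcases h4'.eq_or_lt with rfl | h4'
          · exact h6.trans h6'.symm
          · exact absurd ⟨h3', h4'⟩ this
      · have e1 : a' ≤ a := by
          by_contra hc; push Not at hc; exact h5 a' h1' ⟨hc, h3'.trans_lt h4⟩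
        have e2 : a ≤ a' := by
          by_contra hc; push Not at hc; exact h5' a h1 ⟨hc, h3.trans_le h4'⟩
        rw [le_antisymm e1 e2]
  obtain ⟨f, hfc, hf⟩ := quot_lift (fun p : T => p.1.2.2) (fun p : T => γ p.1.1)
    (by fun_prop) (fun t => by
      obtain ⟨p, hp⟩ := hFQ t
      exact ⟨⟨(p.1, p.2, t), hp⟩, rfl⟩)
    (γ.continuous.comp (by fun_prop)) (by
      rintro ⟨⟨a, b, t⟩, hp⟩ ⟨⟨a', b', t'⟩, hp'⟩ (h : t = t')
      subst h
      exact huniq t _ hp _ hp')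
  have hf' : ∀ t, ∀ p ∈ Q F F t, f t = γ p.1 := fun t p hp => hf ⟨(p.1, p.2, t), hp⟩
  have hfF : ∀ t ∈ F, f t = γ t := fun t ht => hf' t (t, t)
    ⟨ht, ht, le_rfl, le_rfl, fun c _ h => lt_asymm h.1 h.2, rfl⟩
  refine ⟨⟨⟨f, hfc⟩, by simp [hfF 0 hF0], by simp [hfF 1 hF1]⟩, ?_, ?_⟩
  · rintro _ ⟨t, rfl⟩
    obtain ⟨p, hp⟩ := hFQ t
    exact ⟨p.1, (hf' t p hp).symm⟩
  · intro s t u hst htu hsu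
    change f s = f u at hsu
    change f t = f s
    obtain ⟨p, hp⟩ := hFQ s
    obtain ⟨q, hq⟩ := hFQ u
    rw [hf' s p hp, hf' u q hq] at hsu
    rw [hf' s p hp]
    apply hf' t (p.1, q.2)
    have hle : p.1 ≤ q.2 := hp.2.2.1.trans (hst.trans (htu.trans hq.2.2.2.1))
    have hγ : γ p.1 = γ q.2 := hsu.trans hq.2.2.2.2.2
    refine ⟨hp.1, hq.2.1, hp.2.2.1.trans hst, htu.trans hq.2.2.2.1, ?_, hγ⟩
    rcases hle.eq_or_lt with h | h
    · intro c _ hc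
      dsimp only at hc
      rw [← h] at hc
      exact lt_asymm hc.1 hc.2
    · exact hgap _ hp.1 _ hq.2.1 h hγ

theorem exists_arc {X : Type*} [MetricSpace X] [CompactSpace X] {x y : X} (hxy : x ≠ y)
    (γ : Path x y) : ∃ α : Path x y, range α ⊆ range γ ∧ Function.Injective α := by
  obtain ⟨β, hβγ, hβ⟩ := exists_monotone_path γ
  have : Nonempty X := ⟨x⟩
  let p : ℕ → X := TopologicalSpace.denseSeq X
  let h : ℕ → I → ℝ := fun n t => sInf ((fun s : I => dist (β (t ⊓ s)) (p n)) '' univ)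
  have hbdd : ∀ n (t : I), BddBelow ((fun s : I => dist (β (t ⊓ s)) (p n)) '' univ) := by
    intro n t
    refine ⟨0, ?_⟩
    rintro _ ⟨s, -, rfl⟩
    exact dist_nonneg
  have hne : ∀ n (t : I), ((fun s : I => dist (β (t ⊓ s)) (p n)) '' univ).Nonempty :=
    fun n t => ⟨_, t, mem_univ _, rfl⟩
  have hle : ∀ n t (u : I), u ≤ t → h n t ≤ dist (β u) (p n) := by
    intro n t u hut
    apply csInf_le (hbdd n t)
    refine ⟨u, mem_univ _, ?_⟩
    dsimp only
    rw [inf_eq_right.2 hut]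
  have hge : ∀ n (t : I) (c : ℝ), (∀ u ≤ t, c ≤ dist (β u) (p n)) → c ≤ h n t := by
    intro n t c hc
    apply le_csInf (hne n t)
    rintro _ ⟨s, -, rfl⟩
    exact hc _ inf_le_left
  have hanti : ∀ n (s t : I), s ≤ t → h n t ≤ h n s := fun n s t hst =>
    hge n s _ fun u hu => hle n t u (hu.trans hst)
  have hconst : ∀ n (s t : I), s ≤ t → β s = β t → h n t = h n s := by
    intro n s t hst hβst
    apply le_antisymm (hanti n s t hst)
    apply hge
    intro u hu
    rcases le_total u s with hus | hus
    · exact hle n s u hus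
    · rw [hβ s u t hus hu hβst]
      exact hle n s s le_rfl
  have hcont : ∀ n, Continuous (h n) := by
    intro n
    apply IsCompact.continuous_sInf (f := fun (t : I) (s : I) => dist (β (t ⊓ s)) (p n))
      isCompact_univ
    have : Continuous fun q : I × I => dist (β (q.1 ⊓ q.2)) (p n) :=
      (β.continuous.comp (by fun_prop)).dist continuous_const
    exact this
  have hnn : ∀ n t, 0 ≤ h n t := fun n t => hge n t 0 fun u _ => dist_nonneg
  have hD : ∀ n t, h n t ≤ Metric.diam (univ : Set X) := fun n t => (hle n t t le_rfl).trans
    (Metric.dist_le_diam_of_mem isCompact_univ.isBounded (mem_univ _) (mem_univ _))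
  let D := Metric.diam (univ : Set X)
  have hsum : Summable fun n : ℕ => (1 / 2 : ℝ) ^ n * D := summable_geometric_two.mul_right _
  have hsumt : ∀ t, Summable fun n : ℕ => (1 / 2 : ℝ) ^ n * h n t := fun t =>
    Summable.of_nonneg_of_le (fun n => mul_nonneg (by positivity) (hnn n t))
      (fun n => mul_le_mul_of_nonneg_left (hD n t) (by positivity)) hsum
  let φ : I → ℝ := fun t => ∑' n : ℕ, (1 / 2 : ℝ) ^ n * h n t
  have hφc : Continuous φ := by
    apply continuous_tsum (fun n => continuous_const.mul (hcont n)) hsum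
    intro n t
    change ‖(1 / 2 : ℝ) ^ n * h n t‖ ≤ (1 / 2 : ℝ) ^ n * D
    rw [Real.norm_of_nonneg (mul_nonneg (by positivity) (hnn n t))]
    exact mul_le_mul_of_nonneg_left (hD n t) (by positivity)
  have hφanti : ∀ s t : I, s ≤ t → φ t ≤ φ s := fun s t hst =>
    Summable.tsum_le_tsum (fun n => mul_le_mul_of_nonneg_left (hanti n s t hst) (by positivity))
      (hsumt t) (hsumt s)
  have hφconst : ∀ s t : I, s ≤ t → β s = β t → φ t = φ s := by
    intro s t hst hb
    exact tsum_congr fun n => by rw [hconst n s t hst hb]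
  have hφstrict : ∀ s t : I, s ≤ t → β s ≠ β t → φ t < φ s := by
    intro s t hst hb
    have hcomp : IsCompact (β '' Iic s) := isClosed_Iic.isCompact.image β.continuous
    have hnot : β t ∉ β '' Iic s := by
      rintro ⟨u, hu, hut⟩
      exact hb ((hβ u s t hu hst hut).trans hut)
    obtain ⟨r, hr, hball⟩ := Metric.isOpen_iff.1 hcomp.isClosed.isOpen_compl _ hnot
    have hrd : ∀ u ≤ s, r ≤ dist (β u) (β t) := by
      intro u hu
      by_contra hc
      push Not at hc
      exact hball hc ⟨u, hu, rfl⟩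
    obtain ⟨n, hn⟩ := (TopologicalSpace.denseRange_denseSeq X).exists_dist_lt (β t)
      (show 0 < r / 3 by positivity)
    have h1 : h n t < r / 3 := (hle n t t le_rfl).trans_lt hn
    have h2 : 2 * r / 3 ≤ h n s := by
      apply hge
      intro u hu
      have := hrd u hu
      have h3 := dist_triangle_right (β u) (β t) (p n)
      have hn' : dist (β t) (p n) < r / 3 := hn
      linarith
    apply Summable.tsum_lt_tsum (i := n)
      (fun n => mul_le_mul_of_nonneg_left (hanti n s t hst) (by positivity)) _ (hsumt t) (hsumt s)
    exact mul_lt_mul_of_pos_left (by linarith) (by positivity)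
  have h01 : φ 1 < φ 0 := hφstrict 0 1 zero_le_one (by simpa using hxy)
  have hpos : 0 < φ 0 - φ 1 := by linarith
  let ψ : I → I := fun t => ⟨(φ 0 - φ t) / (φ 0 - φ 1),
    div_nonneg (by linarith [hφanti 0 t t.2.1]) hpos.le,
    (div_le_one hpos).2 (by linarith [hφanti t 1 t.2.2])⟩
  have hψc : Continuous ψ := by
    apply Continuous.subtype_mk
    exact (continuous_const.sub hφc).div_const _
  have hψ0 : ψ 0 = 0 := by
    apply Subtype.ext; simp [ψ]
  have hψ1 : ψ 1 = 1 := by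
    apply Subtype.ext; simp [ψ, hpos.ne']
  have hψφ : ∀ s t, ψ s = ψ t ↔ φ s = φ t := by
    intro s t
    rw [Subtype.ext_iff]
    change (φ 0 - φ s) / (φ 0 - φ 1) = (φ 0 - φ t) / (φ 0 - φ 1) ↔ _
    rw [div_left_inj' hpos.ne']
    constructor <;> intro h <;> linarith
  have hψβ : ∀ s t, ψ s = ψ t ↔ β s = β t := by
    intro s t
    rw [hψφ]
    rcases le_total s t with hst | hst
    · constructor
      · intro he
        by_contra hc
        exact (hφstrict s t hst hc).ne he.symm
      · intro he; exact (hφconst s t hst he).symm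
    · constructor
      · intro he
        by_contra hc
        exact (hφstrict t s hst (Ne.symm hc)).ne he
      · intro he; exact (hφconst t s hst he.symm)
  have hψs : Function.Surjective ψ := by
    intro z
    exact mem_range_of_exists_le_of_exists_ge hψc ⟨0, by rw [hψ0]; exact z.2.1⟩
      ⟨1, by rw [hψ1]; exact z.2.2⟩
  obtain ⟨f, hfc, hf⟩ := quot_lift ψ β hψc hψs β.continuous (fun a b => (hψβ a b).1)
  refine ⟨⟨⟨f, hfc⟩, ?_, ?_⟩, ?_, ?_⟩
  · have := hf 0
    rw [hψ0] at this
    simpa using this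
  · have := hf 1
    rw [hψ1] at this
    simpa using this
  · rintro _ ⟨z, rfl⟩
    obtain ⟨t, rfl⟩ := hψs z
    exact hβγ ⟨t, (hf t).symm⟩
  · intro z w hzw
    obtain ⟨s, rfl⟩ := hψs z
    obtain ⟨t, rfl⟩ := hψs w
    have : β s = β t := by rw [← hf, ← hf]; exact hzw
    exact (hψβ s t).2 this

end Arc

section CircleLemma

variable {X : Type*} [TopologicalSpace X] [T2Space X]

theorem circle_of_loop (f : ℝ → X) (a T : ℝ) (hT : 0 < T) (hf : Continuous f)
    (hper : f a = f (a + T)) (hinj : InjOn f (Ico a (a + T))) :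
    ∃ S : Set X, Nonempty (S ≃ₜ Circle) := by
  haveI : Fact (0 < T) := ⟨hT⟩
  have hc : Continuous (AddCircle.liftIco T a f) :=
    AddCircle.liftIco_continuous hper hf.continuousOn
  have hi : Function.Injective (AddCircle.liftIco T a f) := by
    intro x y hxy
    obtain ⟨x', hx', rfl⟩ : ∃ x' ∈ Ico a (a + T), (x' : AddCircle T) = x :=
      ⟨AddCircle.equivIco T a x, (AddCircle.equivIco T a x).2,
        (AddCircle.equivIco T a).symm_apply_apply x⟩
    obtain ⟨y', hy', rfl⟩ : ∃ y' ∈ Ico a (a + T), (y' : AddCircle T) = y :=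
      ⟨AddCircle.equivIco T a y, (AddCircle.equivIco T a y).2,
        (AddCircle.equivIco T a).symm_apply_apply y⟩
    rw [AddCircle.liftIco_coe_apply hx', AddCircle.liftIco_coe_apply hy'] at hxy
    rw [hinj hx' hy' hxy]
  have he : Topology.IsEmbedding (AddCircle.liftIco T a f) :=
    (hc.isClosedEmbedding hi).isEmbedding
  exact ⟨range (AddCircle.liftIco T a f),
    ⟨he.toHomeomorph.symm.trans (AddCircle.homeomorphCircle hT.ne')⟩⟩

theorem circle_core (a b : ℝ → X) (ha : Continuous a) (hb : Continuous b) {s u c d : ℝ}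
    (hsu : s < u) (hcd : c < d) (hs : a s = b c) (hu : a u = b d)
    (hai : InjOn a (Icc s u)) (hbi : InjOn b (Icc c d))
    (hdis : ∀ x ∈ Ioo s u, ∀ y ∈ Icc c d, a x ≠ b y) :
    ∃ S : Set X, Nonempty (S ≃ₜ Circle) := by
  let f : ℝ → X := fun t => if t ≤ u then a t else b (d - (t - u))
  have hf : Continuous f := by
    apply Continuous.if_le ha (by fun_prop) continuous_id continuous_const
    intro x hx
    simp only [id] at hx
    rw [hx, hu]; simp
  have key : ∀ x ∈ Ico s (s + (u - s + (d - c))), ∀ y ∈ Ico s (s + (u - s + (d - c))),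
      x ≤ u → u < y → f x ≠ f y := by
    intro x hx y hy hxu huy he
    simp only [f, if_pos hxu, if_neg (not_le.2 huy)] at he
    have h1 := hx.1
    have h2 := hy.2
    have hm : d - (y - u) ∈ Icc c d := ⟨by linarith, by linarith⟩
    rcases eq_or_lt_of_le h1 with h | h
    · subst h
      rw [hs] at he
      have := hbi ⟨le_rfl, hcd.le⟩ hm he
      linarith
    · rcases eq_or_lt_of_le hxu with h' | h'
      · subst h'
        rw [hu] at he
        have := hbi ⟨hcd.le, le_rfl⟩ hm he
        linarith
      · exact hdis x ⟨h, h'⟩ _ hm he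
  refine circle_of_loop f s (u - s + (d - c)) (by linarith) hf ?_ ?_
  · have h1 : ¬ (s + (u - s + (d - c)) ≤ u) := by linarith
    simp only [f, if_pos hsu.le, if_neg h1, hs]
    congr 1; ring
  · intro x hx y hy he
    rcases le_or_gt x u with hxu | hxu <;> rcases le_or_gt y u with hyu | hyu
    · simp only [f, if_pos hxu, if_pos hyu] at he
      exact hai ⟨hx.1, hxu⟩ ⟨hy.1, hyu⟩ he
    · exact (key x hx y hy hxu hyu he).elim
    · exact (key y hy x hx hyu hxu he.symm).elim
    · simp only [f, if_neg (not_le.2 hxu), if_neg (not_le.2 hyu)] at he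
      have h1 := hx.2
      have h2 := hy.2
      have := hbi (⟨by linarith, by linarith⟩ : d - (x - u) ∈ Icc c d)
        (⟨by linarith, by linarith⟩ : d - (y - u) ∈ Icc c d) he
      linarith

theorem circle_of_arcs (a b : ℝ → X) (ha : Continuous a) (hb : Continuous b)
    (hai : InjOn a (Icc 0 1)) (hbi : InjOn b (Icc 0 1))
    (h0 : a 0 ∈ b '' Icc 0 1) (h1 : a 1 ∈ b '' Icc 0 1) {t : ℝ} (ht : t ∈ Icc (0 : ℝ) 1)
    (hta : a t ∉ b '' Icc 0 1) : ∃ S : Set X, Nonempty (S ≃ₜ Circle) := by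
  have hB : IsClosed (b '' Icc 0 1) := (isCompact_Icc.image hb).isClosed
  have hK : IsClosed (a ⁻¹' (b '' Icc 0 1)) := hB.preimage ha
  obtain ⟨s, ⟨hs1, hs2⟩, hsm⟩ := (isCompact_Icc (a := (0 : ℝ)) (b := t)).inter_right hK
    |>.exists_isGreatest ⟨0, ⟨le_rfl, ht.1⟩, h0⟩
  obtain ⟨u, ⟨hu1, hu2⟩, hum⟩ := (isCompact_Icc (a := t) (b := (1 : ℝ))).inter_right hK
    |>.exists_isLeast ⟨1, ⟨ht.2, le_rfl⟩, h1⟩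
  have hst : s < t := lt_of_le_of_ne hs1.2 (by rintro rfl; exact hta hs2)
  have htu : t < u := lt_of_le_of_ne hu1.1 (by rintro rfl; exact hta hu2)
  have hdis : ∀ x ∈ Ioo s u, a x ∉ b '' Icc 0 1 := by
    intro x hx hxb
    rcases le_total x t with h | h
    · exact absurd (hsm ⟨⟨hs1.1.trans hx.1.le, h⟩, hxb⟩) (not_le.2 hx.1)
    · exact absurd (hum ⟨⟨h, hx.2.le.trans hu1.2⟩, hxb⟩) (not_le.2 hx.2)
  obtain ⟨c, hc, hcs⟩ := hs2
  obtain ⟨d, hd, hdu⟩ := hu2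
  have hai' : InjOn a (Icc s u) := hai.mono (Icc_subset_Icc hs1.1 hu1.2)
  have hne : c ≠ d := by
    rintro rfl
    have := hai ⟨hs1.1, by linarith [ht.2]⟩ ⟨by linarith [ht.1], hu1.2⟩ (hcs.symm.trans hdu)
    linarith
  rcases lt_or_gt_of_ne hne with h | h
  · refine circle_core a b ha hb (hst.trans htu) h hcs.symm hdu.symm hai'
      (hbi.mono (Icc_subset_Icc hc.1 hd.2)) ?_
    intro x hx y hy he
    exact hdis x hx ⟨y, ⟨hc.1.trans hy.1, hy.2.trans hd.2⟩, he.symm⟩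
  · refine circle_core a (fun z => b (-z)) ha (by fun_prop) (c := -c) (d := -d)
      (hst.trans htu) (by linarith) (by simp [hcs]) (by simp [hdu]) hai' ?_ ?_
    · intro x hx y hy he
      have := hbi (⟨by linarith [hx.2, hd.1], by linarith [hx.1, hc.2]⟩ : -x ∈ Icc (0 : ℝ) 1)
        (⟨by linarith [hy.2, hd.1], by linarith [hy.1, hc.2]⟩ : -y ∈ Icc (0 : ℝ) 1) he
      linarith
    · intro x hx y hy he
      exact hdis x hx ⟨-y, ⟨by linarith [hy.2, hd.1], by linarith [hy.1, hc.2]⟩, he.symm⟩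

theorem path_extend_injOn {x y : X} (α : Path x y) (h : Function.Injective α) :
    InjOn α.extend (Icc 0 1) := by
  intro s hs t ht he
  rw [Path.extend_apply _ hs, Path.extend_apply _ ht] at he
  exact congrArg Subtype.val (h he)

theorem path_extend_image {x y : X} (α : Path x y) : α.extend '' Icc 0 1 = range α := by
  ext z
  constructor
  · rintro ⟨t, ht, rfl⟩
    exact ⟨⟨t, ht⟩, (Path.extend_apply _ ht).symm⟩
  · rintro ⟨t, rfl⟩
    exact ⟨t, t.2, Path.extend_apply _ t.2⟩

theorem arc_subset_of_no_circle (hno : ¬ ∃ S : Set X, Nonempty (S ≃ₜ Circle)) {x y : X}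
    (α β : Path x y) (hα : Function.Injective α) (hβ : Function.Injective β) :
    range α ⊆ range β := by
  rintro _ ⟨t, rfl⟩
  by_contra hc
  apply hno
  refine circle_of_arcs α.extend β.extend α.continuous_extend β.continuous_extend
    (path_extend_injOn α hα) (path_extend_injOn β hβ) ?_ ?_ t.2 ?_
  · rw [path_extend_image, Path.extend_zero]; exact ⟨0, β.source⟩
  · rw [path_extend_image, Path.extend_one]; exact ⟨1, β.target⟩
  · rw [path_extend_image, Path.extend_apply _ t.2]; exact hc

end CircleLemma

section Build

variable {X : Type*} [MetricSpace X] [CompactSpace X] [LocallyConnectedSpace X]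

theorem arc_min (hno : ¬ ∃ S : Set X, Nonempty (S ≃ₜ Circle)) {x y : X} (hxy : x ≠ y)
    (α : Path x y) (hα : Function.Injective α) (C : Set X) (hC : IsPreconnected C)
    (hx : x ∈ C) (hy : y ∈ C) : range α ⊆ C := by
  have hL : LocallyPathConnectedSpace X := locPath
  intro p hp
  by_contra hpC
  have hCs : C ⊆ ({p}ᶜ : Set X) := fun z hz hzp => hpC (hzp ▸ hz)
  have hsub : C ⊆ connectedComponentIn ({p}ᶜ : Set X) x :=
    hC.subset_connectedComponentIn hx hCs
  have hopen : IsOpen (connectedComponentIn ({p}ᶜ : Set X) x) :=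
    isOpen_compl_singleton.connectedComponentIn
  have hcon : IsConnected (connectedComponentIn ({p}ᶜ : Set X) x) :=
    isConnected_connectedComponentIn_iff.2 (hCs hx)
  have hJ := (hopen.isConnected_iff_isPathConnected.1 hcon).joinedIn x (hsub hx) y (hsub hy)
  obtain ⟨β, hβr, hβ⟩ := exists_arc hxy hJ.somePath
  have h1 := hβr (arc_subset_of_no_circle hno α β hα hβ hp)
  obtain ⟨t, ht⟩ := h1
  have h2 := connectedComponentIn_subset _ _ (hJ.somePath_mem t)
  exact h2 ht

theorem exists_arcSet [ConnectedSpace X] (hno : ¬ ∃ S : Set X, Nonempty (S ≃ₜ Circle))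
    (x y : X) : ∃ J : Set X, IsPreconnected J ∧ IsClosed J ∧ x ∈ J ∧ y ∈ J ∧
      (∀ C : Set X, IsPreconnected C → x ∈ C → y ∈ C → J ⊆ C) ∧
      (∀ p ∈ J, p ≠ y → ∃ C : Set X, IsPreconnected C ∧ x ∈ C ∧ p ∈ C ∧ y ∉ C) := by
  have hL : LocallyPathConnectedSpace X := locPath
  rcases eq_or_ne x y with rfl | hxy
  · exact ⟨{x}, isPreconnected_singleton, isClosed_singleton, rfl, rfl,
      fun C _ h _ => singleton_subset_iff.2 h, fun p hp hne => (hne hp).elim⟩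
  · have hP : PathConnectedSpace X := pathConnectedSpace_iff_connectedSpace.2 inferInstance
    obtain ⟨α, -, hα⟩ := exists_arc hxy (PathConnectedSpace.somePath x y)
    refine ⟨range α, isPreconnected_range α.continuous,
      (isCompact_range α.continuous).isClosed, ⟨0, α.source⟩, ⟨1, α.target⟩,
      arc_min hno hxy α hα, ?_⟩
    rintro _ ⟨t, rfl⟩ hne
    refine ⟨α '' Iic t, isPreconnected_Iic.image _ α.continuous.continuousOn,
      ⟨0, t.2.1, α.source⟩, ⟨t, mem_Iic.2 le_rfl, rfl⟩, ?_⟩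
    rintro ⟨s, hs, hsy⟩
    have h1 : s = 1 := hα (hsy.trans α.target.symm)
    subst h1
    have h2 : t = 1 := le_antisymm t.2.2 hs
    subst h2
    exact hne α.target

theorem exists_arcSys [ConnectedSpace X] (hno : ¬ ∃ S : Set X, Nonempty (S ≃ₜ Circle)) :
    Nonempty (ArcSys X) := by
  choose J h1 h2 h3 h4 h5 h6 using fun x y : X => exists_arcSet hno x y
  refine ⟨⟨J, h1, h2, h3, h4, h5, ?_⟩⟩
  intro x y p hp hne hy
  obtain ⟨C, hC, hx, hpC, hyC⟩ := h6 x y p hp hne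
  exact hyC (h5 x p C hC hx hpC hy)

end Build

/-- Tits alternative for dendrites: a group acting by homeomorphisms on a dendrite
either contains a non-abelian free subgroup or acts elementarily. -/
theorem dendrite_tits_alternative (G X : Type*) [Group G] [TopologicalSpace X]
    [MulAction G X] (hcont : ∀ g : G, Continuous fun x : X => g • x)
    (hX : IsDendrite X) :
    (∃ f : FreeGroup (Fin 2) →* G, Function.Injective f) ∨ ElementaryAction G X := by
  obtain ⟨_, hK, hC, hM, hLC, hno⟩ := hX
  letI : MetricSpace X := TopologicalSpace.metrizableSpaceMetric X
  obtain ⟨A⟩ := exists_arcSys hno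
  exact A.main hcont
end
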